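/- arXiv:2204.01036 — 2 statements merged into one kernel-verified Lean document; each statement's English description precedes it below -/
import Mathlib

section
/- If the Riemann Hypothesis is false (i.e., there exists a zero of 2ξ with real part strictly greater than 1/2), then Λ_n < 0 for infinitely many n: the set {n : ℕ | Λ_n < 0} is infinite. -/
open scoped Nat BigOperators

/-- The completed Riemann zeta function `2ξ(s) = s(s-1)π^{-s/2}Γ(s/2)ζ(s)`,
extended by its (entire) values `1` at `s = 0, 1`. -/
noncomputable def xi2 (s : ℂ) : ℂ :=
  if s = 0 ∨ s = 1 then 1
  else s * (s - 1) * (Real.pi : ℂ) ^ (-s / 2) * Complex.Gamma (s / 2) * riemannZeta s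

/-- The coefficients `A_{nm} = 2^{m-n} (2(n+m)-1)!! / ((2m-1)(n-m)!(2m)!)`. -/
noncomputable def A (n m : ℕ) : ℝ :=
  (2 : ℝ) ^ ((m : ℤ) - (n : ℤ)) * (Nat.doubleFactorial (2 * (n + m) - 1) : ℝ) /
    ((2 * (m : ℝ) - 1) * (Nat.factorial (n - m) : ℝ) * (Nat.factorial (2 * m) : ℝ))

/-- `Φ_m = log 2ξ(2m)`, a real number (the value `2ξ(2m)` is a positive real). -/
noncomputable def PhiVal (m : ℕ) : ℝ := (Complex.log (xi2 (2 * m))).re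

/-- The closed-form variant `Λ_n` of the Keiper sequence. -/
noncomputable def Lambda (n : ℕ) : ℝ := ∑ m ∈ Finset.Icc 1 n, (-1 : ℝ) ^ m * A n m * PhiVal m

open Complex MeasureTheory ProbabilityTheory Filter Topology in
theorem exists_nonneg_riemannZeta_eq : ∃ T : ℂ → ℂ, AnalyticOnNhd ℂ T {s | 0 < s.re} ∧
    (∀ s : ℝ, ∃ r : ℝ, 0 ≤ r ∧ T s = r) ∧
    ∀ s : ℂ, 1 < s.re → riemannZeta s = s / (s - 1) - s * T s := by
  set μ : Measure ℝ := (volume.restrict (Set.Ioi 1)).withDensity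
    (fun t => ENNReal.ofReal (Int.fract t / t)) with hμ
  set X : ℝ → ℝ := fun t => - Real.log t with hX
  have hXm : Measurable X := Real.measurable_log.neg
  have hdm : Measurable (fun t : ℝ => Int.fract t / t) := measurable_fract.div measurable_id
  have hint : ∀ s : ℝ, 0 < s → s ∈ integrableExpSet X μ := by
    intro s hs
    rw [integrableExpSet, Set.mem_ofPred_eq, hμ,
      integrable_withDensity_iff hdm.ennreal_ofReal (by simp)]
    have h1 : IntegrableOn (fun t : ℝ => t ^ (-s - 1)) (Set.Ioi 1) :=
      integrableOn_Ioi_rpow_of_lt (by linarith) one_pos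
    refine h1.mono' ?_ ?_
    · exact Measurable.aestronglyMeasurable (by fun_prop)
    · filter_upwards [ae_restrict_mem measurableSet_Ioi] with t ht
      have ht : (1:ℝ) < t := ht
      have h0 : 0 < t := by linarith
      have hf := Int.fract_nonneg t
      have hf1 := (Int.fract_lt_one t).le
      rw [ENNReal.toReal_ofReal (by positivity), Real.norm_of_nonneg (by positivity),
        Real.rpow_sub h0, Real.rpow_one, Real.rpow_def_of_pos h0, hX, div_eq_mul_inv,
        div_eq_mul_inv]
      rw [show s * -Real.log t = Real.log t * -s by ring]
      have : 0 ≤ t⁻¹ := by positivity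
      gcongr
      exact mul_le_of_le_one_left this hf1
  have hsub : ∀ s : ℝ, 0 < s → s ∈ interior (integrableExpSet X μ) := fun s hs =>
    mem_interior.2 ⟨Set.Ioi 0, fun x hx => hint x hx, isOpen_Ioi, hs⟩
  refine ⟨complexMGF X μ, fun s hs => analyticAt_complexMGF (hsub _ hs), fun s => 
    ⟨mgf X μ s, mgf_nonneg, complexMGF_ofReal s⟩, fun s hs => ?_⟩
  have hs0 : s ≠ 0 := by rintro rfl; simp at hs; linarith
  have hs1 : s - 1 ≠ 0 := by
    intro h; rw [sub_eq_zero] at h; subst h; simp at hs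
  have hO : (fun n : ℕ => ∑ k ∈ Finset.Icc 1 n, ‖(fun _ => 1 : ℕ → ℂ) k‖) =O[atTop]
      fun n => (n : ℝ) ^ (1:ℝ) := by
    simp
    exact Asymptotics.isBigO_refl _ _
  have hL := LSeries_eq_mul_integral' (fun _ => 1 : ℕ → ℂ) zero_le_one hs hO
  have hL' : LSeries (fun _ => 1 : ℕ → ℂ) s = riemannZeta s := LSeries_one_eq_riemannZeta hs
  rw [← hL', hL]
  have hI1 : IntegrableOn (fun t : ℝ => (t : ℂ) ^ (-s)) (Set.Ioi 1) :=
    integrableOn_Ioi_cpow_of_lt (by simp; linarith) one_pos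
  have hM : complexMGF X μ s =
      ∫ t in Set.Ioi (1:ℝ), ((Int.fract t : ℝ) : ℂ) * (t : ℂ) ^ (-(s + 1)) := by
    rw [complexMGF, hμ, integral_withDensity_eq_integral_toReal_smul hdm.ennreal_ofReal (by simp)]
    refine setIntegral_congr_fun measurableSet_Ioi fun t ht => ?_
    have ht : (1:ℝ) < t := ht
    have h0 : 0 < t := by linarith
    have h0' : (t : ℂ) ≠ 0 := by exact_mod_cast h0.ne'
    rw [ENNReal.toReal_ofReal (div_nonneg (Int.fract_nonneg t) h0.le), neg_add, cpow_add _ _ h0',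
      cpow_neg_one, cpow_def_of_ne_zero h0', hX, real_smul, ← ofReal_log h0.le]
    push_cast
    ring_nf
  have hI2 : IntegrableOn (fun t : ℝ => ((Int.fract t : ℝ) : ℂ) * (t : ℂ) ^ (-(s + 1)))
      (Set.Ioi 1) := by
    have h2 : IntegrableOn (fun t : ℝ => (t : ℂ) ^ (-(s + 1))) (Set.Ioi 1) :=
      integrableOn_Ioi_cpow_of_lt (by simp; linarith) one_pos
    refine Integrable.bdd_mul (c := 1) h2 ?_ ?_
    · exact (measurable_ofReal.comp measurable_fract).aestronglyMeasurable
    · filter_upwards with t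
      rw [norm_real, Real.norm_of_nonneg (Int.fract_nonneg t)]
      exact (Int.fract_lt_one t).le
  have hsplit : ∫ t in Set.Ioi (1:ℝ), (∑ k ∈ Finset.Icc 1 ⌊t⌋₊, (1:ℂ)) * (t:ℂ) ^ (-(s + 1)) =
      (∫ t in Set.Ioi (1:ℝ), (t : ℂ) ^ (-s)) - complexMGF X μ s := by
    rw [hM, ← integral_sub hI1 hI2]
    refine setIntegral_congr_fun measurableSet_Ioi fun t ht => ?_
    have ht : (1:ℝ) < t := ht
    have h0 : 0 < t := by linarith
    have h0' : (t : ℂ) ≠ 0 := by exact_mod_cast h0.ne'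
    have e1 : (t : ℂ) ^ (-s) = t * (t : ℂ) ^ (-(s + 1)) := by
      rw [neg_add, cpow_add _ _ h0', cpow_neg_one]; field_simp
    have e2 : (Int.fract t : ℝ) = t - (⌊t⌋₊ : ℝ) := by
      rw [natCast_floor_eq_intCast_floor h0.le]; rfl
    rw [e1, e2]
    simp
    ring
  rw [hsplit, integral_Ioi_cpow_of_lt (by simp; linarith) one_pos]
  have : -s + 1 ≠ 0 := by intro h; apply hs1; linear_combination -h
  simp
  field_simp
  rw [show -s + 1 = -(s-1) by ring]
  ring

open Complex in
theorem riemannZeta_ne_zero_of_mem_Ioo {s : ℝ} (h0 : 0 < s) (h1 : s < 1) :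
    riemannZeta s ≠ 0 := by
  obtain ⟨T, hT, hTr, hTz⟩ := exists_nonneg_riemannZeta_eq
  have hpre : IsPreconnected {s : ℂ | 0 < s.re} := (convex_halfSpace_re_gt 0).isPreconnected
  have hopen : IsOpen {s : ℂ | 1 < s.re} := isOpen_lt continuous_const continuous_re
  have ha : AnalyticOnNhd ℂ riemannZeta₁ {s | 0 < s.re} :=
    fun s _ => differentiable_riemannZeta₁.analyticAt s
  have hb : AnalyticOnNhd ℂ (fun s => s - s * (s - 1) * T s) {s | 0 < s.re} := 
    fun s hs => by
      have := hT s hs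
      fun_prop
  have heq := ha.eqOn_of_preconnected_of_eventuallyEq hb hpre (z₀ := 2) (by simp) (by
    filter_upwards [hopen.mem_nhds (show (2:ℂ) ∈ {s : ℂ | 1 < s.re} by simp)] with s hs
    have hs1 : s ≠ 1 := by rintro rfl; simp at hs
    have h2 : s - 1 ≠ 0 := sub_ne_zero.2 hs1
    have := riemannZeta_eq_inv_sub_mul hs1
    rw [hTz s hs] at this
    field_simp at this
    linear_combination -this)
  have hs1 : (s : ℂ) ≠ 1 := by exact_mod_cast h1.ne
  have := heq (show (s : ℂ) ∈ {s : ℂ | 0 < s.re} by simpa using h0)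
  rw [riemannZeta_eq_inv_sub_mul hs1, this]
  obtain ⟨r, hr, hTs⟩ := hTr s
  simp only [hTs]
  refine mul_ne_zero (inv_ne_zero (sub_ne_zero.2 hs1)) ?_
  have : 0 < s - s * (s - 1) * r := by
    have : 0 ≤ s * (1 - s) * r := by 
      have : 0 < 1 - s := by linarith
      positivity
    nlinarith
  exact_mod_cast this.ne'

open Complex in
theorem xi2_eq_completedRiemannZeta₀ {s : ℂ} (hs : 0 < s.re) :
    xi2 s = 1 + s * (s - 1) * completedRiemannZeta₀ s := by
  have hs0 : s ≠ 0 := by rintro rfl; simp at hs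
  rw [xi2]
  split_ifs with h
  · rcases h with rfl | rfl <;> simp
  · push Not at h
    have h1 : s - 1 ≠ 0 := sub_ne_zero.2 h.2
    have h1' : 1 - s ≠ 0 := sub_ne_zero.2 h.2.symm
    have hG := Gammaℝ_ne_zero_of_re_pos hs
    rw [riemannZeta_def_of_ne_zero hs0, completedRiemannZeta_eq]
    rw [show s * (s - 1) * (Real.pi : ℂ) ^ (-s / 2) * Gamma (s / 2) *
      ((completedRiemannZeta₀ s - 1 / s - 1 / (1 - s)) / s.Gammaℝ) =
      s * (s - 1) * ((Real.pi : ℂ) ^ (-s / 2) * Gamma (s / 2)) *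
      ((completedRiemannZeta₀ s - 1 / s - 1 / (1 - s)) / s.Gammaℝ) by ring, ← Gammaℝ_def]
    field_simp
    ring

open Complex in
theorem analyticOnNhd_xi2 : AnalyticOnNhd ℂ xi2 {s | 0 < s.re} := by
  refine DifferentiableOn.analyticOnNhd ?_ (isOpen_lt continuous_const continuous_re)
  have h : Differentiable ℂ fun s : ℂ => 1 + s * (s - 1) * completedRiemannZeta₀ s := by
    have := differentiable_completedZeta₀
    fun_prop
  exact h.differentiableOn.congr fun s hs => xi2_eq_completedRiemannZeta₀ hs

open Complex in
theorem xi2_ne_zero_of_riemannZeta_ne_zero {s : ℂ} (hs : 0 < s.re)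
    (h : s ≠ 1 → riemannZeta s ≠ 0) : xi2 s ≠ 0 := by
  rw [xi2]
  split_ifs with h'
  · exact one_ne_zero
  · push Not at h'
    have : Real.pi ≠ 0 := Real.pi_ne_zero
    refine mul_ne_zero (mul_ne_zero (mul_ne_zero (mul_ne_zero h'.1 (sub_ne_zero.2 h'.2)) ?_) ?_)
      (h h'.2)
    · simp [cpow_eq_zero_iff]
    · exact Gamma_ne_zero_of_re_pos (by simpa using hs)

open Complex in
theorem xi2_two_mul {y : ℂ} (hy : 0 < y.re) (hy' : 2 * y ≠ 1) :
    xi2 (2 * y) = 2 * (2 * y - 1) * (Real.pi : ℂ) ^ (-y) * Gamma (y + 1) *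
      riemannZeta (2 * y) := by
  have hy0 : y ≠ 0 := by rintro rfl; simp at hy
  rw [xi2, if_neg (by simp [hy0, hy']), Gamma_add_one y hy0]
  rw [show -(2 * y) / 2 = -y by ring, show 2 * y / 2 = y by ring]
  ring

open Complex in
theorem norm_log_one_add_le_of_re_nonneg {u : ℂ} (hu : 0 ≤ u.re) :
    ‖log (1 + u)‖ ≤ ‖u‖ ∧ ‖u - log (1 + u)‖ ≤ ‖u‖ ^ 2 := by
  have hmem : ∀ x : ℂ, 0 ≤ x.re → 1 + x ∈ slitPlane := fun x hx =>
    Or.inl (by simp; linarith)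
  have hn : ∀ x : ℂ, 0 ≤ x.re → 1 ≤ ‖1 + x‖ := fun x hx =>
    le_trans (by simpa using hx) (re_le_norm (1 + x))
  have hd : ∀ x : ℂ, 0 ≤ x.re → HasDerivAt (fun z => log (1 + z)) ((1 + x)⁻¹) x := fun x hx => by
    simpa using ((hasDerivAt_id x).const_add 1).clog (hmem x hx)
  constructor
  · have := Convex.norm_image_sub_le_of_norm_hasDerivWithin_le (C := 1) (x := 0) (y := u)
      (s := {z : ℂ | 0 ≤ z.re})
      (fun x hx => (hd x hx).hasDerivWithinAt)
      (fun x hx => by rw [norm_inv]; exact inv_le_one_of_one_le₀ (hn x hx))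
      (convex_halfSpace_re_ge 0) (by simp) hu
    simpa using this
  · have := Convex.norm_image_sub_le_of_norm_hasDerivWithin_le (C := ‖u‖) (x := 0) (y := u)
      (f := fun z => z - log (1 + z)) (s := {z : ℂ | 0 ≤ z.re} ∩ Metric.closedBall 0 ‖u‖)
      (fun x hx => ((hasDerivAt_id x).sub (hd x hx.1)).hasDerivWithinAt)
      (fun x hx => by
        have h1 := hn x hx.1
        have h2 : (1 + x) ≠ 0 := norm_pos_iff.1 (by linarith)
        have h3 : ‖x‖ ≤ ‖u‖ := by simpa using hx.2
        rw [show 1 - (1 + x)⁻¹ = x / (1 + x) by field_simp; ring, norm_div]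
        exact (div_le_self (norm_nonneg _) h1).trans h3)
      ((convex_halfSpace_re_ge 0).inter (convex_closedBall 0 _)) (by simp) ⟨hu, by simp⟩
    simpa [sq] using this

/-- The terms of the series expansion of `log Γ(y + 1)` coming from Euler's product. -/
noncomputable def logGammaTerm (j : ℕ) (y : ℂ) : ℂ :=
  y * Complex.log (1 + 1 / (j + 1)) - Complex.log (1 + y / (j + 1))

open Complex in
theorem norm_logGammaTerm_le (j : ℕ) {y : ℂ} (hy : 0 ≤ y.re) :
    ‖logGammaTerm j y‖ ≤ 2 * (1 + ‖y‖) ^ (5 / 4 : ℝ) * ((j : ℝ) + 1) ^ (-(5 / 4) : ℝ) := by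
  have hJ : (0:ℝ) < j + 1 := by positivity
  have hnJ : ‖(j : ℂ) + 1‖ = j + 1 := by
    rw [show (j : ℂ) + 1 = ((j + 1 : ℝ) : ℂ) by push_cast; rfl, norm_real,
      Real.norm_of_nonneg hJ.le]
  have hre : ∀ z : ℂ, 0 ≤ z.re → 0 ≤ (z / (j + 1)).re := fun z hz => by
    rw [show (j : ℂ) + 1 = ((j + 1 : ℝ) : ℂ) by push_cast; rfl, div_ofReal_re]
    positivity
  obtain ⟨a1, a2⟩ := norm_log_one_add_le_of_re_nonneg (hre 1 (by simp))
  obtain ⟨b1, b2⟩ := norm_log_one_add_le_of_re_nonneg (hre y hy)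
  rw [norm_div, hnJ] at a1 a2 b1 b2
  rw [norm_one] at a1 a2
  set J : ℝ := j + 1
  set t : ℝ := (1 + ‖y‖) / J with ht
  have hy0 := norm_nonneg y
  have ht0 : 0 < t := by positivity
  have hyJ : ‖y‖ / J ≤ t := by rw [ht]; gcongr; linarith
  have e1 : ‖logGammaTerm j y‖ ≤ 2 * t := by
    refine (norm_sub_le _ _).trans ?_
    rw [norm_mul]
    have : ‖y‖ * ‖log (1 + 1 / ((j : ℂ) + 1))‖ ≤ ‖y‖ / J := by
      exact (mul_le_mul_of_nonneg_left a1 hy0).trans_eq (mul_one_div _ _)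
    linarith
  have e2 : ‖logGammaTerm j y‖ ≤ 2 * t ^ 2 := by
    have : logGammaTerm j y = -(y * (1 / ((j : ℂ) + 1) - log (1 + 1 / (j + 1)))) +
        (y / (j + 1) - log (1 + y / (j + 1))) := by rw [logGammaTerm]; ring
    rw [this]
    refine (norm_add_le _ _).trans ?_
    rw [norm_neg, norm_mul]
    have h1 : ‖y‖ * ‖1 / ((j : ℂ) + 1) - log (1 + 1 / (j + 1))‖ ≤ ‖y‖ * (1 / J) ^ 2 := by gcongr
    have h2 : ‖y‖ * (1 / J) ^ 2 ≤ t ^ 2 := by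
      rw [ht, div_pow, div_pow, one_pow, mul_one_div]; gcongr; nlinarith
    have h3 : (‖y‖ / J) ^ 2 ≤ t ^ 2 := by gcongr
    linarith
  have e3 : ‖logGammaTerm j y‖ ≤ 2 * t ^ (5 / 4 : ℝ) := by
    rcases le_total t 1 with h | h
    · refine e2.trans ?_
      have := Real.rpow_le_rpow_of_exponent_ge ht0 h (show (5 / 4 : ℝ) ≤ 2 by norm_num)
      rw [Real.rpow_two] at this
      linarith
    · refine e1.trans ?_
      have := Real.rpow_le_rpow_of_exponent_le h (show (1 : ℝ) ≤ 5 / 4 by norm_num)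
      rw [Real.rpow_one] at this
      linarith
  refine e3.trans (le_of_eq ?_)
  rw [ht, Real.div_rpow (by positivity) hJ.le, Real.rpow_neg hJ.le]
  ring

theorem summable_nat_add_one_rpow_neg_five_quarters :
    Summable fun j : ℕ => ((j : ℝ) + 1) ^ (-(5 / 4) : ℝ) := by
  have := (summable_nat_add_iff 1).2 (Real.summable_nat_rpow (p := -(5 / 4)).2 (by norm_num))
  simpa using this

/-- A holomorphic logarithm of `Γ(y + 1)` on the right half-plane. -/
noncomputable def logGammaAddOne (y : ℂ) : ℂ := ∑' j : ℕ, logGammaTerm j y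

open Complex in
theorem differentiableOn_logGammaAddOne : DifferentiableOn ℂ logGammaAddOne {y | 0 < y.re} := by
  intro y hy
  have hopen : IsOpen ({y : ℂ | 0 < y.re} ∩ Metric.ball 0 (‖y‖ + 1)) :=
    (isOpen_lt continuous_const continuous_re).inter Metric.isOpen_ball
  have := differentiableOn_tsum_of_summable_norm (F := logGammaTerm)
    (u := fun j : ℕ => 2 * (1 + (‖y‖ + 1)) ^ (5 / 4 : ℝ) * ((j : ℝ) + 1) ^ (-(5 / 4) : ℝ))
    (summable_nat_add_one_rpow_neg_five_quarters.mul_left _) (fun j => ?_) hopen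
    (fun j w hw => ?_)
  · exact (this.differentiableAt (hopen.mem_nhds ⟨hy, by simp⟩)).differentiableWithinAt
  · intro z hz
    have : 1 + z / ((j : ℂ) + 1) ∈ slitPlane := by
      left
      rw [show (j : ℂ) + 1 = ((j + 1 : ℝ) : ℂ) by push_cast; rfl, add_re, div_ofReal_re]
      have : 0 < z.re := hz.1
      simp
      positivity
    have h2 : DifferentiableAt ℂ (fun z : ℂ => 1 + z / ((j : ℂ) + 1)) z :=
      (differentiableAt_id.div_const _).const_add 1
    exact ((differentiableAt_id.mul_const (log (1 + 1 / ((j : ℂ) + 1)))).sub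
      (h2.clog this)).differentiableWithinAt
  · have hw0 : 0 < w.re := hw.1
    refine (norm_logGammaTerm_le j hw0.le).trans ?_
    have : ‖w‖ ≤ ‖y‖ + 1 := by simpa using (Metric.mem_ball.1 hw.2).le
    gcongr

open Complex in
theorem norm_logGammaAddOne_le {y : ℂ} (hy : 0 ≤ y.re) : ‖logGammaAddOne y‖ ≤
    2 * (1 + ‖y‖) ^ (5 / 4 : ℝ) * ∑' j : ℕ, ((j : ℝ) + 1) ^ (-(5 / 4) : ℝ) :=
  tsum_of_norm_bounded (summable_nat_add_one_rpow_neg_five_quarters.hasSum.mul_left _)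
    fun j => norm_logGammaTerm_le j hy

open Complex Filter Topology in
theorem exp_logGammaAddOne {y : ℂ} (hy : 0 < y.re) : exp (logGammaAddOne y) = Gamma (y + 1) := by
  have hy0 : y ≠ 0 := by rintro rfl; simp at hy
  have hs : Summable fun j => logGammaTerm j y :=
    .of_norm_bounded (summable_nat_add_one_rpow_neg_five_quarters.mul_left _)
      fun j => norm_logGammaTerm_le j hy.le
  have h1 : Tendsto (fun n => exp (∑ j ∈ Finset.range n, logGammaTerm j y)) atTop
      (𝓝 (exp (logGammaAddOne y))) := (continuous_exp.tendsto _).comp hs.hasSum.tendsto_sum_nat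
  have hne : ∀ j : ℕ, y + j ≠ 0 := fun j h => by
    have := congrArg re h
    simp at this
    have : (0:ℝ) ≤ j := by positivity
    linarith
  have hj : ∀ j : ℕ, (j : ℂ) + 1 ≠ 0 := fun j => Nat.cast_add_one_ne_zero j
  have key : ∀ n : ℕ, exp (∑ j ∈ Finset.range n, logGammaTerm j y) =
      ((n : ℂ) + 1) ^ y * n.factorial / ∏ j ∈ Finset.range n, (y + (j + 1 : ℕ)) := by
    intro n
    induction n with
    | zero => simp
    | succ n ih =>
      rw [Finset.sum_range_succ, exp_add, ih, logGammaTerm, exp_sub, Finset.prod_range_succ,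
        exp_log (by
          rw [show 1 + y / ((n : ℂ) + 1) = (y + (n + 1 : ℕ)) / (n + 1) by
            push_cast; field_simp [hj n]; ring]
          exact div_ne_zero (hne _) (hj n)), Nat.factorial_succ]
      have h2 : ((n : ℂ) + 1 + 1) ^ y = ((n : ℂ) + 1) ^ y * exp (y * log (1 + 1 / (n + 1))) := by
        have e : (1 + 1 / ((n : ℂ) + 1)) = ((1 + 1 / ((n : ℝ) + 1) : ℝ) : ℂ) := by push_cast; rfl
        rw [mul_comm y, e, ← ofReal_log (by positivity), ofReal_log (by positivity),
          ← cpow_def_of_ne_zero (by exact_mod_cast (by positivity : (1 + 1 / ((n : ℝ) + 1)) ≠ 0)),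
          show (n : ℂ) + 1 + 1 = (((n : ℝ) + 1 + 1 : ℝ) : ℂ) by push_cast; rfl,
          show (n : ℂ) + 1 = (((n : ℝ) + 1 : ℝ) : ℂ) by push_cast; rfl,
          ← mul_cpow_ofReal_nonneg (by positivity) (by positivity), ← ofReal_mul]
        congr 2
        field_simp
      have h3 := hne (n + 1)
      have h4 : ∏ j ∈ Finset.range n, (y + (j + 1 : ℕ)) ≠ 0 :=
        Finset.prod_ne_zero_iff.2 fun j _ => hne _
      have h5 := hj n
      have h6 : 1 + y / ((n : ℂ) + 1) = (y + (n + 1 : ℕ)) / (n + 1) := by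
        push_cast; field_simp [hj n]; ring
      rw [h6]
      push_cast at h2 h3 h4 ⊢
      rw [h2]
      field_simp
  have h2 : Tendsto (fun n : ℕ => y * GammaSeq y (n + 1) * ((n + (y + 1)) / n)) atTop
      (𝓝 (y * Gamma y * 1)) := by
    refine Tendsto.mul (((tendsto_add_atTop_iff_nat 1).2 (GammaSeq_tendsto_Gamma y)).const_mul y) ?_
    have := (tendsto_natCast_div_add_atTop (𝕜 := ℂ) (y + 1)).inv₀ one_ne_zero
    simpa using this
  have h3 : Tendsto (fun n : ℕ => y * GammaSeq y (n + 1) * ((n + (y + 1)) / n) * (n / (n + 1)))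
      atTop (𝓝 (y * Gamma y * 1 * 1)) := h2.mul (tendsto_natCast_div_add_atTop (𝕜 := ℂ) 1)
  rw [Gamma_add_one y hy0]
  rw [mul_one, mul_one] at h3
  refine tendsto_nhds_unique h1 (h3.congr' ?_)
  filter_upwards [eventually_gt_atTop 0] with n hn
  rw [key, GammaSeq, Finset.prod_range_succ', Finset.prod_range_succ, Nat.factorial_succ]
  have h3 := hne (n + 1)
  have h4 : ∏ j ∈ Finset.range n, (y + (j + 1 : ℕ)) ≠ 0 :=
    Finset.prod_ne_zero_iff.2 fun j _ => hne _
  have h5 := hj n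
  have h6 : (n : ℂ) ≠ 0 := by exact_mod_cast hn.ne'
  push_cast at h3 h4 ⊢
  rw [add_zero]
  field_simp
  ring

/-- The logarithm of `ζ` given by the Euler product. -/
noncomputable def logZeta (s : ℂ) : ℂ := ∑' p : Nat.Primes, -Complex.log (1 - (p : ℂ) ^ (-s))

open Complex in
theorem norm_neg_log_one_sub_prime_cpow_le (p : Nat.Primes) {s : ℂ} {σ : ℝ} (hσ : 1 ≤ σ)
    (hs : σ ≤ s.re) : ‖(p : ℂ) ^ (-s)‖ ≤ 1 / 2 ∧
      ‖-log (1 - (p : ℂ) ^ (-s))‖ ≤ 3 / 2 * (p : ℝ) ^ (-σ) := by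
  have hp : (2 : ℝ) ≤ p := by exact_mod_cast p.2.two_le
  have hn : ‖(p : ℂ) ^ (-s)‖ = (p : ℝ) ^ (-s.re) := by
    rw [norm_natCast_cpow_of_pos p.2.pos, neg_re]
  have h1 : (p : ℝ) ^ (-s.re) ≤ (p : ℝ) ^ (-σ) :=
    Real.rpow_le_rpow_of_exponent_le (by linarith) (by linarith)
  have h2 : (p : ℝ) ^ (-σ) ≤ 1 / 2 := by
    refine (Real.rpow_le_rpow_of_exponent_le (by linarith) (neg_le_neg hσ)).trans ?_
    rw [Real.rpow_neg_one, ← one_div]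
    exact one_div_le_one_div_of_le (by norm_num) hp
  refine ⟨by rw [hn]; linarith, ?_⟩
  have := norm_log_one_add_half_le_self (z := -(p : ℂ) ^ (-s)) (by rw [norm_neg, hn]; linarith)
  rw [norm_neg, sub_eq_add_neg]
  rw [norm_neg, hn] at this
  linarith

theorem summable_primes_rpow_neg {σ : ℝ} (hσ : 1 < σ) :
    Summable fun p : Nat.Primes => 3 / 2 * (p : ℝ) ^ (-σ) :=
  (Nat.Primes.summable_rpow.2 (by linarith)).mul_left _

open Complex in
theorem differentiableOn_logZeta : DifferentiableOn ℂ logZeta {s | 1 < s.re} := by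
  intro s hs
  obtain ⟨σ, h1, h2⟩ := exists_between (show 1 < s.re from hs)
  have hopen : IsOpen {s : ℂ | σ < s.re} := isOpen_lt continuous_const continuous_re
  have := differentiableOn_tsum_of_summable_norm
    (F := fun (p : Nat.Primes) (s : ℂ) => -log (1 - (p : ℂ) ^ (-s)))
    (summable_primes_rpow_neg h1) (fun p z hz => ?_) hopen
    (fun p z hz => (norm_neg_log_one_sub_prime_cpow_le p h1.le (le_of_lt hz)).2)
  · exact (this.differentiableAt (hopen.mem_nhds h2)).differentiableWithinAt
  · have hz' := (norm_neg_log_one_sub_prime_cpow_le p h1.le (le_of_lt hz)).1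
    have hmem : 1 - (p : ℂ) ^ (-z) ∈ slitPlane := by
      left
      have := (re_le_norm _).trans hz'
      rw [sub_re, one_re]
      linarith
    have hp : (p : ℂ) ≠ 0 := by exact_mod_cast p.2.ne_zero
    have h3 : DifferentiableAt ℂ (fun z : ℂ => 1 - (p : ℂ) ^ (-z)) z :=
      (differentiableAt_id.neg.const_cpow (Or.inl hp)).const_sub 1
    exact (h3.clog hmem).neg.differentiableWithinAt

theorem norm_logZeta_le {s : ℂ} {σ : ℝ} (hσ : 1 < σ) (hs : σ ≤ s.re) :
    ‖logZeta s‖ ≤ ∑' p : Nat.Primes, 3 / 2 * (p : ℝ) ^ (-σ) :=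
  tsum_of_norm_bounded (summable_primes_rpow_neg hσ).hasSum
    fun p => (norm_neg_log_one_sub_prime_cpow_le p hσ.le hs).2

/-- A holomorphic logarithm of `y ↦ xi2 (2 * y)` on the half-plane `1 / 2 < re y`. -/
noncomputable def logXi2 (y : ℂ) : ℂ :=
  Complex.log 2 + Complex.log (2 * y - 1) - y * Complex.log Real.pi + logGammaAddOne y +
    logZeta (2 * y)

open Complex in
theorem two_mul_sub_one_mem_slitPlane {y : ℂ} (hy : 1 / 2 < y.re) : 2 * y - 1 ∈ slitPlane := by
  left
  simp
  linarith

open Complex in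
theorem differentiableOn_logXi2 : DifferentiableOn ℂ logXi2 {y | 1 / 2 < y.re} := by
  intro y hy
  have hy' : 1 / 2 < y.re := hy
  have h1 : DifferentiableAt ℂ logGammaAddOne y :=
    differentiableOn_logGammaAddOne.differentiableAt
      ((isOpen_lt continuous_const continuous_re).mem_nhds (show 0 < y.re by linarith))
  have h2 : DifferentiableAt ℂ (fun y => logZeta (2 * y)) y := by
    have : DifferentiableAt ℂ logZeta (2 * y) := differentiableOn_logZeta.differentiableAt
      ((isOpen_lt continuous_const continuous_re).mem_nhds (show 1 < (2 * y).re by simp; linarith))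
    exact this.comp y (differentiableAt_id.const_mul 2)
  have h3 : DifferentiableAt ℂ (fun y => log (2 * y - 1)) y :=
    ((differentiableAt_id.const_mul 2).sub_const 1).clog (two_mul_sub_one_mem_slitPlane hy)
  exact ((((h3.const_add (log 2)).sub (differentiableAt_id.mul_const (log Real.pi))).add h1).add
    h2).differentiableWithinAt

open Complex in
theorem exp_logXi2 {y : ℂ} (hy : 1 / 2 < y.re) : exp (logXi2 y) = xi2 (2 * y) := by
  have hne := slitPlane_ne_zero (two_mul_sub_one_mem_slitPlane hy)
  have h2y : 1 < (2 * y).re := by simp; linarith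
  rw [xi2_two_mul (by linarith) (sub_ne_zero.1 hne), logXi2, exp_add, exp_add,
    exp_logGammaAddOne (by linarith), exp_sub, exp_add, exp_log two_ne_zero, exp_log hne,
    logZeta, riemannZeta_eulerProduct_exp_log h2y,
    cpow_def_of_ne_zero (by exact_mod_cast Real.pi_ne_zero), mul_neg, exp_neg, mul_comm y]
  ring

theorem re_logXi2 {y : ℂ} (hy : 1 / 2 < y.re) : (logXi2 y).re = Real.log ‖xi2 (2 * y)‖ := by
  rw [← exp_logXi2 hy, Complex.norm_exp, Real.log_exp]

theorem re_logXi2_natCast {m : ℕ} (hm : 1 ≤ m) : (logXi2 m).re = PhiVal m := by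
  have : (1 : ℝ) ≤ m := by exact_mod_cast hm
  rw [re_logXi2 (by simp; linarith), PhiVal, Complex.log_re]

open Complex in
theorem exists_norm_logXi2_le :
    ∃ C : ℝ, ∀ y : ℂ, 3 / 5 ≤ y.re → ‖logXi2 y‖ ≤ C * (1 + ‖y‖) ^ (5 / 4 : ℝ) := by
  refine ⟨‖log 2‖ + (‖log ((1 / 5 : ℝ) : ℂ)‖ + 10) + ‖log Real.pi‖ +
    2 * (∑' j : ℕ, ((j : ℝ) + 1) ^ (-(5 / 4) : ℝ)) +
    ∑' p : Nat.Primes, 3 / 2 * (p : ℝ) ^ (-(6 / 5) : ℝ), fun y hy => ?_⟩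
  set t : ℝ := (1 + ‖y‖) ^ (5 / 4 : ℝ)
  have hy0 := norm_nonneg y
  have ht : 1 + ‖y‖ ≤ t := by
    have := Real.rpow_le_rpow_of_exponent_le (show 1 ≤ 1 + ‖y‖ by linarith)
      (show (1 : ℝ) ≤ 5 / 4 by norm_num)
    rwa [Real.rpow_one] at this
  have ht1 : 1 ≤ t := by linarith
  have h1 : ‖log 2‖ ≤ ‖log 2‖ * t := le_mul_of_one_le_right (norm_nonneg _) ht1
  have h2 : ‖log (2 * y - 1)‖ ≤ (‖log ((1 / 5 : ℝ) : ℂ)‖ + 10) * t := by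
    have hu : 0 ≤ (10 * y - 6).re := by
      simp
      linarith
    have hne : 1 + (10 * y - 6) ≠ 0 := fun h => by
      have := congrArg re h
      rw [add_re] at this
      simp only [one_re, zero_re] at this
      linarith
    have e : 2 * y - 1 = ((1 / 5 : ℝ) : ℂ) * (1 + (10 * y - 6)) := by push_cast; ring
    rw [e, log_ofReal_mul (by norm_num) hne, ofReal_log (by norm_num)]
    refine (norm_add_le _ _).trans ?_
    have h3 := (norm_log_one_add_le_of_re_nonneg hu).1
    have h4 : ‖10 * y - 6‖ ≤ 10 * t := by
      refine (norm_sub_le _ _).trans ?_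
      rw [norm_mul]
      simp
      linarith
    have h5 := le_mul_of_one_le_right (norm_nonneg (log ((1 / 5 : ℝ) : ℂ))) ht1
    linarith
  have h3 : ‖y * log Real.pi‖ ≤ ‖log Real.pi‖ * t := by
    rw [norm_mul, mul_comm]
    gcongr
    linarith
  have h4 := norm_logGammaAddOne_le (show 0 ≤ y.re by linarith)
  have h5 : ‖logZeta (2 * y)‖ ≤ (∑' p : Nat.Primes, 3 / 2 * (p : ℝ) ^ (-(6 / 5) : ℝ)) * t :=
    (norm_logZeta_le (by norm_num) (by simp; linarith)).trans
      (le_mul_of_one_le_right (tsum_nonneg fun p => by positivity) ht1)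
  have h6 : ‖logXi2 y‖ ≤ ‖log 2‖ + ‖log (2 * y - 1)‖ + ‖y * log Real.pi‖ + ‖logGammaAddOne y‖ +
      ‖logZeta (2 * y)‖ :=
    (norm_add_le _ _).trans (by gcongr; refine (norm_add_le _ _).trans (by
      gcongr; refine (norm_sub_le _ _).trans (by gcongr; exact norm_add_le _ _)))
  linarith

/-- The holomorphic function interpolating `PhiVal m / (m * (m - 1 / 2))`. -/
noncomputable def logXi2Quot (y : ℂ) : ℂ := logXi2 y / (y * (y - 1 / 2))

open Complex in
theorem differentiableOn_logXi2Quot : DifferentiableOn ℂ logXi2Quot {y | 1 / 2 < y.re} := by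
  refine differentiableOn_logXi2.div (by fun_prop) fun y hy => ?_
  have hy' : 1 / 2 < y.re := hy
  refine mul_ne_zero ?_ (sub_ne_zero.2 ?_)
  · rintro rfl
    simp at hy'
    linarith
  · rintro rfl
    simp at hy'

theorem exists_norm_logXi2Quot_le :
    ∃ C : ℝ, 0 ≤ C ∧ ∀ y : ℂ, 3 / 5 ≤ y.re → ‖logXi2Quot y‖ ≤ C * ‖y‖ ^ (-(3 / 4) : ℝ) := by
  obtain ⟨C, hC⟩ := exists_norm_logXi2_le
  have hC0 : 0 ≤ C := by
    have h := hC 1 (by norm_num)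
    have : 0 < (1 + ‖(1 : ℂ)‖) ^ (5 / 4 : ℝ) := Real.rpow_pos_of_pos (by simp) _
    exact nonneg_of_mul_nonneg_left ((norm_nonneg _).trans h) this
  refine ⟨C * 3 ^ (5 / 4 : ℝ) * 6, by positivity, fun y hy => ?_⟩
  have hn : 3 / 5 ≤ ‖y‖ := hy.trans (Complex.re_le_norm y)
  have hn0 : 0 < ‖y‖ := by linarith
  have h1 : ‖y‖ / 6 ≤ ‖y - 1 / 2‖ := by
    have := norm_sub_norm_le y (1 / 2)
    norm_num at this
    linarith
  rw [logXi2Quot, norm_div, norm_mul, div_le_iff₀ (mul_pos hn0 (by linarith))]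
  calc ‖logXi2 y‖ ≤ C * (1 + ‖y‖) ^ (5 / 4 : ℝ) := hC y hy
    _ ≤ C * (3 * ‖y‖) ^ (5 / 4 : ℝ) := by gcongr; linarith
    _ = C * 3 ^ (5 / 4 : ℝ) * 6 * ‖y‖ ^ (-(3 / 4) : ℝ) * (‖y‖ * (‖y‖ / 6)) := by
      rw [Real.mul_rpow (by norm_num) hn0.le,
        show (5 / 4 : ℝ) = -(3 / 4) + 2 by norm_num, Real.rpow_add hn0, Real.rpow_two]
      ring
    _ ≤ _ := by gcongr

open Finset in
theorem cast_doubleFactorial_two_mul_sub_one (k : ℕ) :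
    (Nat.doubleFactorial (2 * k - 1) : ℝ) = 2 ^ k * ∏ j ∈ range k, ((j : ℝ) + 1 / 2) := by
  induction k with
  | zero => simp
  | succ k ih =>
    have h : Nat.doubleFactorial (2 * (k + 1) - 1) = (2 * k + 1) * Nat.doubleFactorial (2 * k - 1) := by
      rcases k with _ | k
      · simp
      · rw [show 2 * (k + 1 + 1) - 1 = (2 * k + 1) + 2 by omega, Nat.doubleFactorial_add_two]
        rfl
    rw [h, prod_range_succ]
    push_cast
    rw [ih]
    ring

open Finset in
theorem cast_factorial_two_mul (m : ℕ) :
    (Nat.factorial (2 * m) : ℝ) = 4 ^ m * m.factorial * ∏ j ∈ range m, ((j : ℝ) + 1 / 2) := by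
  rcases m with _ | m
  · simp
  · rw [show 2 * (m + 1) = (2 * m + 1) + 1 by ring, Nat.factorial_eq_mul_doubleFactorial,
      show (2 * m + 1) + 1 = 2 * (m + 1) by ring, Nat.doubleFactorial_two_mul,
      show 2 * m + 1 = 2 * (m + 1) - 1 by omega]
    push_cast
    rw [cast_doubleFactorial_two_mul_sub_one, show (4 : ℝ) = 2 * 2 by norm_num, mul_pow]
    ring

open Finset in
theorem A_eq (n m : ℕ) : A n m = (∏ j ∈ range n, ((m : ℝ) + j + 1 / 2)) /
    ((2 * m - 1) * (n - m).factorial * m.factorial) := by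
  have h1 : (∏ j ∈ range m, ((j : ℝ) + 1 / 2)) ≠ 0 :=
    prod_ne_zero_iff.2 fun j _ => by positivity
  have h2 : (2 * (m : ℝ) - 1) ≠ 0 := by
    intro h
    have : ((2 * m : ℕ) : ℝ) = (1 : ℕ) := by push_cast; linarith
    have := Nat.cast_injective this
    omega
  rw [A, cast_doubleFactorial_two_mul_sub_one, cast_factorial_two_mul, add_comm n m,
    prod_range_add, zpow_sub₀ two_ne_zero, zpow_natCast, zpow_natCast,
    show (4 : ℝ) = 2 * 2 by norm_num, mul_pow, pow_add]
  generalize ∏ j ∈ range m, ((j : ℝ) + 1 / 2) = P at *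
  push_cast
  generalize ∏ j ∈ range n, ((m : ℝ) + j + 1 / 2) = Q
  field_simp

/-- The coefficients of `Λ_{n+1} + Λ_n`. -/
noncomputable def pairCoeff (n i : ℕ) : ℝ :=
  (2 * n + 3 / 2) * (∏ j ∈ Finset.range n, ((i : ℝ) + 1 + j + 1 / 2)) /
    ((2 * i + 1) * (n - i).factorial * (i + 1).factorial)

theorem A_add_A (n i : ℕ) (h : i < n) : A (n + 1) (i + 1) + A n (i + 1) = pairCoeff n i := by
  obtain ⟨k, rfl⟩ := Nat.exists_eq_add_of_lt h
  rw [A_eq, A_eq, pairCoeff, Finset.prod_range_succ, show i + k + 1 + 1 - (i + 1) = k + 1 by omega,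
    show i + k + 1 - (i + 1) = k by omega, show i + k + 1 - i = k + 1 by omega,
    Nat.factorial_succ k]
  push_cast
  rw [show 2 * ((i : ℝ) + 1) - 1 = 2 * i + 1 by ring]
  have h2 : 2 * (i : ℝ) + 1 ≠ 0 := by positivity
  generalize ∏ j ∈ Finset.range (i + k + 1), ((i : ℝ) + 1 + j + 1 / 2) = Q
  field_simp
  ring

theorem A_self (n : ℕ) : A (n + 1) (n + 1) = pairCoeff n n := by
  rw [A_eq, pairCoeff, Finset.prod_range_succ, Nat.sub_self, Nat.sub_self]
  push_cast
  rw [show 2 * ((n : ℝ) + 1) - 1 = 2 * n + 1 by ring]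
  have h2 : 2 * (n : ℝ) + 1 ≠ 0 := by positivity
  generalize ∏ j ∈ Finset.range n, ((n : ℝ) + 1 + j + 1 / 2) = Q
  field_simp
  ring

open Finset in
theorem Lambda_eq_sum_range (n : ℕ) :
    Lambda n = ∑ i ∈ range n, (-1 : ℝ) ^ (i + 1) * A n (i + 1) * PhiVal (i + 1) := by
  rw [Lambda, range_eq_Ico, sum_Ico_add' (fun m => (-1 : ℝ) ^ m * A n m * PhiVal m)]
  rfl

open Finset in
theorem Lambda_succ_add (n : ℕ) : Lambda (n + 1) + Lambda n =
    ∑ i ∈ range (n + 1), (-1 : ℝ) ^ (i + 1) * pairCoeff n i * PhiVal (i + 1) := by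
  rw [Lambda_eq_sum_range, Lambda_eq_sum_range, sum_range_succ, sum_range_succ, A_self,
    add_right_comm, ← sum_add_distrib]
  congr 1
  refine sum_congr rfl fun i hi => ?_
  rw [← A_add_A n i (mem_range.1 hi)]
  ring

open Finset in
theorem prod_range_erase_sub (i k : ℕ) : ∏ j ∈ (range (i + k + 1)).erase i,
    (((i : ℂ) + 1) - (j + 1)) = (-1) ^ k * i.factorial * k.factorial := by
  induction k with
  | zero =>
    rw [add_zero, range_add_one, erase_insert (by simp), ← prod_range_reflect]
    simp only [pow_zero, one_mul, Nat.factorial_zero, Nat.cast_one, mul_one]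
    rw [← prod_range_add_one_eq_factorial]
    push_cast
    refine prod_congr rfl fun j hj => ?_
    have : j < i := mem_range.1 hj
    rw [Nat.cast_sub (by omega), Nat.cast_sub (by omega)]
    push_cast
    ring
  | succ k ih =>
    rw [← add_assoc, range_add_one, erase_insert_of_ne (by omega), prod_insert (by simp), ih,
      Nat.factorial_succ]
    push_cast
    ring

/-- The residue at `i + 1` of `∏ j < n, (y + j + 1 / 2) / ∏ j ≤ n, (y - (j + 1))`. -/
noncomputable def rationalResidue (n i : ℕ) : ℂ :=
  (-1) ^ (n - i) * (∏ j ∈ Finset.range n, ((i : ℂ) + 1 + j + 1 / 2)) /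
    (i.factorial * (n - i).factorial)

open Finset Polynomial in
theorem prod_div_prod_eq_sum_rationalResidue (n : ℕ) {y : ℂ}
    (hy : ∀ i ∈ range (n + 1), y ≠ (i : ℂ) + 1) :
    (∏ j ∈ range n, (y + j + 1 / 2)) / ∏ j ∈ range (n + 1), (y - (j + 1)) =
      ∑ i ∈ range (n + 1), rationalResidue n i * (y - (i + 1))⁻¹ := by
  set v : ℕ → ℂ := fun i => (i : ℂ) + 1 with hv
  have hinj : Set.InjOn v (range (n + 1)) := fun a _ b _ h => by simpa [hv] using h
  set f : ℂ[X] := ∏ j ∈ range n, (X + C ((j : ℂ) + 1 / 2)) with hf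
  have hdeg : f.degree < #(range (n + 1)) := by
    rw [hf, degree_prod, card_range]
    simp only [degree_X_add_C, sum_const, card_range, nsmul_eq_mul, mul_one]
    exact_mod_cast Nat.lt_succ_self n
  have heval : ∀ z, f.eval z = ∏ j ∈ range n, (z + j + 1 / 2) := fun z => by
    rw [hf, eval_prod]
    simp [add_assoc]
  have key := congrArg (eval y) (Lagrange.eq_interpolate hinj hdeg)
  rw [Lagrange.eval_interpolate_not_at_node _ hy, heval, Lagrange.eval_nodal] at key
  have hne : ∏ j ∈ range (n + 1), (y - ((j : ℂ) + 1)) ≠ 0 :=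
    prod_ne_zero_iff.2 fun j hj => sub_ne_zero.2 (hy j hj)
  rw [key, mul_div_cancel_left₀ _ hne]
  refine sum_congr rfl fun i hi => ?_
  obtain ⟨k, rfl⟩ := Nat.exists_eq_add_of_le (Nat.le_of_lt_succ (mem_range.1 hi))
  rw [Lagrange.nodalWeight, prod_inv_distrib, prod_range_erase_sub, heval, rationalResidue,
    Nat.add_sub_cancel_left]
  have : ((-1 : ℂ) ^ k)⁻¹ = (-1) ^ k := by rw [← inv_pow, inv_neg_one]
  rw [mul_inv, mul_inv, this]
  ring

theorem re_rationalResidue_mul_logXi2Quot (n i : ℕ) (hi : i ≤ n) :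
    ((2 * n + 3 / 2) * (rationalResidue n i * logXi2Quot ((i : ℂ) + 1))).re =
      2 * (-1) ^ (n + 1) * ((-1) ^ (i + 1) * pairCoeff n i * PhiVal (i + 1)) := by
  obtain ⟨k, rfl⟩ := Nat.exists_eq_add_of_le hi
  have e : (2 * ((i + k : ℕ) : ℂ) + 3 / 2) *
      (rationalResidue (i + k) i * logXi2Quot ((i : ℂ) + 1)) =
      ((2 * (-1) ^ k * pairCoeff (i + k) i : ℝ) : ℂ) * logXi2 ((i + 1 : ℕ) : ℂ) := by
    rw [rationalResidue, logXi2Quot, pairCoeff, Nat.add_sub_cancel_left, Nat.factorial_succ]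
    push_cast
    have h1 : (i : ℂ) + 1 - 1 / 2 = (2 * i + 1) / 2 := by ring
    have h2 : 2 * (i : ℂ) + 1 ≠ 0 := by exact_mod_cast Nat.succ_ne_zero (2 * i)
    have h3 : (i : ℂ) + 1 ≠ 0 := Nat.cast_add_one_ne_zero i
    have h4 : (i.factorial : ℂ) ≠ 0 := by exact_mod_cast i.factorial_ne_zero
    have h5 : (k.factorial : ℂ) ≠ 0 := by exact_mod_cast k.factorial_ne_zero
    rw [h1]
    field_simp
  rw [e, Complex.re_ofReal_mul, re_logXi2_natCast (by omega), pow_add, pow_add, pow_add]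
  have : (-1 : ℝ) ^ i * (-1) ^ i = 1 := by rw [← mul_pow]; simp
  linear_combination (-2 * (-1) ^ k * pairCoeff (i + k) i * PhiVal (i + 1)) * this

/-- The quotient `q(x) / q(y)`, where `q(y) = ∏ 1 ≤ j ≤ N, (y - j) / (y + j - 1 / 2)`. -/
noncomputable def nodeRatio (N : ℕ) (x y : ℂ) : ℂ := ∏ j ∈ Finset.range N,
  ((x - (j + 1)) * (y + j + 1 / 2)) / ((x + j + 1 / 2) * (y - (j + 1)))

open Finset in
theorem nodeRatio_succ_mul_inv (N : ℕ) {x y : ℂ} (hx : ∀ j : ℕ, x + j + 1 / 2 ≠ 0)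
    (hy : ∀ j ∈ range (N + 1), y ≠ (j : ℂ) + 1) (hxy : y ≠ x) :
    nodeRatio (N + 1) x y * (y - x)⁻¹ = nodeRatio N x y * (y - x)⁻¹ -
      (2 * N + 3 / 2) * ((∏ j ∈ range N, (x - (j + 1))) / ∏ j ∈ range (N + 1), (x + j + 1 / 2)) *
      ∑ i ∈ range (N + 1), rationalResidue N i * (y - (i + 1))⁻¹ := by
  rw [← prod_div_prod_eq_sum_rationalResidue N hy, nodeRatio, nodeRatio, prod_range_succ,
    prod_div_distrib, prod_mul_distrib, prod_mul_distrib, prod_range_succ,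
    prod_range_succ (fun j => y - ((j : ℂ) + 1))]
  have h1 : ∏ j ∈ range N, (x + j + 1 / 2) ≠ 0 := prod_ne_zero_iff.2 fun j _ => hx j
  have h2 : ∏ j ∈ range N, (y - ((j : ℂ) + 1)) ≠ 0 := prod_ne_zero_iff.2 fun j hj =>
    sub_ne_zero.2 (hy j (mem_range.2 (by have := mem_range.1 hj; omega)))
  have h3 : y - ((N : ℂ) + 1) ≠ 0 := sub_ne_zero.2 (hy N (by simp))
  have h4 := hx N
  have h5 : y - x ≠ 0 := sub_ne_zero.2 hxy
  generalize ∏ j ∈ range N, (x + j + 1 / 2) = P at *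
  generalize ∏ j ∈ range N, (y - ((j : ℂ) + 1)) = Q at *
  generalize ∏ j ∈ range N, (y + j + 1 / 2) = S at *
  generalize ∏ j ∈ range N, (x - ((j : ℂ) + 1)) = T at *
  have key : (x - ((N : ℂ) + 1)) * (y + N + 1 / 2) =
      (x + N + 1 / 2) * (y - ((N : ℂ) + 1)) - (2 * N + 3 / 2) * (y - x) := by ring
  rw [key]
  generalize x + N + 1 / 2 = u at *
  generalize y - ((N : ℂ) + 1) = w at *
  generalize y - x = d at *
  field_simp

open Metric in
theorem continuousOn_nodeRatio (N : ℕ) {x c : ℂ} {R : ℝ} (hx : ∀ j : ℕ, x + j + 1 / 2 ≠ 0)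
    (hN : ∀ j < N, (j : ℂ) + 1 ∈ ball c R) : ContinuousOn (nodeRatio N x) (sphere c R) := by
  refine continuousOn_finsetProd _ fun j hj => ContinuousOn.div (by fun_prop) (by fun_prop)
    fun y hy => mul_ne_zero (hx j) (sub_ne_zero.2 ?_)
  rintro rfl
  exact (mem_ball.1 (hN j (Finset.mem_range.1 hj))).ne (mem_sphere.1 hy)

open Finset Metric in
theorem circleIntegral_nodeRatio {g : ℂ → ℂ} {x c : ℂ} {R : ℝ}
    (hg : DifferentiableOn ℂ g (closedBall c R)) (hxR : x ∈ ball c R)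
    (hx : ∀ j : ℕ, x + j + 1 / 2 ≠ 0) (N : ℕ) (hN : ∀ j < N, (j : ℂ) + 1 ∈ ball c R) :
    (∮ y in C(c, R), nodeRatio N x y * (y - x)⁻¹ * g y) = 2 * Real.pi * Complex.I *
      (g x - ∑ n ∈ range N, (2 * n + 3 / 2) *
        ((∏ j ∈ range n, (x - (j + 1))) / ∏ j ∈ range (n + 1), (x + j + 1 / 2)) *
        ∑ i ∈ range (n + 1), rationalResidue n i * g (i + 1)) := by
  have hR : 0 < R := pos_of_mem_ball hxR
  have hsph : ∀ w ∈ ball c R, ∀ y ∈ sphere c R, y ≠ w := by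
    rintro w hw y hy rfl
    exact (mem_ball.1 hw).ne (mem_sphere.1 hy)
  have hgc : ContinuousOn g (sphere c R) := hg.continuousOn.mono sphere_subset_closedBall
  have hinv : ∀ w ∈ ball c R, ContinuousOn (fun y : ℂ => (y - w)⁻¹) (sphere c R) := fun w hw =>
    ContinuousOn.inv₀ (by fun_prop) fun y hy => sub_ne_zero.2 (hsph w hw y hy)
  have hcauchy : ∀ w ∈ ball c R,
      (∮ y in C(c, R), (y - w)⁻¹ * g y) = 2 * Real.pi * Complex.I * g w := fun w hw => by
    simpa only [smul_eq_mul] using hg.circleIntegral_sub_inv_smul hw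
  induction N with
  | zero => simpa [nodeRatio] using hcauchy x hxR
  | succ N ih =>
    have hN' : ∀ j < N, (j : ℂ) + 1 ∈ ball c R := fun j hj => hN j (by omega)
    have e : Set.EqOn (fun y => nodeRatio (N + 1) x y * (y - x)⁻¹ * g y)
        (fun y => nodeRatio N x y * (y - x)⁻¹ * g y - (2 * N + 3 / 2) *
          ((∏ j ∈ range N, (x - (j + 1))) / ∏ j ∈ range (N + 1), (x + j + 1 / 2)) *
          ∑ i ∈ range (N + 1), rationalResidue N i * ((y - (i + 1))⁻¹ * g y)) (sphere c R) := by
      intro y hy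
      dsimp only
      rw [nodeRatio_succ_mul_inv N hx
        (fun j hj => hsph _ (hN j (mem_range.1 hj)) y hy) (hsph _ hxR y hy), sub_mul]
      congr 1
      rw [mul_assoc _ _ (g y), sum_mul]
      simp only [mul_assoc]
    have hint : ∀ i ∈ range (N + 1), CircleIntegrable
        (fun y => rationalResidue N i * ((y - (i + 1))⁻¹ * g y)) c R := fun i hi =>
      ContinuousOn.circleIntegrable hR.le
        (ContinuousOn.mul continuousOn_const ((hinv _ (hN i (mem_range.1 hi))).mul hgc))
    rw [circleIntegral.integral_congr hR.le e, circleIntegral.integral_sub, ih hN',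
      circleIntegral.integral_const_mul, circleIntegral.integral_fun_sum hint]
    · have : ∀ i ∈ range (N + 1), (∮ y in C(c, R), rationalResidue N i * ((y - (i + 1))⁻¹ * g y)) =
          2 * Real.pi * Complex.I * (rationalResidue N i * g (i + 1)) := fun i hi => by
        rw [circleIntegral.integral_const_mul, hcauchy _ (hN i (mem_range.1 hi))]
        ring
      conv_rhs => rw [sum_range_succ]
      rw [sum_congr rfl this, ← mul_sum]
      ring
    · exact (((continuousOn_nodeRatio N hx hN').mul (hinv x hxR)).mul hgc).circleIntegrable hR.le
    · refine ContinuousOn.circleIntegrable hR.le (ContinuousOn.mul continuousOn_const ?_)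
      exact continuousOn_finsetSum _ fun i hi =>
        ContinuousOn.mul continuousOn_const ((hinv _ (hN i (mem_range.1 hi))).mul hgc)

open Metric Real in
theorem circleAverage_norm_sq_inv {R ρ : ℝ} (h0 : 0 < ρ) (h : ρ < R) :
    circleAverage (fun z : ℂ => (‖z‖ ^ 2)⁻¹) R ρ = (R ^ 2 - ρ ^ 2)⁻¹ := by
  have hR : 0 < R := h0.trans h
  have hd : 0 < R ^ 2 - ρ ^ 2 := by nlinarith
  have hn : ‖((R - ρ ^ 2 / R : ℝ) : ℂ) - R‖ = ρ ^ 2 / R := by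
    rw [← Complex.ofReal_sub, Complex.norm_real, sub_sub_cancel_left, norm_neg,
      Real.norm_of_nonneg (by positivity)]
  have hw : ((R - ρ ^ 2 / R : ℝ) : ℂ) ∈ ball (R : ℂ) ρ := by
    rw [mem_ball, dist_eq_norm, hn, div_lt_iff₀ hR]
    nlinarith
  have key := InnerProductSpace.HarmonicContOnCl.circleAverage_poissonKernel_smul
    (InnerProductSpace.harmonicContOnCl_const (c := (1 : ℝ))) hw
  have e : Set.EqOn (poissonKernel (R : ℂ) ((R - ρ ^ 2 / R : ℝ) : ℂ) • fun _ => (1 : ℝ))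
      (fun z => (R ^ 2 - ρ ^ 2) • (‖z‖ ^ 2)⁻¹) (sphere (R : ℂ) |ρ|) := by
    intro z hz
    rw [abs_of_pos h0, mem_sphere, dist_eq_norm] at hz
    have h1 : ‖(z - R) - (((R - ρ ^ 2 / R : ℝ) : ℂ) - R)‖ ^ 2 = ρ ^ 2 / R ^ 2 * ‖z‖ ^ 2 := by
      have hz2 : ‖z - R‖ ^ 2 = ρ ^ 2 := by rw [hz]
      rw [← Complex.normSq_eq_norm_sq, Complex.normSq_apply] at hz2 ⊢
      rw [← Complex.normSq_eq_norm_sq, Complex.normSq_apply]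
      simp [-Complex.ofReal_pow] at hz2 ⊢
      have h2 : z.re * z.re + z.im * z.im = ρ ^ 2 - R ^ 2 + 2 * R * z.re := by linarith
      have h3 : z.im * z.im = ρ ^ 2 - R ^ 2 + 2 * R * z.re - z.re * z.re := by linarith
      rw [h2, h3]
      field_simp
      ring
    rw [Pi.smul_apply', poissonKernel_def, h1, hn, hz, smul_eq_mul, mul_one]
    change _ = (R ^ 2 - ρ ^ 2) * (‖z‖ ^ 2)⁻¹
    by_cases hz0 : ‖z‖ = 0
    · simp [hz0]
    · field_simp
  rw [circleAverage_congr_sphere e] at key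
  have h2 := circleAverage_fun_smul (a := R ^ 2 - ρ ^ 2) (f := fun z : ℂ => (‖z‖ ^ 2)⁻¹) (c := R) (R := ρ)
  rw [h2, smul_eq_mul] at key
  exact eq_inv_of_mul_eq_one_right key

open Metric Real in
theorem norm_circleIntegral_le_of_norm_le_div_sq {f : ℂ → ℂ} {R ρ K : ℝ} (h0 : 0 < ρ) (h : ρ < R)
    (hf : ∀ z ∈ sphere (R : ℂ) ρ, ‖f z‖ ≤ K / ‖z‖ ^ 2) :
    ‖∮ z in C(R, ρ), f z‖ ≤ 2 * π * ρ * K / (R ^ 2 - ρ ^ 2) := by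
  have hne : ∀ z ∈ sphere (R : ℂ) ρ, z ≠ 0 := by
    rintro z hz rfl
    rw [mem_sphere, dist_eq_norm, zero_sub, norm_neg, Complex.norm_real,
      Real.norm_of_nonneg (by linarith)] at hz
    linarith
  have hci : Continuous fun θ => K / ‖circleMap R ρ θ‖ ^ 2 := by
    refine continuous_const.div (by fun_prop) fun θ => ?_
    have := hne _ (circleMap_mem_sphere _ h0.le θ)
    positivity
  have h1 : ‖∮ z in C(R, ρ), f z‖ ≤ ∫ θ in (0)..2 * π, ρ * (K / ‖circleMap R ρ θ‖ ^ 2) := by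
    rw [circleIntegral]
    refine intervalIntegral.norm_integral_le_of_norm_le (by positivity) ?_ ?_
    · refine Filter.Eventually.of_forall fun θ _ => ?_
      rw [norm_smul, deriv_circleMap, norm_mul, norm_circleMap_zero, Complex.norm_I, mul_one,
        abs_of_pos h0]
      exact mul_le_mul_of_nonneg_left (hf _ (circleMap_mem_sphere _ h0.le _)) h0.le
    · exact (hci.const_mul _).intervalIntegrable _ _
  refine h1.trans (le_of_eq ?_)
  have h2 := circleAverage_norm_sq_inv h0 h
  rw [circleAverage_def, smul_eq_mul, inv_mul_eq_iff_eq_mul₀ (by positivity)] at h2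
  simp only [div_eq_mul_inv]
  rw [intervalIntegral.integral_const_mul, intervalIntegral.integral_const_mul, h2]
  ring

open Metric in
theorem norm_add_mul_le_norm_sub_mul {R : ℝ} {m : ℝ} (hm : 1 ≤ m) (hR : 4 * m ^ 2 ≤ R) {y : ℂ}
    (hy : y ∈ sphere (R : ℂ) (R - 3 / 5)) :
    ‖y + ((m - 1 / 2 : ℝ) : ℂ)‖ * (m - 3 / 5) ≤ ‖y - (m : ℂ)‖ * (m + 1 / 10) := by
  rw [mem_sphere, dist_eq_norm] at hy
  have hy2 : ‖y - R‖ ^ 2 = (R - 3 / 5) ^ 2 := by rw [hy]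
  have hre : 3 / 5 ≤ y.re := by
    have := Complex.abs_re_le_norm (y - R)
    rw [hy, Complex.sub_re, Complex.ofReal_re, abs_le] at this
    linarith
  refine le_of_sq_le_sq ?_ (by positivity)
  rw [mul_pow, mul_pow]
  rw [← Complex.normSq_eq_norm_sq, Complex.normSq_apply] at hy2
  rw [← Complex.normSq_eq_norm_sq, ← Complex.normSq_eq_norm_sq, Complex.normSq_apply,
    Complex.normSq_apply]
  simp only [Complex.sub_re, Complex.sub_im, Complex.add_re, Complex.add_im, Complex.ofReal_re,
    Complex.ofReal_im, sub_zero, add_zero] at hy2 ⊢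
  have h3 : y.im * y.im = (R - 3 / 5) ^ 2 - (y.re - R) * (y.re - R) := by linarith
  rw [h3]
  obtain ⟨t, ht⟩ : ∃ t, t = y.re - 3 / 5 := ⟨_, rfl⟩
  have ht0 : 0 ≤ t := by linarith
  have hyre : y.re = t + 3 / 5 := by linarith
  rw [hyre]
  have h4 : (2 * R + 2 * m - 1) * (m - 3 / 5) ^ 2 ≤ (2 * R - 2 * m) * (m + 1 / 10) ^ 2 := by
    nlinarith [mul_nonneg (sub_nonneg.2 hm) (sub_nonneg.2 hR), sq_nonneg (m - 1),
      mul_nonneg (sub_nonneg.2 hm) (sq_nonneg m), mul_nonneg (sub_nonneg.2 hm) (sq_nonneg (m - 1))]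
  nlinarith [mul_le_mul_of_nonneg_left h4 ht0]

theorem one_sub_div_le_rpow {δ m : ℝ} (hδ : 0 ≤ δ) (hm : 1 ≤ m) :
    1 - δ / (m + 1) ≤ ((m + 1) / (m + 2)) ^ δ := by
  have h1 : Real.exp (-(1 / (m + 1))) ≤ (m + 1) / (m + 2) := by
    rw [Real.exp_neg, inv_le_comm₀ (Real.exp_pos _) (by positivity), inv_div]
    refine le_trans (le_of_eq ?_) (Real.add_one_le_exp (1 / (m + 1)))
    field_simp
    ring
  calc 1 - δ / (m + 1) ≤ Real.exp (-(δ / (m + 1))) := by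
        have := Real.add_one_le_exp (-(δ / (m + 1)))
        linarith
    _ = Real.exp (-(1 / (m + 1))) ^ δ := by rw [← Real.exp_mul]; ring_nf
    _ ≤ _ := Real.rpow_le_rpow (Real.exp_pos _).le h1 hδ

theorem node_factor_le {x m : ℝ} (hx : x ∈ Set.Ioo (9 / 10) 1) (hm : 1 ≤ m) :
    (m - x) * (m + 1 / 10) / ((m + x - 1 / 2) * (m - 3 / 5)) ≤
      ((m + 1) / (m + 2)) ^ (2 * (x - 3 / 5)) := by
  obtain ⟨h1, h2⟩ := hx
  have h3 := one_sub_div_le_rpow (δ := x - 3 / 5) (by linarith) hm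
  have a1 : (m - x) / (m - 3 / 5) ≤ 1 - (x - 3 / 5) / (m + 1) := by
    rw [show (m - x) / (m - 3 / 5) = 1 - (x - 3 / 5) / (m - 3 / 5) by
      rw [eq_sub_iff_add_eq, ← add_div, div_eq_one_iff_eq (by linarith)]; ring]
    have : (x - 3 / 5) / (m + 1) ≤ (x - 3 / 5) / (m - 3 / 5) :=
      div_le_div_of_nonneg_left (by linarith) (by linarith) (by linarith)
    linarith
  have a2 : (m + 1 / 10) / (m + x - 1 / 2) ≤ 1 - (x - 3 / 5) / (m + 1) := by
    rw [show (m + 1 / 10) / (m + x - 1 / 2) = 1 - (x - 3 / 5) / (m + x - 1 / 2) by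
      rw [eq_sub_iff_add_eq, ← add_div, div_eq_one_iff_eq (by linarith)]; ring]
    have : (x - 3 / 5) / (m + 1) ≤ (x - 3 / 5) / (m + x - 1 / 2) :=
      div_le_div_of_nonneg_left (by linarith) (by linarith) (by linarith)
    linarith
  have b1 : 0 ≤ (m - x) / (m - 3 / 5) := div_nonneg (by linarith) (by linarith)
  have b2 : 0 ≤ (m + 1 / 10) / (m + x - 1 / 2) := div_nonneg (by linarith) (by linarith)
  rw [mul_comm 2, Real.rpow_mul (by positivity), Real.rpow_two, sq]
  calc _ = (m - x) / (m - 3 / 5) * ((m + 1 / 10) / (m + x - 1 / 2)) := by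
        rw [div_mul_div_comm, mul_comm (m - 3 / 5)]
    _ ≤ _ := mul_le_mul (a1.trans h3) (a2.trans h3) b2 (b1.trans (a1.trans h3))

open Metric Finset in
theorem norm_nodeRatio_le {x R : ℝ} (hx : x ∈ Set.Ioo (9 / 10) 1) {N : ℕ}
    (hR : 4 * ((N : ℝ) + 2) ^ 2 ≤ R) {y : ℂ} (hy : y ∈ sphere (R : ℂ) (R - 3 / 5)) :
    ‖nodeRatio N x y‖ ≤ (2 / ((N : ℝ) + 2)) ^ (2 * (x - 3 / 5)) := by
  have h1 : ∀ j ∈ range N, ‖((x : ℂ) - (j + 1)) * (y + j + 1 / 2) /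
      ((x + j + 1 / 2) * (y - (j + 1)))‖ ≤
      ((((j : ℝ) + 1) + 1) / ((j + 1) + 2)) ^ (2 * (x - 3 / 5)) := by
    intro j hj
    obtain ⟨hx1, hx2⟩ := hx
    set m : ℝ := j + 1 with hm
    have hm1 : 1 ≤ m := by simp [hm]
    have hmN : m ≤ N := by
      rw [hm]
      exact_mod_cast mem_range.1 hj
    have hmR : 4 * m ^ 2 ≤ R := by nlinarith
    have hym := norm_add_mul_le_norm_sub_mul hm1 hmR hy
    have e1 : (x : ℂ) - (j + 1) = ((-(m - x) : ℝ) : ℂ) := by rw [hm]; push_cast; ring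
    have e2 : y + j + 1 / 2 = y + ((m - 1 / 2 : ℝ) : ℂ) := by rw [hm]; push_cast; ring
    have e3 : (x : ℂ) + j + 1 / 2 = ((m + x - 1 / 2 : ℝ) : ℂ) := by rw [hm]; push_cast; ring
    have e4 : y - (j + 1) = y - (m : ℂ) := by rw [hm]; push_cast; ring
    rw [e1, e2, e3, e4, norm_div, norm_mul, norm_mul, Complex.norm_real, Complex.norm_real, norm_neg,
      Real.norm_of_nonneg (by linarith), Real.norm_of_nonneg (by linarith)]
    refine le_trans ?_ (node_factor_le ⟨hx1, hx2⟩ hm1)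
    have hpos : 0 < ‖y - (m : ℂ)‖ := by
      rw [norm_pos_iff, sub_ne_zero]
      rintro rfl
      rw [mem_sphere, dist_eq_norm, ← Complex.ofReal_sub, Complex.norm_real, Real.norm_eq_abs,
        abs_sub_comm, abs_of_nonneg (by nlinarith)] at hy
      linarith
    have p1 : 0 < m + x - 1 / 2 := by linarith
    have p2 : 0 < m - 3 / 5 := by linarith
    rw [div_le_div_iff₀ (mul_pos p1 hpos) (mul_pos p1 p2)]
    have := mul_le_mul_of_nonneg_left hym
      (mul_nonneg (show 0 ≤ m - x by linarith) p1.le)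
    linarith
  rw [nodeRatio]
  refine (Finset.norm_prod_le _ _).trans ((prod_le_prod (fun _ _ => norm_nonneg _) h1).trans (le_of_eq ?_))
  rw [Real.finsetProd_rpow _ _ fun j _ => by positivity]
  congr 1
  clear * -
  induction N with
  | zero => simp
  | succ N ih =>
    rw [prod_range_succ, ih]
    push_cast
    field_simp
    ring

open Metric in
theorem exists_norm_remainder_le : ∃ C : ℝ, ∀ x ∈ Set.Ioo (9 / 10 : ℝ) 1, ∀ N : ℕ,
    ‖∮ y in C(((4 * ((N : ℝ) + 2) ^ 2 : ℝ) : ℂ), 4 * ((N : ℝ) + 2) ^ 2 - 3 / 5),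
      nodeRatio N x y * (y - x)⁻¹ * logXi2Quot y‖ ≤
      C * ((N : ℝ) + 2) ^ (1 / 2 - 2 * (x - 3 / 5)) := by
  obtain ⟨C, hC0, hC⟩ := exists_norm_logXi2Quot_le
  refine ⟨2 * Real.pi * (5 / 3) * (2 ^ (1 : ℝ) * 5 * C * 8 ^ (1 / 4 : ℝ)), fun x hx N => ?_⟩
  obtain ⟨n, hn⟩ : ∃ n : ℝ, n = N + 2 := ⟨_, rfl⟩
  have hn2 : 2 ≤ n := by rw [hn]; simp
  obtain ⟨R, hR⟩ : ∃ R : ℝ, R = 4 * n ^ 2 := ⟨_, rfl⟩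
  rw [← hn, ← hR]
  have hR1 : 16 ≤ R := by rw [hR]; nlinarith
  have hx1 := hx.1
  have hx2 := hx.2
  set δ := 2 * (x - 3 / 5) with hδ
  have hpt : ∀ y ∈ sphere (R : ℂ) (R - 3 / 5), ‖nodeRatio N x y * (y - x)⁻¹ * logXi2Quot y‖ ≤
      ((2 / n) ^ δ * 5 * C * (2 * R) ^ (1 / 4 : ℝ)) / ‖y‖ ^ 2 := by
    intro y hy
    have h1 := norm_nodeRatio_le hx (N := N) (by rw [hR, hn]) hy
    rw [← hn, ← hδ] at h1
    rw [mem_sphere, dist_eq_norm] at hy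
    have hre : 3 / 5 ≤ y.re := by
      have := Complex.abs_re_le_norm (y - R)
      rw [hy, Complex.sub_re, Complex.ofReal_re, abs_le] at this
      linarith
    have hy0 : 0 < ‖y‖ := by linarith [Complex.re_le_norm y]
    have hyR : ‖y‖ ≤ 2 * R := by
      have := norm_sub_norm_le y R
      rw [hy, Complex.norm_real, Real.norm_of_nonneg (by linarith)] at this
      linarith
    have hyx : ‖y‖ / 5 ≤ ‖y - x‖ := by
      have a1 := norm_sub_norm_le y x
      have a2 := norm_sub_norm_le (y - R) (x - R : ℂ)
      rw [sub_sub_sub_cancel_right, hy, ← Complex.ofReal_sub, Complex.norm_real, Real.norm_eq_abs,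
        abs_sub_comm, abs_of_nonneg (by linarith)] at a2
      rw [Complex.norm_real, Real.norm_of_nonneg (by linarith)] at a1
      linarith
    have h2 : ‖(y - x)⁻¹‖ ≤ 5 / ‖y‖ := by
      rw [norm_inv, inv_le_comm₀ (by linarith [div_pos hy0 (by norm_num : (0 : ℝ) < 5)])
        (by positivity), inv_div]
      exact hyx
    have h3 : ‖logXi2Quot y‖ ≤ C * ((2 * R) ^ (1 / 4 : ℝ) / ‖y‖) := by
      refine (hC y hre).trans ?_
      gcongr
      rw [show (-(3 / 4) : ℝ) = 1 / 4 - 1 by norm_num, Real.rpow_sub hy0, Real.rpow_one]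
      gcongr
    rw [norm_mul, norm_mul]
    calc _ ≤ (2 / n) ^ δ * (5 / ‖y‖) * (C * ((2 * R) ^ (1 / 4 : ℝ) / ‖y‖)) := by gcongr
      _ = _ := by field_simp
  refine (norm_circleIntegral_le_of_norm_le_div_sq (by linarith) (by linarith) hpt).trans ?_
  have hK : (2 / n) ^ δ * 5 * C * (2 * R) ^ (1 / 4 : ℝ) ≤
      2 ^ (1 : ℝ) * 5 * C * 8 ^ (1 / 4 : ℝ) * n ^ (1 / 2 - δ) := by
    have e : (2 * R) ^ (1 / 4 : ℝ) = 8 ^ (1 / 4 : ℝ) * n ^ (1 / 2 : ℝ) := by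
      rw [hR, show 2 * (4 * n ^ 2) = 8 * n ^ 2 by ring, Real.mul_rpow (by norm_num) (by positivity),
        ← Real.rpow_natCast n 2, ← Real.rpow_mul (by linarith)]
      norm_num
    rw [e, Real.div_rpow (by norm_num) (by linarith), Real.rpow_sub (by linarith)]
    have : (2 : ℝ) ^ δ ≤ 2 ^ (1 : ℝ) := Real.rpow_le_rpow_of_exponent_le (by norm_num) (by linarith)
    calc _ = 2 ^ δ * 5 * C * 8 ^ (1 / 4 : ℝ) * (n ^ (1 / 2 : ℝ) / n ^ δ) := by ring
      _ ≤ _ := by gcongr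
  set K := (2 / n) ^ δ * 5 * C * (2 * R) ^ (1 / 4 : ℝ)
  have hK0 : 0 ≤ K := by positivity
  have h4 : 2 * Real.pi * (R - 3 / 5) * K / (R ^ 2 - (R - 3 / 5) ^ 2) ≤
      2 * Real.pi * (5 / 3) * K := by
    rw [div_le_iff₀ (by nlinarith)]
    have : 0 ≤ 2 * Real.pi * K := by positivity
    nlinarith [mul_nonneg this (show 0 ≤ R by linarith)]
  refine h4.trans ?_
  rw [mul_assoc _ _ (n ^ (1 / 2 - δ))]
  gcongr

/-- The functions `(1 - x) ⋯ (n - x) / ((x + 1 / 2) ⋯ (x + n + 1 / 2))`. -/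
noncomputable def nodeKernel (n : ℕ) (x : ℝ) : ℝ :=
  (∏ j ∈ Finset.range n, ((j + 1) - x)) / ∏ j ∈ Finset.range (n + 1), (x + j + 1 / 2)

open Filter Topology Finset Metric in
theorem tendsto_sum_Lambda_mul_nodeKernel {x : ℝ} (hx : x ∈ Set.Ioo (9 / 10) 1) :
    Tendsto (fun N => ∑ n ∈ range N, (Lambda (n + 1) + Lambda n) * nodeKernel n x) atTop
      (𝓝 (-(Real.log ‖xi2 (2 * x)‖ / (2 * (x * (x - 1 / 2)))))) := by
  have hx1 := hx.1
  have hx2 := hx.2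
  obtain ⟨C, hC⟩ := exists_norm_remainder_le
  set rem : ℕ → ℂ := fun N =>
    ∮ y in C(((4 * ((N : ℝ) + 2) ^ 2 : ℝ) : ℂ), 4 * ((N : ℝ) + 2) ^ 2 - 3 / 5),
      nodeRatio N x y * (y - x)⁻¹ * logXi2Quot y with hrem
  have h0 : Tendsto rem atTop (𝓝 0) := by
    refine squeeze_zero_norm (fun N => hC x hx N) ?_
    have h1 : Tendsto (fun N : ℕ => (N : ℝ) + 2) atTop atTop :=
      tendsto_atTop_add_const_right _ _ tendsto_natCast_atTop_atTop
    have h2 := (tendsto_rpow_neg_atTop (y := 2 * (x - 3 / 5) - 1 / 2) (by linarith)).comp h1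
    have h3 := h2.const_mul C
    rw [mul_zero] at h3
    refine h3.congr fun N => ?_
    rw [Function.comp_apply, neg_sub]
  have hball : ∀ N : ℕ, ∀ t : ℝ, 3 / 5 < t → t ≤ N + 1 → (t : ℂ) ∈
      ball ((4 * ((N : ℝ) + 2) ^ 2 : ℝ) : ℂ) (4 * ((N : ℝ) + 2) ^ 2 - 3 / 5) := by
    intro N t h1 h2
    have hN : (0 : ℝ) ≤ N := N.cast_nonneg
    rw [mem_ball, dist_eq_norm, ← Complex.ofReal_sub, Complex.norm_real, Real.norm_eq_abs,
      abs_sub_comm, abs_of_nonneg (by nlinarith)]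
    linarith
  have key : ∀ N, ∑ n ∈ range N, (Lambda (n + 1) + Lambda n) * nodeKernel n x =
      -(Real.log ‖xi2 (2 * x)‖ / (2 * (x * (x - 1 / 2)))) +
        1 / 2 * (rem N / (2 * Real.pi * Complex.I)).re := by
    intro N
    have hN : (0 : ℝ) ≤ N := N.cast_nonneg
    have h1 := circleIntegral_nodeRatio (g := logXi2Quot) (N := N) (x := x)
      (c := ((4 * ((N : ℝ) + 2) ^ 2 : ℝ) : ℂ)) (R := 4 * ((N : ℝ) + 2) ^ 2 - 3 / 5)
      (differentiableOn_logXi2Quot.mono fun y hy => ?_) (hball N x (by linarith) (by linarith))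
      (fun j h => ?_) (fun j hj => ?_)
    · have hg : (logXi2Quot x).re = Real.log ‖xi2 (2 * x)‖ / (x * (x - 1 / 2)) := by
        rw [logXi2Quot, show (x : ℂ) * (x - 1 / 2) = ((x * (x - 1 / 2) : ℝ) : ℂ) by push_cast; rfl,
          Complex.div_ofReal_re, re_logXi2 (by rw [Complex.ofReal_re]; linarith)]
      have hterm : ∀ n : ℕ, ((2 * n + 3 / 2) * ((∏ j ∈ range n, ((x : ℂ) - (j + 1))) /
          ∏ j ∈ range (n + 1), ((x : ℂ) + j + 1 / 2)) *
          ∑ i ∈ range (n + 1), rationalResidue n i * logXi2Quot (i + 1)).re =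
          -2 * ((Lambda (n + 1) + Lambda n) * nodeKernel n x) := by
        intro n
        have e1 : (∏ j ∈ range n, ((x : ℂ) - (j + 1))) / ∏ j ∈ range (n + 1), ((x : ℂ) + j + 1 / 2) =
            (((-1) ^ n * nodeKernel n x : ℝ) : ℂ) := by
          rw [nodeKernel]
          push_cast
          rw [mul_div_assoc']
          congr 1
          induction n with
          | zero => simp
          | succ n ih =>
            rw [prod_range_succ, prod_range_succ, ih]
            ring
        rw [e1, mul_right_comm, mul_sum, mul_comm, Complex.re_ofReal_mul, Complex.re_sum,
          Lambda_succ_add, sum_congr rfl fun i hi =>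
            re_rationalResidue_mul_logXi2Quot n i (Nat.le_of_lt_succ (mem_range.1 hi)), ← mul_sum]
        have : (-1 : ℝ) ^ n * (-1) ^ n = 1 := by rw [← mul_pow]; simp
        rw [pow_succ]
        linear_combination (-2 * nodeKernel n x *
          ∑ i ∈ range (n + 1), (-1) ^ (i + 1) * pairCoeff n i * PhiVal (i + 1)) * this
      rw [hrem]
      dsimp only
      rw [h1, mul_div_cancel_left₀ _ Complex.two_pi_I_ne_zero, Complex.sub_re, Complex.re_sum, hg, sum_congr rfl fun n _ => hterm n, ← mul_sum,
        mul_comm (2 : ℝ) (x * _), ← div_div]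
      linarith
    · rw [mem_closedBall, dist_eq_norm] at hy
      have := (Complex.abs_re_le_norm _).trans hy
      rw [Complex.sub_re, Complex.ofReal_re, abs_le] at this
      change 1 / 2 < y.re
      linarith
    · have := congrArg Complex.re h
      simp at this
      have : (0 : ℝ) ≤ j := j.cast_nonneg
      linarith
    · have h := hball N (j + 1) (by have : (0 : ℝ) ≤ j := j.cast_nonneg; linarith) (by
        have : (j : ℝ) + 1 ≤ N := by exact_mod_cast hj
        linarith)
      simpa using h
  have h4 : Tendsto (fun N => -(Real.log ‖xi2 (2 * x)‖ / (2 * (x * (x - 1 / 2)))) +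
      1 / 2 * (rem N / (2 * Real.pi * Complex.I)).re) atTop
      (𝓝 (-(Real.log ‖xi2 (2 * x)‖ / (2 * (x * (x - 1 / 2)))) +
      1 / 2 * ((0 : ℂ) / (2 * Real.pi * Complex.I)).re)) :=
    (((Complex.continuous_re.tendsto _).comp (h0.div_const _)).const_mul _).const_add _
  rw [zero_div, Complex.zero_re, mul_zero, add_zero] at h4
  exact h4.congr fun N => (key N).symm

open MeasureTheory ProbabilityTheory Filter Topology in
theorem exists_lt_mem_integrableExpSet_of_analyticAt {Ω : Type*} [MeasurableSpace Ω]
    {μ : Measure Ω} {Y : Ω → ℝ} {F : ℝ → ℝ} {σ b : ℝ} (hσb : σ < b) (hF : AnalyticAt ℝ F σ)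
    (hS : Set.Ioo σ b ⊆ integrableExpSet Y μ) (hFm : Set.EqOn F (mgf Y μ) (Set.Ioo σ b)) :
    ∃ τ < σ, τ ∈ integrableExpSet Y μ := by
  obtain ⟨p, r, hp⟩ := hF
  obtain ⟨R, hR0, hRr⟩ : ∃ R : ℝ, 0 < R ∧ ENNReal.ofReal R ≤ r := by
    rcases eq_or_ne r ⊤ with h | h
    · exact ⟨1, one_pos, h ▸ le_top⟩
    · exact ⟨r.toReal, ENNReal.toReal_pos hp.r_pos.ne' h, ENNReal.ofReal_toReal_le⟩
  obtain ⟨δ, hδ0, hδ⟩ := exists_between (show 0 < min (R / 4) (b - σ) by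
    rw [lt_min_iff]; constructor <;> linarith)
  obtain ⟨hδR, hδb⟩ := lt_min_iff.1 hδ
  have hx0 : σ + δ ∈ interior (integrableExpSet Y μ) := by
    rw [mem_interior]
    exact ⟨_, hS, isOpen_Ioo, by linarith, by linarith⟩
  have hY := aemeasurable_of_mem_interior_integrableExpSet hx0
  have hq := (hp.mono (ENNReal.ofReal_pos.2 hR0) hRr).changeOrigin (y := δ) (by
    rw [← enorm_eq_nnnorm, Real.enorm_of_nonneg hδ0.le]
    exact (ENNReal.ofReal_lt_ofReal_iff hR0).2 (by linarith))
  have hev : F =ᶠ[𝓝 (σ + δ)] mgf Y μ :=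
    Filter.eventuallyEq_of_mem (Ioo_mem_nhds (by linarith) (by linarith)) hFm
  have hqe := (hq.hasFPowerSeriesAt.congr hev).eq_formalMultilinearSeries (hasFPowerSeriesAt_mgf hx0)
  have hsum := hq.hasSum (y := 2 * δ) (by
    rw [Metric.mem_eball, edist_zero_right, ← enorm_eq_nnnorm, Real.enorm_of_nonneg hδ0.le,
      Real.enorm_of_nonneg (by linarith), ← ENNReal.ofReal_sub _ hδ0.le,
      ENNReal.ofReal_lt_ofReal_iff (by linarith)]
    linarith)
  rw [hqe] at hsum
  have hsummable : Summable fun k : ℕ =>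
      ∫ ω, (2 * δ * Y ω) ^ (2 * k) / (2 * k)! * Real.exp ((σ + δ) * Y ω) ∂μ := by
    refine (hsum.summable.comp_injective (i := fun k : ℕ => 2 * k)
      (mul_right_injective₀ two_ne_zero)).congr fun k => ?_
    rw [Function.comp_apply, FormalMultilinearSeries.ofScalars_apply_eq, smul_eq_mul, mul_comm,
      mul_div_assoc', ← integral_const_mul, ← integral_div]
    refine integral_congr_ae (.of_forall fun ω => ?_)
    ring
  have hint : ∀ k : ℕ, Integrable
      (fun ω => (2 * δ * Y ω) ^ (2 * k) / (2 * k)! * Real.exp ((σ + δ) * Y ω)) μ := by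
    intro k
    refine ((integrable_pow_mul_exp_of_mem_interior_integrableExpSet hx0 (2 * k)).const_mul
      ((2 * δ) ^ (2 * k) / (2 * k)!)).congr (.of_forall fun ω => ?_)
    ring
  have hnn : ∀ (k : ℕ) (ω : Ω),
      0 ≤ (2 * δ * Y ω) ^ (2 * k) / (2 * k)! * Real.exp ((σ + δ) * Y ω) := fun k ω =>
    mul_nonneg (div_nonneg (by rw [pow_mul]; positivity) (by positivity)) (Real.exp_pos _).le
  have hcosh : ∫⁻ ω, ENNReal.ofReal (Real.cosh (2 * δ * Y ω) * Real.exp ((σ + δ) * Y ω)) ∂μ < ⊤ := by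
    have h1 : ∀ ω, ENNReal.ofReal (Real.cosh (2 * δ * Y ω) * Real.exp ((σ + δ) * Y ω)) =
        ∑' k : ℕ, ENNReal.ofReal
          ((2 * δ * Y ω) ^ (2 * k) / (2 * k)! * Real.exp ((σ + δ) * Y ω)) := by
      intro ω
      have := (Real.hasSum_cosh (2 * δ * Y ω)).mul_right (Real.exp ((σ + δ) * Y ω))
      rw [← this.tsum_eq, ENNReal.ofReal_tsum_of_nonneg (fun k => hnn k ω) this.summable]
    simp_rw [h1]
    rw [lintegral_tsum fun k => (hint k).aemeasurable.ennreal_ofReal]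
    simp_rw [fun k => (ofReal_integral_eq_lintegral_ofReal (hint k) (.of_forall (hnn k))).symm]
    rw [← ENNReal.ofReal_tsum_of_nonneg (fun k => integral_nonneg (hnn k)) hsummable]
    exact ENNReal.ofReal_lt_top
  refine ⟨σ - δ, by linarith, ?_⟩
  refine ⟨(hY.const_mul _).exp.aestronglyMeasurable, ?_⟩
  rw [hasFiniteIntegral_iff_ofReal (.of_forall fun ω => (Real.exp_pos _).le)]
  refine lt_of_le_of_lt (lintegral_mono (g := fun ω => ENNReal.ofReal 2 *
    ENNReal.ofReal (Real.cosh (2 * δ * Y ω) * Real.exp ((σ + δ) * Y ω))) fun ω => ?_) ?_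
  · beta_reduce
    rw [← ENNReal.ofReal_mul zero_le_two]
    refine ENNReal.ofReal_le_ofReal ?_
    have h1 : Real.exp ((σ - δ) * Y ω) = Real.exp (-(2 * δ * Y ω)) * Real.exp ((σ + δ) * Y ω) := by
      rw [← Real.exp_add]
      congr 1
      ring
    rw [h1, Real.cosh_eq, ← mul_assoc, mul_div_cancel₀ _ two_ne_zero]
    gcongr
    linarith [Real.exp_pos (2 * δ * Y ω)]
  · rw [lintegral_const_mul' _ _ ENNReal.ofReal_ne_top]
    exact ENNReal.mul_lt_top ENNReal.ofReal_lt_top hcosh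

open MeasureTheory ProbabilityTheory Filter Topology in
/-- Landau's lemma: the moment generating function exists as far as it continues analytically. -/
theorem Ioo_subset_integrableExpSet_of_analyticOnNhd {Ω : Type*} [MeasurableSpace Ω]
    {μ : Measure Ω} {Y : Ω → ℝ} {F : ℝ → ℝ} {a p b : ℝ} (hpb : p < b)
    (hF : AnalyticOnNhd ℝ F (Set.Ioo a b))
    (hS : Set.Ioo p b ⊆ integrableExpSet Y μ) (hFm : Set.EqOn F (mgf Y μ) (Set.Ioo p b)) :
    Set.Ioo a b ⊆ integrableExpSet Y μ := by
  set S := integrableExpSet Y μ with hSdef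
  have hord : S.OrdConnected := convex_integrableExpSet.ordConnected
  by_contra hcon
  obtain ⟨x, hx, hxS⟩ := Set.not_subset.1 hcon
  have hlow : ∀ s ∈ S, s < b → x ≤ s := by
    intro s hs hsb
    by_contra! hlt
    obtain ⟨v, hv1, hv2⟩ := exists_between (max_lt hx.2 hpb)
    rw [max_lt_iff] at hv1
    exact hxS (hord.out hs (hS ⟨hv1.2, hv2⟩) ⟨hlt.le, hv1.1.le⟩)
  have hbdd : BddBelow (S ∩ Set.Iio b) := ⟨x, fun s hs => hlow s hs.1 hs.2⟩
  have hup : ∀ v, p < v → v < b → v ∈ S ∩ Set.Iio b := fun v h1 h2 => ⟨hS ⟨h1, h2⟩, h2⟩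
  obtain ⟨v, hv1, hv2⟩ := exists_between hpb
  set σ := sInf (S ∩ Set.Iio b) with hσ
  have hxσ : x ≤ σ := le_csInf ⟨v, hup v hv1 hv2⟩ fun s hs => hlow s hs.1 hs.2
  have hσb : σ < b := (csInf_le hbdd (hup v hv1 hv2)).trans_lt hv2
  have hIoo : Set.Ioo σ b ⊆ S := by
    intro y hy
    obtain ⟨s, hs, hsy⟩ := exists_lt_of_csInf_lt ⟨v, hup v hv1 hv2⟩ hy.1
    obtain ⟨w, hw1, hw2⟩ := exists_between (max_lt hy.2 hpb)
    rw [max_lt_iff] at hw1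
    exact hord.out hs.1 (hS ⟨hw1.2, hw2⟩) ⟨hsy.le, hw1.1.le⟩
  have hEq : Set.EqOn F (mgf Y μ) (Set.Ioo σ b) := by
    obtain ⟨w, hw1, hw2⟩ := exists_between (max_lt hσb hpb)
    rw [max_lt_iff] at hw1
    refine (hF.mono (Set.Ioo_subset_Ioo_left (hx.1.le.trans hxσ))).eqOn_of_preconnected_of_eventuallyEq
      (analyticOnNhd_mgf.mono (interior_maximal hIoo isOpen_Ioo)) isPreconnected_Ioo
      ⟨hw1.1, hw2⟩ (Filter.eventuallyEq_of_mem (Ioo_mem_nhds hw1.2 hw2) hFm)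
  obtain ⟨τ, hτ, hτS⟩ := exists_lt_mem_integrableExpSet_of_analyticAt hσb
    (hF σ ⟨hx.1.trans_le hxσ, hσb⟩) hIoo hEq
  exact hτ.not_ge (csInf_le hbdd ⟨hτS, hτ.trans hσb⟩)

/-- The factor relating `nodeKernel` to Beta integrals. -/
noncomputable def gammaFactor (z : ℂ) : ℂ :=
  Complex.Gamma (1 - z) * Complex.Gamma (2 * z + 1 / 2) / Complex.Gamma (z + 1 / 2)

theorem gammaFactor_ne_zero {z : ℂ} (h0 : 0 < z.re) (h1 : z.re < 1) : gammaFactor z ≠ 0 := by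
  refine div_ne_zero (mul_ne_zero ?_ ?_) ?_ <;> refine Complex.Gamma_ne_zero_of_re_pos ?_
  · simpa using h1
  · simp
    linarith
  · simp
    linarith

theorem analyticOnNhd_gammaFactor : AnalyticOnNhd ℂ gammaFactor {z | 0 < z.re ∧ z.re < 1} := by
  have hG : ∀ w : ℂ, 0 < w.re → DifferentiableAt ℂ Complex.Gamma w := fun w hw => by
    refine Complex.differentiableAt_Gamma w fun m hm => ?_
    rw [hm, Complex.neg_re, Complex.natCast_re] at hw
    linarith [(m.cast_nonneg : (0 : ℝ) ≤ m)]
  refine DifferentiableOn.analyticOnNhd (fun z hz => DifferentiableAt.differentiableWithinAt ?_)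
    ((isOpen_lt continuous_const Complex.continuous_re).inter
      (isOpen_lt Complex.continuous_re continuous_const))
  obtain ⟨h0, h1⟩ := hz
  have a1 : 0 < (1 - z).re := by simpa using h1
  have a2 : 0 < (2 * z + 1 / 2).re := by
    simp
    linarith
  have a3 : 0 < (z + 1 / 2).re := by
    simp
    linarith
  refine ((DifferentiableAt.comp z (hG _ a1) (by fun_prop)).mul
    (DifferentiableAt.comp z (hG _ a2) (by fun_prop))).div
    (DifferentiableAt.comp z (hG _ a3) (by fun_prop)) (Complex.Gamma_ne_zero_of_re_pos a3)

theorem gammaFactor_ofReal (x : ℝ) : gammaFactor x =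
    ((Real.Gamma (1 - x) * Real.Gamma (2 * x + 1 / 2) / Real.Gamma (x + 1 / 2) : ℝ) : ℂ) := by
  rw [gammaFactor]
  push_cast [← Complex.Gamma_ofReal]
  rfl

open ProbabilityTheory in
theorem beta_eq_nodeKernel_mul {x : ℝ} (h0 : 0 < x) (h1 : x < 1) (n : ℕ) :
    beta (n + 1 - x) (2 * x + 1 / 2) = nodeKernel n x * (gammaFactor x).re := by
  have e1 : Real.Gamma (n + 1 - x) =
      Real.Gamma (1 - x) * ∏ j ∈ Finset.range n, ((j : ℝ) + 1 - x) := by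
    induction n with
    | zero => simp
    | succ n ih =>
      have : (0 : ℝ) ≤ n := n.cast_nonneg
      rw [Finset.prod_range_succ, ← mul_assoc, ← ih, mul_comm,
        ← Real.Gamma_add_one (by linarith)]
      push_cast
      ring_nf
  have e2 : ∀ m : ℕ, Real.Gamma (x + 1 / 2 + m) =
      Real.Gamma (x + 1 / 2) * ∏ j ∈ Finset.range m, (x + j + 1 / 2) := by
    intro m
    induction m with
    | zero => simp
    | succ m ih =>
      have : (0 : ℝ) ≤ m := m.cast_nonneg
      rw [Finset.prod_range_succ, ← mul_assoc, ← ih, mul_comm,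
        show x + m + 1 / 2 = x + 1 / 2 + m by ring, ← Real.Gamma_add_one (by linarith)]
      push_cast
      ring_nf
  rw [beta, gammaFactor_ofReal, Complex.ofReal_re, nodeKernel,
    show (n : ℝ) + 1 - x + (2 * x + 1 / 2) = x + 1 / 2 + (n + 1 : ℕ) by push_cast; ring, e1, e2]
  have hp : ∏ j ∈ Finset.range (n + 1), (x + j + 1 / 2) ≠ 0 :=
    Finset.prod_ne_zero_iff.2 fun j _ => by positivity
  have hG : Real.Gamma (x + 1 / 2) ≠ 0 := (Real.Gamma_pos_of_pos (by linarith)).ne'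
  generalize ∏ j ∈ Finset.range (n + 1), (x + j + 1 / 2) = P at *
  generalize ∏ j ∈ Finset.range n, ((j : ℝ) + 1 - x) = Q at *
  generalize Real.Gamma (x + 1 / 2) = g at *
  field_simp

theorem nodeKernel_nonneg {x : ℝ} (h0 : 0 < x) (h1 : x < 1) (n : ℕ) : 0 ≤ nodeKernel n x := by
  refine div_nonneg (Finset.prod_nonneg fun j _ => ?_) (Finset.prod_nonneg fun j _ => ?_)
  · linarith [(j.cast_nonneg : (0 : ℝ) ≤ j)]
  · positivity

open MeasureTheory ProbabilityTheory in
theorem lintegral_exp_mul_log {x : ℝ} (h0 : 0 < x) (h1 : x < 1) (n : ℕ) :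
    ∫⁻ z in Set.Ioo (0 : ℝ) 1, ENNReal.ofReal (z ^ n * (1 - z) ^ (-(1 / 2) : ℝ)) *
      ENNReal.ofReal (Real.exp (x * (2 * Real.log (1 - z) - Real.log z))) =
    ENNReal.ofReal (beta (n + 1 - x) (2 * x + 1 / 2)) := by
  have hn : (0 : ℝ) ≤ n := n.cast_nonneg
  have ha : 0 < n + 1 - x := by linarith
  have hb : 0 < 2 * x + 1 / 2 := by linarith
  have hB := beta_pos ha hb
  have h := lintegral_betaPDF_eq_one ha hb
  rw [lintegral_betaPDF] at h
  rw [← mul_one (ENNReal.ofReal (beta _ _)), ← h, ← lintegral_const_mul' _ _ ENNReal.ofReal_ne_top]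
  refine setLIntegral_congr_fun measurableSet_Ioo fun z hz => ?_
  obtain ⟨hz0, hz1⟩ := hz
  have hz1' : 0 < 1 - z := by linarith
  rw [← ENNReal.ofReal_mul (by positivity), ← ENNReal.ofReal_mul hB.le]
  congr 1
  rw [mul_assoc (1 / _), ← mul_assoc, mul_one_div_cancel hB.ne', one_mul, ← Real.rpow_natCast z n,
    Real.rpow_def_of_pos hz0, Real.rpow_def_of_pos hz0, Real.rpow_def_of_pos hz1',
    Real.rpow_def_of_pos hz1', ← Real.exp_add, ← Real.exp_add, ← Real.exp_add]
  congr 1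
  ring

open MeasureTheory ProbabilityTheory in
/-- If the nonnegative series `∑ w n * nodeKernel n x` converges for `x` in `T`, it is a moment
generating function there, up to the factor `gammaFactor`. -/
theorem exists_mgf_eq_of_hasSum_nodeKernel {w : ℕ → ℝ} (hw : ∀ n, 0 ≤ w n) {T : Set ℝ}
    (hT : T ⊆ Set.Ioo 0 1) {f : ℝ → ℝ} (hf : ∀ x ∈ T, HasSum (fun n => w n * nodeKernel n x) (f x)) :
    ∃ (μ : Measure ℝ) (Y : ℝ → ℝ), ∀ x ∈ T, x ∈ integrableExpSet Y μ ∧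
      mgf Y μ x = f x * (gammaFactor x).re := by
  let μ : Measure ℝ := Measure.sum fun n => ENNReal.ofReal (w n) •
    (volume.restrict (Set.Ioo (0 : ℝ) 1)).withDensity
      fun z => ENNReal.ofReal (z ^ n * (1 - z) ^ (-(1 / 2) : ℝ))
  let Y : ℝ → ℝ := fun z => 2 * Real.log (1 - z) - Real.log z
  have hY : Measurable Y := by fun_prop
  refine ⟨μ, Y, fun x hx => ?_⟩
  obtain ⟨h0, h1⟩ := hT hx
  have hg : 0 ≤ (gammaFactor x).re := by
    rw [gammaFactor_ofReal, Complex.ofReal_re]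
    exact div_nonneg (mul_nonneg (Real.Gamma_nonneg_of_nonneg (by linarith))
      (Real.Gamma_nonneg_of_nonneg (by linarith))) (Real.Gamma_nonneg_of_nonneg (by linarith))
  have hs := (hf x hx).mul_right (gammaFactor x).re
  have hnn : ∀ n, 0 ≤ w n * nodeKernel n x * (gammaFactor x).re := fun n =>
    mul_nonneg (mul_nonneg (hw n) (nodeKernel_nonneg h0 h1 n)) hg
  have hmeas : Measurable fun z => ENNReal.ofReal (Real.exp (x * Y z)) := by fun_prop
  have hl : ∫⁻ z, ENNReal.ofReal (Real.exp (x * Y z)) ∂μ =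
      ENNReal.ofReal (f x * (gammaFactor x).re) := by
    rw [lintegral_sum_measure, ← hs.tsum_eq, ENNReal.ofReal_tsum_of_nonneg hnn hs.summable]
    refine tsum_congr fun n => ?_
    rw [lintegral_smul_measure, lintegral_withDensity_eq_lintegral_mul _ (by fun_prop) hmeas,
      smul_eq_mul, mul_assoc, ENNReal.ofReal_mul (hw n), ← beta_eq_nodeKernel_mul h0 h1,
      ← lintegral_exp_mul_log h0 h1]
    rfl
  have hm : AEStronglyMeasurable (fun z => Real.exp (x * Y z)) μ :=
    (by fun_prop : Measurable fun z => Real.exp (x * Y z)).aestronglyMeasurable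
  refine ⟨⟨hm, ?_⟩, ?_⟩
  · rw [hasFiniteIntegral_iff_ofReal (.of_forall fun z => (Real.exp_pos _).le), hl]
    exact ENNReal.ofReal_lt_top
  · rw [mgf, integral_eq_lintegral_of_nonneg_ae (.of_forall fun z => (Real.exp_pos _).le) hm, hl,
      ENNReal.toReal_ofReal]
    rw [← hs.tsum_eq]
    exact tsum_nonneg hnn

theorem xi2_two_mul_ofReal_ne_zero {x : ℝ} (h0 : 0 < x) : xi2 (2 * x) ≠ 0 := by
  refine xi2_ne_zero_of_riemannZeta_ne_zero (by simpa using h0) fun _ => ?_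
  rcases lt_or_ge (2 * x) 1 with h | h
  · exact_mod_cast riemannZeta_ne_zero_of_mem_Ioo (s := 2 * x) (by linarith) h
  · exact riemannZeta_ne_zero_of_one_le_re (by simpa using h)

theorem analyticAt_xi2_two_mul {z : ℂ} (hz : 0 < z.re) : AnalyticAt ℂ (fun z => xi2 (2 * z)) z :=
  AnalyticAt.fun_comp (f := fun z : ℂ => 2 * z) (analyticOnNhd_xi2 (2 * z) (by simpa using hz))
    (by fun_prop)

theorem analyticAt_log_norm_xi2 {x : ℝ} (h0 : 0 < x) :
    AnalyticAt ℝ (fun x : ℝ => Real.log ‖xi2 (2 * x)‖) x := by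
  have hc : AnalyticAt ℂ (fun z => xi2 (2 * z)) (x : ℂ) := analyticAt_xi2_two_mul (by simpa using h0)
  have hn := Complex.normSq_pos.2 (xi2_two_mul_ofReal_ne_zero h0)
  rw [Complex.normSq_apply] at hn
  have h := ((hc.re_ofReal.mul hc.re_ofReal).add (hc.im_ofReal.mul hc.im_ofReal)).log hn
  refine (h.div_const (c := 2)).congr (.of_forall fun y => ?_)
  change Real.log ((xi2 (2 * y)).re * (xi2 (2 * y)).re + (xi2 (2 * y)).im * (xi2 (2 * y)).im) / 2 = _
  rw [← Complex.normSq_apply, Complex.normSq_eq_norm_sq, Real.log_pow]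
  push_cast
  ring

theorem analyticAt_dslope {f : ℝ → ℝ} {a x : ℝ} (ha : AnalyticAt ℝ f a) (hx : AnalyticAt ℝ f x) :
    AnalyticAt ℝ (dslope f a) x := by
  rcases eq_or_ne x a with rfl | hne
  · obtain ⟨p, hp⟩ := ha
    exact hp.has_fpower_series_dslope_fslope.analyticAt
  · have : AnalyticAt ℝ (fun y => (y - a)⁻¹ * (f y - f a)) x :=
      ((analyticAt_id.sub analyticAt_const).inv (sub_ne_zero.2 hne)).mul (hx.sub analyticAt_const)
    refine this.congr ?_
    filter_upwards [isOpen_ne.mem_nhds hne] with y hy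
    rw [dslope_of_ne _ hy, slope, vsub_eq_sub, smul_eq_mul]

/-- The complex version of `nodeKernel`. -/
noncomputable def complexNodeKernel (n : ℕ) (z : ℂ) : ℂ :=
  (∏ j ∈ Finset.range n, ((j + 1) - z)) / ∏ j ∈ Finset.range (n + 1), (z + j + 1 / 2)

theorem complexNodeKernel_ofReal (n : ℕ) (x : ℝ) : complexNodeKernel n x = nodeKernel n x := by
  rw [complexNodeKernel, nodeKernel]
  push_cast
  rfl

theorem analyticAt_complexNodeKernel (n : ℕ) {z : ℂ} (hz : 0 < z.re) :
    AnalyticAt ℂ (complexNodeKernel n) z := by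
  refine AnalyticAt.div (Finset.analyticAt_fun_prod _ fun j _ => by fun_prop)
    (Finset.analyticAt_fun_prod _ fun j _ => by fun_prop) (Finset.prod_ne_zero_iff.2 fun j _ h => ?_)
  have := congrArg Complex.re h
  simp at this
  linarith [(j.cast_nonneg : (0 : ℝ) ≤ j)]

open Filter Topology Finset in
theorem hasSum_nodeKernel_of_Lambda_nonneg {N₀ : ℕ} (hN : ∀ n, N₀ ≤ n → 0 ≤ Lambda n) {x : ℝ}
    (hx : x ∈ Set.Ioo (9 / 10) 1) :
    HasSum (fun n => (if n < N₀ then 0 else Lambda (n + 1) + Lambda n) * nodeKernel n x)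
      (-(Real.log ‖xi2 (2 * x)‖ / (2 * (x * (x - 1 / 2)))) -
        ∑ n ∈ range N₀, (Lambda (n + 1) + Lambda n) * nodeKernel n x) := by
  rw [hasSum_iff_tendsto_nat_of_nonneg]
  · refine ((tendsto_sum_Lambda_mul_nodeKernel hx).sub_const
      (∑ n ∈ range N₀, (Lambda (n + 1) + Lambda n) * nodeKernel n x)).congr' ?_
    filter_upwards [eventually_ge_atTop N₀] with N hle
    rw [← sum_range_add_sum_Ico _ hle, ← sum_range_add_sum_Ico _ hle, add_sub_cancel_left,
      sum_eq_zero (s := range N₀), zero_add]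
    · refine sum_congr rfl fun n hn => ?_
      rw [if_neg (mem_Ico.1 hn).1.not_gt]
    · intro n hn
      rw [if_pos (mem_range.1 hn), zero_mul]
  · intro n
    refine mul_nonneg ?_ (nodeKernel_nonneg (by linarith [hx.1]) hx.2 n)
    split_ifs with h
    · exact le_rfl
    · exact add_nonneg (hN _ (by omega)) (hN _ (by omega))

open Filter Topology Finset MeasureTheory ProbabilityTheory in
theorem xi2_two_mul_ne_zero_of_Lambda_nonneg {N₀ : ℕ} (hN : ∀ n, N₀ ≤ n → 0 ≤ Lambda n) {z : ℂ}
    (hz0 : 1 / 4 < z.re) (hz1 : z.re < 1) : xi2 (2 * z) ≠ 0 := by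
  obtain ⟨μ, Y, hμ⟩ := exists_mgf_eq_of_hasSum_nodeKernel (T := Set.Ioo (9 / 10) 1)
    (w := fun n => if n < N₀ then 0 else Lambda (n + 1) + Lambda n) (fun n => by
      split_ifs with h
      · exact le_rfl
      · exact add_nonneg (hN _ (by omega)) (hN _ (by omega)))
    (Set.Ioo_subset_Ioo_left (by norm_num))
    (fun x hx => hasSum_nodeKernel_of_Lambda_nonneg hN hx)
  have hS : Set.Ioo (1 / 4) 1 ⊆ integrableExpSet Y μ := by
    refine Ioo_subset_integrableExpSet_of_analyticOnNhd (p := 9 / 10) (F := fun x =>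
      (-(dslope (fun x : ℝ => Real.log ‖xi2 (2 * x)‖) (1 / 2) x / (2 * x)) -
        ∑ n ∈ range N₀, (Lambda (n + 1) + Lambda n) * (complexNodeKernel n x).re) *
          (gammaFactor x).re)
      (by norm_num) (fun x hx => ?_) (fun x hx => (hμ x hx).1) fun x hx => ?_
    · obtain ⟨h1, h2⟩ := hx
      have h0 : 0 < x := by linarith
      refine AnalyticAt.mul (AnalyticAt.sub (AnalyticAt.neg (AnalyticAt.div (analyticAt_dslope
        (analyticAt_log_norm_xi2 (by norm_num)) (analyticAt_log_norm_xi2 h0)) (by fun_prop)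
        (by positivity))) (Finset.analyticAt_fun_sum _ fun n _ => analyticAt_const.mul
        (analyticAt_complexNodeKernel n (by simpa using h0)).re_ofReal))
        (analyticOnNhd_gammaFactor (x : ℂ) ⟨by simpa using h0, by simpa using h2⟩).re_ofReal
    · rw [(hμ x hx).2]
      have hx1 := hx.1
      have e1 : xi2 (2 * ((1 / 2 : ℝ) : ℂ)) = 1 := by
        rw [xi2, if_pos (by right; push_cast; norm_num)]
      beta_reduce
      rw [dslope_of_ne _ (by linarith), slope, vsub_eq_sub, smul_eq_mul, e1, norm_one, Real.log_one,
        sub_zero, inv_mul_eq_div, div_div, sum_congr rfl fun n _ => by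
          rw [complexNodeKernel_ofReal, Complex.ofReal_re]]
      congr 4
      ring
  have hIoo : Set.Ioo (1 / 4) 1 ⊆ interior (integrableExpSet Y μ) := interior_maximal hS isOpen_Ioo
  set V : Set ℂ := {z | 1 / 4 < z.re ∧ z.re < 1} with hV
  have hVo : IsOpen V := (isOpen_lt continuous_const Complex.continuous_re).inter
    (isOpen_lt Complex.continuous_re continuous_const)
  have hVc : IsPreconnected V :=
    ((convex_Ioo (1 / 4 : ℝ) 1).linear_preimage Complex.reLm).isPreconnected
  let E : ℂ → ℂ := fun z => Complex.exp (2 * (-(2 * (z * (z - 1 / 2))) *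
    (∑ n ∈ range N₀, ((Lambda (n + 1) + Lambda n : ℝ) : ℂ) * complexNodeKernel n z +
      complexMGF Y μ z / gammaFactor z)))
  let P : ℂ → ℂ := fun z => xi2 (2 * z) * starRingEnd ℂ (xi2 (2 * starRingEnd ℂ z))
  have hE : AnalyticOnNhd ℂ E V := by
    intro w hw
    have h0 : 0 < w.re := by linarith [hw.1]
    have a1 : AnalyticAt ℂ (fun z => ∑ n ∈ range N₀,
        ((Lambda (n + 1) + Lambda n : ℝ) : ℂ) * complexNodeKernel n z) w :=
      Finset.analyticAt_fun_sum _ fun n _ => analyticAt_const.mul (analyticAt_complexNodeKernel n h0)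
    have a2 : AnalyticAt ℂ (fun z => complexMGF Y μ z / gammaFactor z) w :=
      (analyticAt_complexMGF (hIoo hw)).div (analyticOnNhd_gammaFactor w ⟨h0, hw.2⟩)
        (gammaFactor_ne_zero h0 hw.2)
    exact (analyticAt_const.mul (AnalyticAt.mul (by fun_prop) (a1.add a2))).cexp
  have hP : AnalyticOnNhd ℂ P V := by
    refine DifferentiableOn.analyticOnNhd (fun w hw => ?_) hVo
    have h0 : 0 < w.re := by linarith [hw.1]
    refine ((analyticAt_xi2_two_mul h0).differentiableAt.mul ?_).differentiableWithinAt
    have := (analyticAt_xi2_two_mul (z := starRingEnd ℂ w) (by simpa using h0)).differentiableAt.conj_conj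
    rw [Complex.conj_conj] at this
    exact this
  have hreal : ∀ x ∈ Set.Ioo (9 / 10 : ℝ) 1, E x = P x := by
    intro x hx
    obtain ⟨hx1, hx2⟩ := hx
    have hg := gammaFactor_ne_zero (z := x) (by simp; linarith) (by simpa using hx2)
    have hgr : gammaFactor x = ((gammaFactor x).re : ℂ) := by
      rw [gammaFactor_ofReal, Complex.ofReal_re]
    have hg' : (gammaFactor x).re ≠ 0 := fun h => hg (by rw [hgr, h, Complex.ofReal_zero])
    have e1 : -(2 * ((x : ℂ) * (x - 1 / 2))) * (∑ n ∈ range N₀,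
        ((Lambda (n + 1) + Lambda n : ℝ) : ℂ) * complexNodeKernel n x +
        complexMGF Y μ x / gammaFactor x) = ((Real.log ‖xi2 (2 * x)‖ : ℝ) : ℂ) := by
      rw [complexMGF_ofReal, (hμ x ⟨hx1, hx2⟩).2, hgr, ← Complex.ofReal_div, Complex.ofReal_re,
        mul_div_cancel_right₀ _ hg', sum_congr rfl fun n _ => by rw [complexNodeKernel_ofReal],
        show -(2 * ((x : ℂ) * (x - 1 / 2))) = ((-(2 * (x * (x - 1 / 2))) : ℝ) : ℂ) by push_cast; rfl]
      simp_rw [← Complex.ofReal_mul, ← Complex.ofReal_sum, ← Complex.ofReal_add,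
        ← Complex.ofReal_mul]
      congr 1
      rw [add_sub_cancel, neg_mul_neg, mul_div_cancel₀]
      have : 0 < x - 1 / 2 := by linarith
      positivity
    change Complex.exp (2 * _) = xi2 (2 * x) * starRingEnd ℂ (xi2 (2 * starRingEnd ℂ (x : ℂ)))
    rw [e1, Complex.conj_ofReal, Complex.mul_conj, Complex.normSq_eq_norm_sq, two_mul, Complex.exp_add,
      ← Complex.ofReal_exp, Real.exp_log (norm_pos_iff.2 (xi2_two_mul_ofReal_ne_zero (by linarith))),
      sq, Complex.ofReal_mul]
  have hEP : Set.EqOn E P V := by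
    refine hE.eqOn_of_preconnected_of_frequently_eq hP hVc (z₀ := ((19 / 20 : ℝ) : ℂ))
      ⟨by rw [Complex.ofReal_re]; norm_num, by rw [Complex.ofReal_re]; norm_num⟩ ?_
    have ht : Tendsto (fun x : ℝ => (x : ℂ)) (𝓝[≠] (19 / 20)) (𝓝[≠] ((19 / 20 : ℝ) : ℂ)) :=
      Complex.continuous_ofReal.continuousWithinAt.tendsto_nhdsWithin fun x hx h =>
        hx (Complex.ofReal_injective h)
    refine ht.frequently (Eventually.frequently (eventually_nhdsWithin_of_eventually_nhds ?_))
    filter_upwards [Ioo_mem_nhds (a := (9 / 10 : ℝ)) (b := 1) (by norm_num) (by norm_num)] with x hx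
      using hreal x hx
  intro h
  have := hEP (show z ∈ V from ⟨hz0, hz1⟩)
  rw [show P z = 0 by change xi2 (2 * z) * _ = 0; rw [h, zero_mul]] at this
  exact Complex.exp_ne_zero _ this

/-- If RH is false (there is a zero of `2ξ` with real part `> 1/2`), then
`Λ_n < 0` for infinitely many `n`. -/
theorem lambda_neg_infinitely_often_of_not_RH
    (h : ∃ ρ : ℂ, xi2 ρ = 0 ∧ 1 / 2 < ρ.re) :
    {n : ℕ | Lambda n < 0}.Infinite := by
  obtain ⟨ρ, hρ, hre⟩ := h
  intro hfin
  obtain ⟨N, hN⟩ := hfin.bddAbove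
  have hnn : ∀ n, N + 1 ≤ n → 0 ≤ Lambda n := fun n hn => by
    by_contra! hneg
    exact absurd (hN hneg) (by omega)
  have h1 : ρ.re < 1 := by
    by_contra! hge
    exact xi2_ne_zero_of_riemannZeta_ne_zero (by linarith)
      (fun _ => riemannZeta_ne_zero_of_one_le_re hge) hρ
  refine xi2_two_mul_ne_zero_of_Lambda_nonneg hnn (z := ρ / 2) ?_ ?_ ?_
  · simp
    linarith
  · simp
    linarith
  · rwa [mul_div_cancel₀ _ two_ne_zero]
end

section
/- Li's criterion: the Riemann Hypothesis is true if and only if λ_n^L > 0 for every integer n ≥ 1. -/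
open scoped Nat BigOperators

/-- `Φ(z) = log 2ξ(1/(1-z))` (principal branch), analytic near `z = 0`. -/
noncomputable def PhiKL (z : ℂ) : ℂ := Complex.log (xi2 (1 / (1 - z)))

/-- Keiper's constants `λ_n^K`: the `n`-th Taylor coefficient of `Φ` at `0`
(a real number; we take the real part). -/
noncomputable def lambdaK (n : ℕ) : ℝ := (iteratedDeriv n PhiKL 0 / (Nat.factorial n : ℂ)).re

/-- Li's constants `λ_n^L = n·λ_n^K`. -/
noncomputable def lambdaL (n : ℕ) : ℝ := n * lambdaK n

open Complex Filter Topology Set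

/-- The entire function `s (s - 1) Λ(s)`, where `Λ` is the completed Riemann zeta function. -/
noncomputable def entireXi (s : ℂ) : ℂ := s * (s - 1) * completedRiemannZeta₀ s + 1

lemma differentiable_entireXi : Differentiable ℂ entireXi := by
  unfold entireXi
  have := differentiable_completedZeta₀
  fun_prop

lemma entireXi_one_sub (s : ℂ) : entireXi (1 - s) = entireXi s := by
  simp only [entireXi, completedRiemannZeta₀_one_sub]
  ring

lemma entireXi_one : entireXi 1 = 1 := by simp [entireXi]

lemma entireXi_eq_completedRiemannZeta {s : ℂ} (h0 : s ≠ 0) (h1 : s ≠ 1) :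
    entireXi s = s * (s - 1) * completedRiemannZeta s := by
  have h1' : 1 - s ≠ 0 := sub_ne_zero.mpr h1.symm
  rw [completedRiemannZeta_eq, entireXi]
  field_simp
  ring

lemma entireXi_eq_riemannZeta {s : ℂ} (hs : 0 < s.re) (h1 : s ≠ 1) :
    entireXi s = s * (s - 1) * (Gammaℝ s * riemannZeta s) := by
  have h0 : s ≠ 0 := by rintro rfl; simp at hs
  rw [entireXi_eq_completedRiemannZeta h0 h1, riemannZeta_def_of_ne_zero h0,
    mul_div_cancel₀ _ (Gammaℝ_ne_zero_of_re_pos hs)]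

lemma xi2_eq_entireXi {s : ℂ} (hs : 0 < s.re) : xi2 s = entireXi s := by
  have h0 : s ≠ 0 := by rintro rfl; simp at hs
  by_cases h1 : s = 1
  · simp [xi2, h1, entireXi_one]
  · rw [xi2, if_neg (by tauto), entireXi_eq_riemannZeta hs h1, Gammaℝ]
    ring

lemma entireXi_conj (s : ℂ) : entireXi (starRingEnd ℂ s) = starRingEnd ℂ (entireXi s) := by
  have h_pos (s : ℂ) (hs : 0 < s.re) :
      entireXi (starRingEnd ℂ s) = starRingEnd ℂ (entireXi s) := by
    by_cases h1 : s = 1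
    · simp [h1, entireXi_one]
    · have h1' : starRingEnd ℂ s ≠ 1 := by
        intro h
        exact h1 (by simpa using congrArg (starRingEnd ℂ) h)
      rw [entireXi_eq_riemannZeta hs h1, entireXi_eq_riemannZeta (by simpa using hs) h1',
        riemannZeta_conj, Gammaℝ, Gammaℝ]
      have hpi : ((Real.pi : ℂ)) ^ (-(starRingEnd ℂ s) / 2) =
          starRingEnd ℂ ((Real.pi : ℂ) ^ (-s / 2)) := by
        have harg : arg (Real.pi : ℂ) ≠ Real.pi := by
          rw [arg_ofReal_of_nonneg Real.pi_pos.le]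
          exact Real.pi_ne_zero.symm
        have := cpow_conj _ (-s / 2) harg
        rwa [conj_ofReal, map_div₀, map_neg, map_ofNat] at this
      have hG : Gamma (starRingEnd ℂ s / 2) = starRingEnd ℂ (Gamma (s / 2)) := by
        rw [← Gamma_conj, map_div₀, map_ofNat]
      rw [hpi, hG]
      simp
  rcases lt_or_ge 0 s.re with hs | hs
  · exact h_pos s hs
  · have := h_pos (1 - s) (by simp; linarith)
    rwa [map_sub, map_one, entireXi_one_sub, entireXi_one_sub] at this

/-- The Riemann hypothesis says that `entireXi` has no zero to the right of the critical line. -/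
lemma riemannHypothesis_iff_entireXi_ne_zero :
    RiemannHypothesis ↔ ∀ s : ℂ, 1 / 2 < s.re → entireXi s ≠ 0 := by
  constructor
  · intro h s hs h0
    have hs1 : s ≠ 1 := by rintro rfl; simp [entireXi_one] at h0
    have hpos : 0 < s.re := by linarith
    have hs0 : s ≠ 0 := by rintro rfl; simp at hpos
    have hz : riemannZeta s = 0 := by
      rw [entireXi_eq_riemannZeta hpos hs1] at h0
      simpa [hs0, sub_ne_zero.mpr hs1, Gammaℝ_ne_zero_of_re_pos hpos] using h0
    have := h s hz (by
      rintro ⟨n, rfl⟩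
      have : (0 : ℝ) ≤ n := n.cast_nonneg
      simp at hpos
      linarith) hs1
    linarith
  · intro h s hz hn hs1
    have hs0 : s ≠ 0 := by
      rintro rfl
      norm_num [riemannZeta_zero] at hz
    have hG : Gammaℝ s ≠ 0 := by
      rw [Ne, Gammaℝ_eq_zero_iff]
      rintro ⟨n, rfl⟩
      rcases n with _ | n
      · simp at hs0
      · exact hn ⟨n, by push_cast; ring⟩
    have hΛ : completedRiemannZeta s = 0 := by
      rw [riemannZeta_def_of_ne_zero hs0] at hz
      simpa [hG] using hz
    have hX : entireXi s = 0 := by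
      rw [entireXi_eq_completedRiemannZeta hs0 hs1, hΛ, mul_zero]
    rcases lt_trichotomy s.re (1 / 2) with hlt | heq | hgt
    · exact absurd (entireXi_one_sub s ▸ hX) (h (1 - s) (by simp; linarith))
    · exact heq
    · exact absurd hX (h s hgt)
    
lemma norm_mellin_le {f : ℝ → ℂ} {a b : ℝ} (ha : MellinConvergent f a) (hb : MellinConvergent f b) :
    ∃ C, ∀ s : ℂ, a ≤ s.re → s.re ≤ b → ‖mellin f s‖ ≤ C := by
  refine ⟨∫ t in Ioi (0 : ℝ), (‖(t : ℂ) ^ ((a : ℂ) - 1) • f t‖ + ‖(t : ℂ) ^ ((b : ℂ) - 1) • f t‖),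
    fun s has hsb ↦ ?_⟩
  refine MeasureTheory.norm_integral_le_of_norm_le
    (MeasureTheory.Integrable.add ha.norm hb.norm) ?_
  filter_upwards [MeasureTheory.ae_restrict_mem measurableSet_Ioi] with t ht
  rw [mem_Ioi] at ht
  simp only [norm_smul, ← add_mul]
  gcongr
  simp only [norm_cpow_eq_rpow_re_of_pos ht, sub_re, ofReal_re, one_re]
  rcases le_total 1 t with h | h
  · have := Real.rpow_le_rpow_of_exponent_le h (sub_le_sub_right hsb 1)
    have := Real.rpow_nonneg ht.le (a - 1)
    linarith
  · have := Real.rpow_le_rpow_of_exponent_ge ht h (sub_le_sub_right has 1)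
    have := Real.rpow_nonneg ht.le (b - 1)
    linarith

lemma exists_norm_completedRiemannZeta₀_le (a b : ℝ) :
    ∃ C, ∀ s : ℂ, a ≤ s.re → s.re ≤ b → ‖completedRiemannZeta₀ s‖ ≤ C := by
  have hM (s : ℂ) : MellinConvergent (HurwitzZeta.hurwitzEvenFEPair 0).f_modif s :=
    ((HurwitzZeta.hurwitzEvenFEPair 0).isStrongFEPair_toStrongFEPair.hasMellin s).1
  obtain ⟨C, hC⟩ := norm_mellin_le (hM (a / 2 : ℝ)) (hM (b / 2 : ℝ))
  refine ⟨C / 2, fun s has hsb ↦ ?_⟩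
  have := hC (s / 2) (by simpa using by linarith) (by simpa using by linarith)
  rw [completedRiemannZeta₀, HurwitzZeta.completedHurwitzZetaEven₀, norm_div, WeakFEPair.Λ₀]
  simpa using by linarith

lemma exists_norm_entireXi_le (a b : ℝ) :
    ∃ C, 1 ≤ C ∧ ∀ s : ℂ, a ≤ s.re → s.re ≤ b → ‖entireXi s‖ ≤ C * (1 + |s.im|) ^ 2 := by
  obtain ⟨C, hC⟩ := exists_norm_completedRiemannZeta₀_le a b
  set M := 1 + |a| + |b| with hM
  refine ⟨(M + 1) ^ 2 * max C 0 + 1, by simp; positivity, fun s has hsb ↦ ?_⟩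
  have hre : |s.re| ≤ M := by
    rw [abs_le]
    constructor <;> linarith [neg_abs_le a, le_abs_self b, abs_nonneg a, abs_nonneg b]
  have hM1 : 1 ≤ M := by linarith [abs_nonneg a, abs_nonneg b]
  have him := abs_nonneg s.im
  have h1 : ‖s‖ ≤ (M + 1) * (1 + |s.im|) := by
    nlinarith [norm_le_abs_re_add_abs_im s]
  have h2 : ‖s - 1‖ ≤ (M + 1) * (1 + |s.im|) := by
    have := norm_sub_le s 1
    rw [norm_one] at this
    nlinarith [norm_le_abs_re_add_abs_im s]
  calc ‖entireXi s‖ ≤ ‖s‖ * ‖s - 1‖ * ‖completedRiemannZeta₀ s‖ + 1 := by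
        refine (norm_add_le _ _).trans ?_
        simp
    _ ≤ ((M + 1) * (1 + |s.im|)) * ((M + 1) * (1 + |s.im|)) * max C 0 + (1 + |s.im|) ^ 2 := by
        gcongr
        · exact (hC s has hsb).trans (le_max_left _ _)
        · nlinarith
    _ = _ := by ring

lemma Complex.norm_Gamma_le_of_re_pos {s : ℂ} (hs : 0 < s.re) : ‖Gamma s‖ ≤ Real.Gamma s.re := by
  rw [Gamma_eq_integral hs, Real.Gamma_eq_integral hs, GammaIntegral]
  refine (MeasureTheory.norm_integral_le_integral_norm _).trans_eq ?_
  refine MeasureTheory.setIntegral_congr_fun measurableSet_Ioi fun x hx ↦ ?_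
  rw [mem_Ioi] at hx
  simp [norm_cpow_eq_rpow_re_of_pos hx, abs_of_pos (Real.exp_pos _), -ofReal_exp]

lemma norm_betaIntegral_mul_Gamma_le {u : ℂ} (hu : 0 < u.re) {v : ℝ} (hv : 0 < v) :
    ‖betaIntegral u v‖ * Real.Gamma (u.re + v) ≤ Real.Gamma u.re * Real.Gamma v := by
  have hconv := betaIntegral_convergent (u := (u.re : ℂ)) (v := (v : ℂ)) (by simpa) (by simpa)
  have hint : betaIntegral u.re v =
      ((∫ x in (0 : ℝ)..1, ‖(x : ℂ) ^ (u - 1) * (1 - (x : ℂ)) ^ ((v : ℂ) - 1)‖ : ℝ) : ℂ) := by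
    rw [betaIntegral, ← intervalIntegral.integral_ofReal]
    refine intervalIntegral.integral_congr_ae ?_
    rw [uIoc_of_le zero_le_one]
    filter_upwards [MeasureTheory.Measure.ae_ne MeasureTheory.volume (1 : ℝ)] with x hx1 hx
    have h0 : 0 < x := hx.1
    have h1 : 0 < 1 - x := sub_pos.mpr (lt_of_le_of_ne hx.2 hx1)
    have h1' : (1 : ℂ) - x = ((1 - x : ℝ) : ℂ) := by push_cast; rfl
    rw [norm_mul, h1', norm_cpow_eq_rpow_re_of_pos h0, norm_cpow_eq_rpow_re_of_pos h1,
      ofReal_mul, ofReal_cpow h0.le, ofReal_cpow h1.le]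
    simp
  have hG := Gamma_mul_Gamma_eq_betaIntegral (s := (u.re : ℂ)) (t := (v : ℂ)) (by simpa) (by simpa)
  rw [hint, ← ofReal_add, Gamma_ofReal, Gamma_ofReal, Gamma_ofReal] at hG
  have hG' : Real.Gamma u.re * Real.Gamma v = Real.Gamma (u.re + v) *
      ∫ x in (0 : ℝ)..1, ‖(x : ℂ) ^ (u - 1) * (1 - (x : ℂ)) ^ ((v : ℂ) - 1)‖ := by
    exact_mod_cast hG
  rw [hG', mul_comm]
  have := Real.Gamma_pos_of_pos (add_pos hu hv)
  gcongr
  exact intervalIntegral.norm_integral_le_integral_norm zero_le_one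

lemma norm_Gamma_mul_Gamma_add_le {u : ℂ} (hu : 0 < u.re) {v : ℝ} (hv : 0 < v) :
    ‖Gamma u‖ * Real.Gamma (u.re + v) ≤ ‖Gamma (u + v)‖ * Real.Gamma u.re := by
  have hG := congrArg norm (Gamma_mul_Gamma_eq_betaIntegral (s := u) (t := (v : ℂ)) hu (by simpa))
  have hvpos := Real.Gamma_pos_of_pos hv
  rw [norm_mul, norm_mul, Gamma_ofReal, norm_real, Real.norm_of_nonneg hvpos.le] at hG
  refine le_of_mul_le_mul_right ?_ hvpos
  calc ‖Gamma u‖ * Real.Gamma (u.re + v) * Real.Gamma v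
      = ‖Gamma u‖ * Real.Gamma v * Real.Gamma (u.re + v) := by ring
    _ = ‖Gamma (u + v)‖ * (‖betaIntegral u v‖ * Real.Gamma (u.re + v)) := by rw [hG]; ring
    _ ≤ ‖Gamma (u + v)‖ * (Real.Gamma u.re * Real.Gamma v) :=
      mul_le_mul_of_nonneg_left (norm_betaIntegral_mul_Gamma_le hu hv) (norm_nonneg _)
    _ = _ := by ring

lemma Real.mul_Gamma_le_rpow_mul_Gamma_add {x v : ℝ} (hx : 0 < x) (hv : 0 < v) (hv1 : v < 1) :
    x * Real.Gamma x ≤ (x + v) ^ (1 - v) * Real.Gamma (x + v) := by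
  have hxv : 0 < x + v := add_pos hx hv
  have h := Real.Gamma_mul_add_mul_le_rpow_Gamma_mul_rpow_Gamma hxv (t := x + v + 1) (by linarith)
    hv (sub_pos.mpr hv1) (by ring)
  have hG := Real.Gamma_pos_of_pos hxv
  rw [show v * (x + v) + (1 - v) * (x + v + 1) = x + 1 by ring, Real.Gamma_add_one hx.ne',
    Real.Gamma_add_one hxv.ne', Real.mul_rpow hxv.le hG.le] at h
  calc x * Real.Gamma x ≤ _ := h
    _ = (x + v) ^ (1 - v) * (Real.Gamma (x + v) ^ v * Real.Gamma (x + v) ^ (1 - v)) := by ring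
    _ = _ := by rw [← Real.rpow_add hG]; simp

/-- Adding `v` to the argument increases `‖Γ‖` by a factor of about `(re u) ^ v` or more. -/
lemma norm_Gamma_le_rpow_mul_norm_Gamma_add {u : ℂ} {v : ℝ} (hv : 0 < v) (hv1 : v < 1)
    (hu : 1 ≤ u.re) : ‖Gamma u‖ ≤ 2 * u.re ^ (-v) * ‖Gamma (u + v)‖ := by
  have hx : 0 < u.re := by linarith
  have h1 := norm_Gamma_mul_Gamma_add_le hx hv
  have h2 := Real.mul_Gamma_le_rpow_mul_Gamma_add hx hv hv1
  have hG := Real.Gamma_pos_of_pos (add_pos hx hv)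
  have h3 : (u.re + v) ^ (1 - v) ≤ 2 * u.re ^ (1 - v) := by
    calc (u.re + v) ^ (1 - v) ≤ (2 * u.re) ^ (1 - v) := by
          apply Real.rpow_le_rpow <;> linarith
      _ = 2 ^ (1 - v) * u.re ^ (1 - v) := Real.mul_rpow (by norm_num) hx.le
      _ ≤ 2 ^ (1 : ℝ) * u.re ^ (1 - v) := by
          gcongr
          · norm_num
          · linarith
      _ = _ := by simp
  have h4 : u.re ^ (1 - v) = u.re * u.re ^ (-v) := by
    rw [sub_eq_add_neg, Real.rpow_add hx, Real.rpow_one]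
  have h5 : Real.Gamma u.re ≤ 2 * u.re ^ (-v) * Real.Gamma (u.re + v) := by
    refine le_of_mul_le_mul_left ?_ hx
    calc _ ≤ _ := h2
      _ ≤ 2 * u.re ^ (1 - v) * Real.Gamma (u.re + v) := by gcongr
      _ = _ := by rw [h4]; ring
  refine le_of_mul_le_mul_right ?_ hG
  calc _ ≤ _ := h1
    _ ≤ ‖Gamma (u + v)‖ * (2 * u.re ^ (-v) * Real.Gamma (u.re + v)) := by gcongr
    _ = _ := by ring

lemma norm_Gammaℝ_le_rpow_mul_norm_Gammaℝ_add {s : ℂ} {h : ℝ} (h0 : 0 < h) (h1 : h ≤ 1)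
    (hs : 2 ≤ s.re) : ‖Gammaℝ s‖ ≤ 8 * (s.re / 2) ^ (-(h / 2)) * ‖Gammaℝ (s + h)‖ := by
  have hΓ := norm_Gamma_le_rpow_mul_norm_Gamma_add (u := s / 2) (v := h / 2) (by linarith)
    (by linarith) (by simpa using by linarith)
  have hre : (s / 2).re = s.re / 2 := by simp
  have hsum : s / 2 + (h / 2 : ℝ) = (s + h) / 2 := by push_cast; ring
  rw [hre, hsum] at hΓ
  have hpi : Real.pi ^ (-s.re / 2) ≤ 4 * Real.pi ^ (-(s.re + h) / 2) := by
    have hsplit : -s.re / 2 = h / 2 + -(s.re + h) / 2 := by ring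
    rw [hsplit, Real.rpow_add Real.pi_pos]
    gcongr
    calc Real.pi ^ (h / 2) ≤ Real.pi ^ (1 : ℝ) := by
          apply Real.rpow_le_rpow_of_exponent_le <;> linarith [Real.pi_gt_three]
      _ ≤ 4 := by simpa using Real.pi_le_four
  have hn (w : ℂ) : ‖(Real.pi : ℂ) ^ (-w / 2)‖ = Real.pi ^ (-w.re / 2) := by
    rw [norm_cpow_eq_rpow_re_of_pos Real.pi_pos]
    simp
  rw [Gammaℝ, Gammaℝ, norm_mul, norm_mul, hn, hn]
  have hre' : (s + h).re = s.re + h := by simp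
  rw [hre']
  calc _ ≤ (4 * Real.pi ^ (-(s.re + h) / 2)) *
        (2 * (s.re / 2) ^ (-(h / 2)) * ‖Gamma ((s + h) / 2)‖) := by gcongr
    _ = _ := by ring

lemma norm_riemannZeta_sub_one_le {s : ℂ} (hs : 2 ≤ s.re) : ‖riemannZeta s - 1‖ ≤ 2 / 3 := by
  have hsum := hasSum_zeta_two
  rw [← hasSum_nat_add_iff' 2] at hsum
  have h1s : 1 < s.re := by linarith
  have hsummable : Summable fun n : ℕ ↦ 1 / ((n : ℂ) + 1) ^ s := by
    have := (summable_nat_add_iff 1).mpr (Complex.summable_one_div_nat_cpow.mpr h1s)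
    simpa using this
  have hz : riemannZeta s - 1 = ∑' n : ℕ, 1 / ((n : ℂ) + 2) ^ s := by
    rw [zeta_eq_tsum_one_div_nat_add_one_cpow h1s, hsummable.tsum_eq_zero_add]
    simp [add_assoc, one_add_one_eq_two]
  rw [hz]
  refine (tsum_of_norm_bounded hsum fun n ↦ ?_).trans ?_
  · have hcast : (n : ℂ) + 2 = ((n + 2 : ℕ) : ℂ) := by push_cast; rfl
    rw [norm_div, norm_one, hcast, norm_natCast_cpow_of_pos (by omega)]
    have h1 : (1 : ℝ) ≤ (n + 2 : ℕ) := by push_cast; linarith [n.cast_nonneg (α := ℝ)]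
    gcongr
    rw [← Real.rpow_natCast]
    exact Real.rpow_le_rpow_of_exponent_le h1 (by simpa using hs)
  · have := Real.pi_lt_d2
    have := Real.pi_gt_three
    simp [Finset.sum_range_succ]
    nlinarith

lemma norm_riemannZeta_le_five_mul {s t : ℂ} (hs : 2 ≤ s.re) (ht : 2 ≤ t.re) :
    ‖riemannZeta s‖ ≤ 5 * ‖riemannZeta t‖ := by
  have h1 := norm_riemannZeta_sub_one_le hs
  have h2 := norm_riemannZeta_sub_one_le ht
  have h3 := norm_sub_norm_le (riemannZeta s) 1
  have h4 := norm_sub_norm_le 1 (riemannZeta t)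
  rw [norm_sub_rev] at h4
  rw [norm_one] at h3 h4
  linarith

lemma norm_le_norm_add_ofReal {s : ℂ} {h : ℝ} (hs : 0 ≤ s.re) (h0 : 0 ≤ h) : ‖s‖ ≤ ‖s + h‖ := by
  rw [← sq_le_sq₀ (norm_nonneg _) (norm_nonneg _), Complex.sq_norm, Complex.sq_norm,
    normSq_apply, normSq_apply]
  simp
  nlinarith

lemma norm_entireXi_le_rpow_mul {s : ℂ} {h : ℝ} (h0 : 0 < h) (h1 : h ≤ 1) (hs : 2 ≤ s.re) :
    ‖entireXi s‖ ≤ 40 * (s.re / 2) ^ (-(h / 2)) * ‖entireXi (s + h)‖ := by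
  have hne (w : ℂ) (hw : 2 ≤ w.re) : w ≠ 1 := by rintro rfl; norm_num at hw
  have hsh : 2 ≤ (s + h).re := by simp; linarith
  rw [entireXi_eq_riemannZeta (by linarith) (hne s hs),
    entireXi_eq_riemannZeta (by linarith) (hne _ hsh)]
  simp only [norm_mul]
  have e1 := norm_le_norm_add_ofReal (s := s) (by linarith) h0.le
  have e2 : ‖s - 1‖ ≤ ‖s + h - 1‖ := by
    have := norm_le_norm_add_ofReal (s := s - 1) (h := h) (by simp; linarith) h0.le
    rwa [sub_add_eq_add_sub] at this
  calc _ ≤ ‖s + h‖ * ‖s + h - 1‖ * ((8 * (s.re / 2) ^ (-(h / 2)) * ‖Gammaℝ (s + h)‖) *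
        (5 * ‖riemannZeta (s + h)‖)) := by
        gcongr
        · exact norm_Gammaℝ_le_rpow_mul_norm_Gammaℝ_add h0 h1 hs
        · exact norm_riemannZeta_le_five_mul hs hsh
    _ = _ := by ring

lemma Complex.norm_sin_le_exp_abs_im (w : ℂ) : ‖sin w‖ ≤ Real.exp |w.im| := by
  rw [sin, norm_div, norm_mul, norm_I, mul_one, norm_ofNat]
  have h := norm_sub_le (exp (-w * I)) (exp (w * I))
  rw [norm_exp, norm_exp] at h
  have h1 : Real.exp (-w * I).re ≤ Real.exp |w.im| :=
    Real.exp_le_exp.mpr (by simpa using le_abs_self w.im)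
  have h2 : Real.exp (w * I).re ≤ Real.exp |w.im| :=
    Real.exp_le_exp.mpr (by simpa using neg_le_abs w.im)
  linarith

lemma exp_neg_le_norm_Gamma_half_add (y : ℝ) :
    Real.exp (-(Real.pi * |y|)) ≤ ‖Gamma (1 / 2 + y * I)‖ := by
  set z : ℂ := 1 / 2 + y * I with hz
  have hG := Gamma_mul_Gamma_one_sub z
  have hzre : z.re = 1 / 2 := by simp [hz]
  have hz1 : ‖Gamma (1 - z)‖ ≤ Real.sqrt Real.pi := by
    refine (Complex.norm_Gamma_le_of_re_pos (by simp [hzre]; norm_num)).trans_eq ?_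
    rw [← Real.Gamma_one_half_eq, sub_re, hzre]
    norm_num
  have hsin : ‖sin (Real.pi * z)‖ ≤ Real.exp (Real.pi * |y|) := by
    refine (Complex.norm_sin_le_exp_abs_im _).trans_eq ?_
    simp [hz, abs_mul, abs_of_pos Real.pi_pos]
  have hsin0 : sin (Real.pi * z) ≠ 0 := by
    intro h0
    rw [h0, div_zero] at hG
    exact (mul_ne_zero (Gamma_ne_zero_of_re_pos (by rw [hzre]; norm_num))
      (Gamma_ne_zero_of_re_pos (by rw [sub_re, hzre]; norm_num))) hG
  rw [eq_div_iff hsin0] at hG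
  have hn := congrArg norm hG
  rw [norm_mul, norm_mul, norm_real, Real.norm_of_nonneg Real.pi_pos.le] at hn
  have hsq : Real.sqrt Real.pi ≤ Real.pi := by
    rw [Real.sqrt_le_left Real.pi_pos.le]
    nlinarith [Real.pi_gt_three]
  have key : Real.pi ≤ ‖Gamma z‖ * Real.pi * Real.exp (Real.pi * |y|) := by
    calc Real.pi = ‖Gamma z‖ * ‖Gamma (1 - z)‖ * ‖sin (Real.pi * z)‖ := hn.symm
      _ ≤ _ := by gcongr; exact hz1.trans hsq
  rw [Real.exp_neg, inv_le_iff_one_le_mul₀ (Real.exp_pos _)]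
  have := Real.pi_pos
  nlinarith

lemma exists_exp_neg_le_norm_entireXi_three :
    ∃ B, 0 ≤ B ∧ ∀ t : ℝ, Real.exp (-(B * (1 + |t|))) ≤ ‖entireXi (3 + t * I)‖ := by
  set c : ℝ := Real.pi ^ (-3 / 2 : ℝ) * (1 / 6) with hc
  have hc0 : 0 < c := by positivity
  refine ⟨|Real.log c| + Real.pi, by positivity, fun t ↦ ?_⟩
  set s : ℂ := 3 + t * I with hs
  have hsre : s.re = 3 := by simp [hs]
  have hs1 : s ≠ 1 := by intro h; rw [h] at hsre; norm_num at hsre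
  have e1 : 3 ≤ ‖s‖ := by simpa [hsre] using abs_re_le_norm s
  have e2 : 2 ≤ ‖s - 1‖ := by
    have := abs_re_le_norm (s - 1)
    rw [sub_re, hsre, one_re] at this
    norm_num at this
    exact this
  have e3 : 1 / 3 ≤ ‖riemannZeta s‖ := by
    have h2 := norm_riemannZeta_sub_one_le (s := s) (by linarith)
    have h4 := norm_sub_norm_le 1 (riemannZeta s)
    rw [norm_sub_rev, norm_one] at h4
    linarith
  have e4 : Real.pi ^ (-3 / 2 : ℝ) * (1 / 2 * Real.exp (-(Real.pi * |t|))) ≤ ‖Gammaℝ s‖ := by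
    have hG : Gamma (s / 2) = (1 / 2 + (t / 2 : ℝ) * I) * Gamma (1 / 2 + (t / 2 : ℝ) * I) := by
      rw [← Gamma_add_one _ (by intro h; simpa using congrArg re h)]
      congr 1
      rw [hs]
      push_cast
      ring
    rw [Gammaℝ, norm_mul, norm_cpow_eq_rpow_re_of_pos Real.pi_pos, hG, norm_mul]
    have hre : (-s / 2).re = -3 / 2 := by simp [hsre]
    rw [hre]
    gcongr
    · simpa using abs_re_le_norm (1 / 2 + (t / 2 : ℝ) * I)
    · refine le_trans ?_ (exp_neg_le_norm_Gamma_half_add (t / 2))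
      apply Real.exp_le_exp.mpr
      rw [abs_div, abs_two]
      nlinarith [mul_nonneg Real.pi_pos.le (abs_nonneg t)]
  rw [entireXi_eq_riemannZeta (by linarith) hs1]
  simp only [norm_mul]
  calc Real.exp (-((|Real.log c| + Real.pi) * (1 + |t|)))
      ≤ Real.exp (Real.log c + -(Real.pi * |t|)) := by
        apply Real.exp_le_exp.mpr
        nlinarith [neg_abs_le (Real.log c), Real.pi_pos, abs_nonneg t, abs_nonneg (Real.log c),
          mul_nonneg (abs_nonneg (Real.log c)) (abs_nonneg t)]
    _ = c * Real.exp (-(Real.pi * |t|)) := by rw [Real.exp_add, Real.exp_log hc0]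
    _ = 1 * 1 * (Real.pi ^ (-3 / 2 : ℝ) * (1 / 2 * Real.exp (-(Real.pi * |t|))) * (1 / 3)) := by
        rw [hc]; ring
    _ ≤ _ := by gcongr <;> linarith

/-- A nonvanishing holomorphic function on a disc has a holomorphic logarithm. -/
lemma exists_differentiableOn_log_ball {f : ℂ → ℂ} {c : ℂ} {r : ℝ}
    (hf : DifferentiableOn ℂ f (Metric.ball c r)) (hne : ∀ z ∈ Metric.ball c r, f z ≠ 0)
    (hr : 0 < r) :
    ∃ L : ℂ → ℂ, L c = log (f c) ∧ ∀ z ∈ Metric.ball c r,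
      exp (L z) = f z ∧ HasDerivAt L (logDeriv f z) z := by
  have hc : c ∈ Metric.ball c r := Metric.mem_ball_self hr
  have hd : DifferentiableOn ℂ (logDeriv f) (Metric.ball c r) :=
    (hf.deriv Metric.isOpen_ball).div hf hne
  obtain ⟨L, hLc, hL⟩ := hd.isExactOn_ball.with_val_at c (log (f c))
  refine ⟨L, hLc, fun z hz ↦ ⟨?_, hL z hz⟩⟩
  have hderiv (w : ℂ) (hw : w ∈ Metric.ball c r) :
      HasDerivWithinAt (fun w ↦ f w * exp (-L w)) 0 (Metric.ball c r) w := by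
    have hfw := (hf.differentiableAt (Metric.isOpen_ball.mem_nhds hw)).hasDerivAt
    have := hfw.mul (hL w hw).neg.cexp
    refine (this.congr_deriv ?_).hasDerivWithinAt
    have hw0 := hne w hw
    rw [logDeriv_apply]
    field_simp
    ring
  have hconst := (convex_ball c r).norm_image_sub_le_of_norm_hasDerivWithin_le (C := 0) hderiv
    (by simp) hc hz
  rw [zero_mul, norm_le_zero_iff, sub_eq_zero, hLc, exp_neg, exp_neg, exp_log (hne c hc),
    mul_inv_cancel₀ (hne c hc), mul_inv_eq_one₀ (exp_ne_zero _)] at hconst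
  exact hconst.symm

/-- To the right of the critical line, the Borel–Carathéodory theorem bounds `entireXi` from below
when it has no zeros there. -/
lemma exists_exp_neg_le_norm_entireXi (hX : ∀ s : ℂ, 1 / 2 < s.re → entireXi s ≠ 0) {h : ℝ}
    (h0 : 0 < h) :
    ∃ B, 0 ≤ B ∧ ∀ s : ℂ, 1 / 2 + h ≤ s.re → s.re ≤ 3 →
      Real.exp (-(B * (1 + |s.im|))) ≤ ‖entireXi s‖ := by
  obtain ⟨B₀, hB₀, hlow⟩ := exists_exp_neg_le_norm_entireXi_three
  obtain ⟨C, hC1, hup⟩ := exists_norm_entireXi_le (1 / 2) (11 / 2)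
  set B₁ := Real.log (13 * C) + 2 + B₀ with hB₁
  have hlog : 0 ≤ Real.log (13 * C) := Real.log_nonneg (by linarith)
  have hB₁0 : 0 < B₁ := by linarith
  refine ⟨B₀ + 5 * B₁ / h, by positivity, fun s hs hs3 ↦ ?_⟩
  set t := s.im with ht
  set c : ℂ := 3 + t * I with hc
  have hcre : c.re = 3 := by simp [hc]
  have hcim : c.im = t := by simp [hc]
  have ht0 : 0 ≤ |t| := abs_nonneg t
  have hmem (u : ℂ) (hu : u ∈ Metric.ball (0 : ℂ) (5 / 2)) :
      1 / 2 < (c + u).re ∧ (c + u).re ≤ 11 / 2 ∧ |(c + u).im| ≤ |t| + 5 / 2 := by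
    rw [mem_ball_zero_iff] at hu
    have h1 := (abs_lt.mp ((abs_re_le_norm u).trans_lt hu))
    have h2 := ((abs_im_le_norm u).trans hu.le)
    refine ⟨by rw [add_re, hcre]; linarith, by rw [add_re, hcre]; linarith, ?_⟩
    rw [add_im, hcim]
    exact (abs_add_le _ _).trans (by linarith)
  have hXc : 0 < ‖entireXi c‖ := norm_pos_iff.mpr (hX c (by rw [hcre]; norm_num))
  set f : ℂ → ℂ := fun u ↦ entireXi (c + u) / entireXi c with hf
  have hfd : Differentiable ℂ f :=
    (differentiable_entireXi.comp (differentiable_id.const_add c)).div_const _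
  have hf0 : f 0 = 1 := by simp [hf, norm_pos_iff.mp hXc]
  obtain ⟨L, hL0, hL⟩ := exists_differentiableOn_log_ball (c := 0) (r := 5 / 2)
    hfd.differentiableOn (fun u hu ↦ div_ne_zero (hX _ (hmem u hu).1) (norm_pos_iff.mp hXc))
    (by norm_num)
  have hM : 0 < B₁ * (1 + |t|) := by positivity
  have hre (u : ℂ) (hu : u ∈ Metric.ball (0 : ℂ) (5 / 2)) : (L u).re ≤ B₁ * (1 + |t|) := by
    rw [← Real.exp_le_exp, ← norm_exp, (hL u hu).1, hf, norm_div, div_le_iff₀ hXc]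
    obtain ⟨g1, g2, g3⟩ := hmem u hu
    have hsq : (1 + |t|) ^ 2 ≤ Real.exp (2 * (1 + |t|)) := by
      have := Real.add_one_le_exp |t|
      calc (1 + |t|) ^ 2 ≤ (Real.exp (1 + |t|)) ^ 2 := by
            gcongr
            linarith [Real.add_one_le_exp (1 + |t|)]
        _ = _ := by rw [← Real.exp_nat_mul]; norm_num
    have hlogexp : 13 * C ≤ Real.exp (Real.log (13 * C) * (1 + |t|)) := by
      calc 13 * C = Real.exp (Real.log (13 * C)) := (Real.exp_log (by linarith)).symm
        _ ≤ _ := Real.exp_le_exp.mpr (by nlinarith)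
    calc ‖entireXi (c + u)‖ ≤ C * (1 + |(c + u).im|) ^ 2 := hup _ g1.le g2
      _ ≤ C * ((7 / 2) * (1 + |t|)) ^ 2 := by gcongr; linarith
      _ ≤ 13 * C * (1 + |t|) ^ 2 := by nlinarith [sq_nonneg (1 + |t|)]
      _ ≤ Real.exp (Real.log (13 * C) * (1 + |t|)) * Real.exp (2 * (1 + |t|)) := by gcongr
      _ = Real.exp (B₁ * (1 + |t|)) * Real.exp (-(B₀ * (1 + |t|))) := by
          rw [← Real.exp_add, ← Real.exp_add, hB₁]
          ring_nf
      _ ≤ _ := by gcongr; exact hlow t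
  have hnorm : ‖s - c‖ = 3 - s.re := by
    have : s - c = ((s.re - 3 : ℝ) : ℂ) := by
      apply Complex.ext <;> simp [hc, ht]
    rw [this, norm_real, Real.norm_eq_abs, abs_of_nonpos (by linarith)]
    ring
  have hmem' : s - c ∈ Metric.ball (0 : ℂ) (5 / 2) := by
    rw [mem_ball_zero_iff, hnorm]
    linarith
  have hBC := borelCaratheodory_zero hM
    (fun u hu ↦ (hL u hu).2.differentiableAt.differentiableWithinAt) hre (by norm_num) hmem'
    (by rw [hL0, hf0, log_one])
  have hBC' : ‖L (s - c)‖ ≤ 5 * B₁ / h * (1 + |t|) := by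
    refine hBC.trans ?_
    rw [hnorm, div_mul_eq_mul_div]
    apply div_le_div₀ (by positivity) _ h0 (by linarith)
    nlinarith
  have hval : entireXi s = entireXi c * exp (L (s - c)) := by
    rw [(hL _ hmem').1, hf]
    field_simp [norm_pos_iff.mp hXc]
    simp
  rw [hval, norm_mul, norm_exp]
  calc _ = Real.exp (-(B₀ * (1 + |t|))) * Real.exp (-(5 * B₁ / h * (1 + |t|))) := by
        rw [← Real.exp_add]
        ring_nf
    _ ≤ _ := by
        gcongr
        · exact hlow t
        · linarith [neg_abs_le (L (s - c)).re, abs_re_le_norm (L (s - c))]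

lemma norm_entireXi_eq_of_re {z : ℂ} {h : ℝ} (hz : z.re = 1 / 2 - h / 2) :
    ‖entireXi z‖ = ‖entireXi (z + h)‖ := by
  have : z + h = starRingEnd ℂ (1 - z) := by
    apply Complex.ext
    · simp [hz]
      ring
    · simp
  rw [this, entireXi_conj, entireXi_one_sub, norm_conj]

/-- If `entireXi` has no zeros to the right of the critical line, its modulus increases there. -/
lemma norm_entireXi_le_norm_entireXi_add (hX : ∀ s : ℂ, 1 / 2 < s.re → entireXi s ≠ 0) {h : ℝ}
    (h0 : 0 < h) (h1 : h ≤ 1) {s : ℂ} (hs : 1 / 2 ≤ s.re) :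
    ‖entireXi s‖ ≤ ‖entireXi (s + h)‖ := by
  set a : ℝ := 1 / 2 - h / 2 with ha
  set b : ℝ := 3 + 2 * (40 : ℝ) ^ (2 / h) with hb
  have hb3 : 3 ≤ b := by
    have : (0 : ℝ) < (40 : ℝ) ^ (2 / h) := by positivity
    linarith
  have hright (z : ℂ) (hz : b ≤ z.re) : ‖entireXi z‖ ≤ ‖entireXi (z + h)‖ := by
    refine (norm_entireXi_le_rpow_mul h0 h1 (by linarith)).trans ?_
    refine mul_le_of_le_one_left (norm_nonneg _) ?_
    have hz2 : (40 : ℝ) ^ (2 / h) ≤ z.re / 2 := by linarith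
    have : (40 : ℝ) ≤ (z.re / 2) ^ (h / 2) := by
      calc (40 : ℝ) = ((40 : ℝ) ^ (2 / h)) ^ (h / 2) := by
            rw [← Real.rpow_mul (by norm_num), show 2 / h * (h / 2) = 1 by field_simp,
              Real.rpow_one]
        _ ≤ _ := by gcongr
    rw [Real.rpow_neg (by linarith), ← div_eq_mul_inv, div_le_one (by linarith)]
    exact this
  rcases le_or_gt b s.re with hbs | hsb
  · exact hright s hbs
  have hne (z : ℂ) (hz : a ≤ z.re) : entireXi (z + h) ≠ 0 :=
    hX _ (by simp; linarith)
  have hcont : DiffContOnCl ℂ (fun z ↦ entireXi z / entireXi (z + h)) (re ⁻¹' Ioo a b) := by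
    have hX' : Differentiable ℂ fun z : ℂ ↦ entireXi (z + h) :=
      differentiable_entireXi.comp (differentiable_id.add_const _)
    refine DifferentiableOn.diffContOnCl fun z hz ↦ ?_
    have hz' : z ∈ re ⁻¹' Icc a b :=
      closure_minimal (preimage_mono Ioo_subset_Icc_self) (isClosed_Icc.preimage continuous_re) hz
    exact ((differentiable_entireXi z).div (hX' z) (hne z hz'.1)).differentiableWithinAt
  have hgrowth : ∃ K B, 0 ≤ B ∧ ∀ z : ℂ, a ≤ z.re → z.re ≤ b →
      ‖entireXi z / entireXi (z + h)‖ ≤ K * Real.exp (B * (1 + |z.im|)) := by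
    obtain ⟨C, hC1, hup⟩ := exists_norm_entireXi_le a b
    obtain ⟨B, hB, hlow⟩ := exists_exp_neg_le_norm_entireXi hX (h := h / 2) (by linarith)
    refine ⟨C + 40, B + 2, by linarith, fun z hza hzb ↦ ?_⟩
    have hpos : 0 < ‖entireXi (z + h)‖ := norm_pos_iff.mpr (hne z hza)
    have ht0 := abs_nonneg z.im
    rw [norm_div]
    rcases le_total (z + h).re 3 with h3 | h3
    · have hl := hlow (z + h) (by simp; linarith) h3
      have him : (z + h).im = z.im := by simp
      rw [him] at hl
      have hsq : (1 + |z.im|) ^ 2 ≤ Real.exp (2 * (1 + |z.im|)) := by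
        calc (1 + |z.im|) ^ 2 ≤ (Real.exp (1 + |z.im|)) ^ 2 := by
              gcongr
              linarith [Real.add_one_le_exp (1 + |z.im|)]
          _ = _ := by rw [← Real.exp_nat_mul]; norm_num
      rw [div_le_iff₀ hpos]
      calc ‖entireXi z‖ ≤ C * (1 + |z.im|) ^ 2 := hup z hza hzb
        _ ≤ (C + 40) * Real.exp (2 * (1 + |z.im|)) := by gcongr; linarith
        _ = (C + 40) * Real.exp ((B + 2) * (1 + |z.im|)) * Real.exp (-(B * (1 + |z.im|))) := by
            rw [mul_assoc, ← Real.exp_add]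
            ring_nf
        _ ≤ _ := by gcongr
    · have h3' : 3 ≤ z.re + h := by simpa using h3
      have hr := norm_entireXi_le_rpow_mul h0 h1 (s := z) (by linarith)
      have hle1 : (z.re / 2) ^ (-(h / 2)) ≤ 1 :=
        Real.rpow_le_one_of_one_le_of_nonpos (by linarith) (by linarith)
      have hexp : 1 ≤ Real.exp ((B + 2) * (1 + |z.im|)) := Real.one_le_exp (by positivity)
      rw [div_le_iff₀ hpos]
      calc _ ≤ _ := hr
        _ ≤ 40 * 1 * ‖entireXi (z + h)‖ := by gcongr
        _ ≤ _ := by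
          gcongr
          · linarith
  have hstrip := PhragmenLindelof.vertical_strip (C := 1) (z := s) hcont ?_ ?_ ?_
    (by linarith) hsb.le
  · rwa [norm_div, div_le_one (norm_pos_iff.mpr (hne s (by linarith)))] at hstrip
  · obtain ⟨K, B, hB, hg⟩ := hgrowth
    have hab : 0 < b - a := by linarith
    set c : ℝ := Real.pi / (b - a) / 2 with hc
    have hc0 : 0 < c := by have := Real.pi_pos; positivity
    refine ⟨c, half_lt_self (div_pos Real.pi_pos hab), B / c, ?_⟩
    refine Asymptotics.IsBigO.of_bound (|K| * Real.exp B) ?_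
    refine (eventually_principal.mpr fun z hz ↦ ?_).filter_mono inf_le_right
    refine (hg z hz.1.le hz.2.le).trans ?_
    rw [Real.norm_of_nonneg (Real.exp_pos _).le, mul_assoc, ← Real.exp_add]
    have hlin : |z.im| ≤ Real.exp (c * |z.im|) / c := by
      rw [le_div_iff₀ hc0]
      linarith [Real.add_one_le_exp (c * |z.im|)]
    have hexp : B * (1 + |z.im|) ≤ B + B / c * Real.exp (c * |z.im|) := by
      calc B * (1 + |z.im|) ≤ B * (1 + Real.exp (c * |z.im|) / c) := by gcongr
        _ = _ := by ring
    gcongr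
    exact le_abs_self K
  · intro z hz
    rw [norm_div, norm_entireXi_eq_of_re hz]
    exact div_self_le_one _
  · intro z hz
    rw [norm_div, div_le_one (norm_pos_iff.mpr (hne z (by rw [hz]; linarith)))]
    exact hright z hz.ge

lemma hasDerivAt_norm_sq_entireXi_add (s : ℂ) (x : ℝ) :
    HasDerivAt (fun y : ℝ ↦ ‖entireXi (s + y)‖ ^ 2)
      (2 * (‖entireXi (s + x)‖ ^ 2 * (logDeriv entireXi (s + x)).re)) x := by
  have h1 : HasDerivAt (fun y : ℝ ↦ s + (y : ℂ)) 1 x := by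
    simpa using (ofRealCLM.hasDerivAt (x := x)).const_add s
  have h2 := ((differentiable_entireXi (s + x)).hasDerivAt.scomp x h1).norm_sq
  refine h2.congr_deriv ?_
  rw [one_smul, Complex.inner, logDeriv_apply]
  by_cases h0 : entireXi (s + x) = 0
  · simp [h0]
  · congr 1
    rw [← normSq_eq_norm_sq, ← re_ofReal_mul, normSq_eq_conj_mul_self]
    congr 1
    simp only [Function.comp_apply]
    field_simp

lemma re_logDeriv_entireXi_nonneg (hX : ∀ s : ℂ, 1 / 2 < s.re → entireXi s ≠ 0) {s : ℂ}
    (hs : 1 / 2 < s.re) : 0 ≤ (logDeriv entireXi s).re := by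
  have hd := hasDerivAt_norm_sq_entireXi_add s 0
  have hnonneg : 0 ≤ 2 * (‖entireXi (s + (0 : ℝ))‖ ^ 2 *
      (logDeriv entireXi (s + (0 : ℝ))).re) := by
    refine ge_of_tendsto ((hasDerivWithinAt_iff_tendsto_slope'
      self_notMem_Ioi).mp hd.hasDerivWithinAt) ?_
    filter_upwards [Ioc_mem_nhdsGT (zero_lt_one' ℝ)] with h hh
    rw [slope_def_field]
    have := norm_entireXi_le_norm_entireXi_add hX hh.1 hh.2 hs.le
    apply div_nonneg _ (by linarith [hh.1])
    rw [sub_nonneg]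
    gcongr
    simpa using this
  rw [ofReal_zero, add_zero] at hnonneg
  have hpos : 0 < ‖entireXi s‖ := norm_pos_iff.mpr (hX s hs)
  by_contra! hneg
  nlinarith [mul_neg_of_pos_of_neg (pow_pos hpos 2) hneg]

lemma factorial_mul_le_norm_entireXi (m : ℕ) :
    m ! * Real.pi⁻¹ ^ (m + 1) / 3 ≤ ‖entireXi (2 * (m + 1 : ℕ))‖ := by
  set s : ℂ := 2 * (m + 1 : ℕ) with hs
  have hm : (0 : ℝ) ≤ m := m.cast_nonneg
  have hsre : s.re = 2 * (m + 1) := by simp [hs]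
  have hs1 : s ≠ 1 := by intro h; rw [h, one_re] at hsre; linarith
  have e1 : 1 ≤ ‖s‖ := by
    have := (le_abs_self _).trans (abs_re_le_norm s)
    linarith
  have e2 : 1 ≤ ‖s - 1‖ := by
    have := (le_abs_self _).trans (abs_re_le_norm (s - 1))
    rw [sub_re, hsre, one_re] at this
    linarith
  have e3 : 1 / 3 ≤ ‖riemannZeta s‖ := by
    have h2 := norm_riemannZeta_sub_one_le (s := s) (by linarith)
    have h4 := norm_sub_norm_le 1 (riemannZeta s)
    rw [norm_sub_rev, norm_one] at h4
    linarith
  have e4 : ‖Gammaℝ s‖ = m ! * Real.pi⁻¹ ^ (m + 1) := by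
    have h2 : s / 2 = (m : ℂ) + 1 := by rw [hs]; push_cast; ring
    have h3 : -s / 2 = -((m + 1 : ℕ) : ℂ) := by rw [hs]; ring
    rw [Gammaℝ, h2, h3, Gamma_nat_eq_factorial, norm_mul, cpow_neg, cpow_natCast, norm_inv,
      norm_pow, norm_real, Real.norm_of_nonneg Real.pi_pos.le, norm_natCast, inv_pow, mul_comm]
  rw [entireXi_eq_riemannZeta (by linarith) hs1]
  simp only [norm_mul]
  rw [e4]
  calc _ = 1 * 1 * (m ! * Real.pi⁻¹ ^ (m + 1) * (1 / 3)) := by ring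
    _ ≤ _ := by
      have := Real.pi_pos
      gcongr

/-- The logarithmic derivative of `entireXi` is unbounded on the real axis. -/
lemma exists_lt_re_logDeriv_entireXi (K x₀ : ℝ) :
    ∃ x : ℝ, x₀ ≤ x ∧ K < (logDeriv entireXi x).re := by
  by_contra! hK
  have hd (x : ℝ) : HasDerivAt (fun y : ℝ ↦ ‖entireXi y‖ ^ 2 * Real.exp (-(2 * K * y)))
      (2 * (‖entireXi x‖ ^ 2 * (logDeriv entireXi x).re) * Real.exp (-(2 * K * x)) +
        ‖entireXi x‖ ^ 2 * (Real.exp (-(2 * K * x)) * -(2 * K))) x := by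
    have h1 := hasDerivAt_norm_sq_entireXi_add 0 x
    simp only [zero_add] at h1
    have h2 : HasDerivAt (fun y : ℝ ↦ -(2 * K * y)) (-(2 * K)) x := by
      simpa using ((hasDerivAt_id x).const_mul (2 * K)).fun_neg
    exact h1.mul h2.exp
  have hanti : AntitoneOn (fun y : ℝ ↦ ‖entireXi y‖ ^ 2 * Real.exp (-(2 * K * y))) (Ici x₀) := by
    refine antitoneOn_of_deriv_nonpos (convex_Ici x₀)
      (fun x _ ↦ (hd x).continuousAt.continuousWithinAt)
      (fun x _ ↦ (hd x).differentiableAt.differentiableWithinAt) fun x hx ↦ ?_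
    rw [interior_Ici] at hx
    rw [(hd x).deriv]
    have h1 := hK x hx.le
    have h2 : 0 ≤ ‖entireXi x‖ ^ 2 * Real.exp (-(2 * K * x)) := by positivity
    nlinarith
  set M : ℝ := ‖entireXi x₀‖ ^ 2 * Real.exp (-(2 * K * x₀)) with hM
  have hbound (m : ℕ) (hm : x₀ ≤ m) : (m ! * Real.pi⁻¹ ^ (m + 1) / 3) ^ 2 ≤
      M * Real.exp (4 * K * (m + 1)) := by
    have hm0 : (0 : ℝ) ≤ m := m.cast_nonneg
    have h1 : ‖entireXi ((2 * (m + 1 : ℕ) : ℝ) : ℂ)‖ ^ 2 *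
        Real.exp (-(2 * K * (2 * (m + 1 : ℕ) : ℝ))) ≤ M :=
      hanti (mem_Ici.mpr le_rfl) (mem_Ici.mpr (by push_cast; linarith)) (by push_cast; linarith)
    have h2 := factorial_mul_le_norm_entireXi m
    have hcast : ((2 * (m + 1 : ℕ) : ℝ) : ℂ) = 2 * (m + 1 : ℕ) := by push_cast; ring
    rw [hcast, Real.exp_neg, ← div_eq_mul_inv, div_le_iff₀ (Real.exp_pos _)] at h1
    have hπ := Real.pi_pos
    calc _ ≤ ‖entireXi (2 * (m + 1 : ℕ))‖ ^ 2 := by gcongr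
      _ ≤ _ := h1
      _ = _ := by push_cast; ring_nf
  have hlim := FloorSemiring.tendsto_pow_div_factorial_atTop (Real.pi * Real.exp (2 * K))
  have hlim' := ((hlim.const_mul (3 * Real.pi * Real.exp (2 * K))).pow 2).const_mul M
  rw [mul_zero, zero_pow two_ne_zero, mul_zero] at hlim'
  obtain ⟨m, hm1, hm2⟩ := ((hlim'.eventually_lt_const (zero_lt_one' ℝ)).and
    (eventually_ge_atTop ⌈x₀⌉₊)).exists
  have hb := hbound m (Nat.ceil_le.mp hm2)
  have hfac : (0 : ℝ) < m ! := by exact_mod_cast Nat.factorial_pos m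
  have hexp : Real.exp (4 * K * (m + 1)) = (Real.exp (2 * K) ^ (m + 1)) ^ 2 := by
    rw [← pow_mul, ← Real.exp_nat_mul]
    push_cast
    ring_nf
  have hπ := Real.pi_pos
  rw [hexp] at hb
  have heq : M * (3 * Real.pi * Real.exp (2 * K) *
      ((Real.pi * Real.exp (2 * K)) ^ m / m !)) ^ 2 =
      M * (Real.exp (2 * K) ^ (m + 1)) ^ 2 / (m ! * Real.pi⁻¹ ^ (m + 1) / 3) ^ 2 := by
    rw [inv_pow]
    field_simp
    ring
  rw [heq, div_lt_one (by positivity)] at hm1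
  linarith

/-- Cauchy's formula for Taylor coefficients, as a circle average. -/
lemma circleAverage_inv_pow_mul {f : ℂ → ℂ} {R r : ℝ}
    (hf : DifferentiableOn ℂ f (Metric.ball 0 R)) (hr : 0 < r) (hrR : r < R) (k : ℕ) :
    Real.circleAverage (fun z ↦ (z ^ k)⁻¹ * f z) 0 r = iteratedDeriv k f 0 / k ! := by
  lift r to NNReal using hr.le
  have hp := (hf.mono (Metric.closedBall_subset_ball hrR)).hasFPowerSeriesOnBall
    (NNReal.coe_pos.mp hr)
  have h1 := hp.factorial_smul 1 k
  rw [cauchyPowerSeries_apply, ← iteratedDeriv_eq_iteratedFDeriv] at h1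
  rw [← h1, Real.circleAverage_eq_circleIntegral hr.ne', nsmul_eq_mul,
    mul_div_cancel_left₀ _ (Nat.cast_ne_zero.mpr k.factorial_ne_zero)]
  congr 2
  ext z
  simp only [sub_zero, smul_eq_mul, one_div, inv_pow]
  ring

/-- A summed Taylor coefficient of `(1 + z + ⋯ + z ^ (n - 1)) * g z`. -/
lemma sum_iteratedDeriv_geom_mul {g : ℂ → ℂ} (hg : DifferentiableOn ℂ g (Metric.ball 0 1))
    (n : ℕ) :
    ∑ k ∈ Finset.range (n + 1),
        iteratedDeriv k (fun z ↦ (∑ j ∈ Finset.range (n + 1), z ^ j) * g z) 0 / (k ! : ℂ) =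
      iteratedDeriv n (fun z ↦ g z / (1 - z) ^ 2) 0 / n ! := by
  obtain ⟨r, hr, hr1⟩ := exists_between (zero_lt_one' ℝ)
  have hne (z : ℂ) (hz : z ∈ Metric.ball (0 : ℂ) 1) : 1 - z ≠ 0 := by
    rw [mem_ball_zero_iff] at hz
    refine sub_ne_zero.mpr fun h ↦ ?_
    simp [← h] at hz
  have hsub : Metric.closedBall (0 : ℂ) |r| ⊆ Metric.ball 0 1 := by
    rw [abs_of_pos hr]
    exact Metric.closedBall_subset_ball hr1
  have hD : Differentiable ℂ fun z : ℂ ↦ ∑ j ∈ Finset.range (n + 1), z ^ j := by fun_prop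
  have hH : DifferentiableOn ℂ (fun z ↦ (∑ j ∈ Finset.range (n + 1), z ^ j) * g z)
      (Metric.ball 0 1) := hD.differentiableOn.mul hg
  have hT : DifferentiableOn ℂ (fun z ↦ g z / (1 - z) ^ 2) (Metric.ball 0 1) :=
    hg.div (by fun_prop) fun z hz ↦ pow_ne_zero 2 (hne z hz)
  have hE : DifferentiableOn ℂ (fun z ↦ z * ((z ^ (n + 1) - 2) * (g z / (1 - z) ^ 2)))
      (Metric.ball 0 1) := by
    have : Differentiable ℂ fun z : ℂ ↦ z ^ (n + 1) - 2 := by fun_prop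
    exact differentiableOn_id.mul (this.differentiableOn.mul hT)
  have hz0 (z : ℂ) (hz : z ∈ Metric.sphere (0 : ℂ) |r|) : z ≠ 0 := by
    rintro rfl
    exact (abs_pos.mpr hr.ne').ne (by simpa using hz)
  have hint {f : ℂ → ℂ} (hf : DifferentiableOn ℂ f (Metric.ball 0 1)) (k : ℕ) :
      CircleIntegrable (fun z ↦ (z ^ k)⁻¹ * f z) 0 r := by
    refine ContinuousOn.circleIntegrable' (ContinuousOn.mul (ContinuousOn.inv₀ (by fun_prop)
      fun z hz ↦ pow_ne_zero k (hz0 z hz)) (hf.continuousOn.mono ?_))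
    exact Metric.sphere_subset_closedBall.trans hsub
  have hE0 : Real.circleAverage (fun z ↦ z * ((z ^ (n + 1) - 2) * (g z / (1 - z) ^ 2))) 0 r = 0 := by
    rw [DiffContOnCl.circleAverage, zero_mul]
    refine (hE.mono ?_).diffContOnCl
    exact Metric.closure_ball_subset_closedBall.trans hsub
  have hTE := Real.circleAverage_fun_add (hint hT n) (by simpa using hint hE 0)
  rw [hE0, add_zero, circleAverage_inv_pow_mul hT hr hr1] at hTE
  rw [← hTE]
  simp_rw [← circleAverage_inv_pow_mul hH hr hr1]
  rw [← Real.circleAverage_fun_sum fun k _ ↦ hint hH k]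
  refine Real.circleAverage_congr_sphere fun z hz ↦ ?_
  have h1 := hne z (hsub (Metric.sphere_subset_closedBall hz))
  have h0 := hz0 z hz
  have e1 : (∑ j ∈ Finset.range (n + 1), z ^ j) = (1 - z ^ (n + 1)) / (1 - z) := by
    rw [eq_div_iff h1, geom_sum_mul_neg]
  have e2 : ∑ k ∈ Finset.range (n + 1), (z ^ k)⁻¹ = ((z ^ n)⁻¹ - z) / (1 - z) := by
    rw [eq_div_iff h1]
    clear * - h0
    induction n with
    | zero => simp
    | succ n ih =>
      rw [Finset.sum_range_succ, add_mul, ih]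
      field_simp
      ring
  rw [← Finset.sum_mul, e1, e2]
  field_simp
  ring

lemma poissonKernel_le_geom_sum {n : ℕ} (hn : 1 ≤ n) {x r : ℝ} (hx : 0 ≤ x)
    (hxn : 1 - x ≤ 1 / (4 * n)) (hxr : (1 + x) / 2 ≤ r) (hr : r < 1) {z : ℂ} (hz : ‖z‖ = r) :
    (r ^ 2 - x ^ 2) / ‖z - x‖ ^ 2 ≤
      16 * n ^ 2 + 16 / (1 - x) * ‖∑ j ∈ Finset.range n, z ^ j‖ ^ 2 := by
  have hn1 : (1 : ℝ) ≤ n := by exact_mod_cast hn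
  have hx1 : 0 < 1 - x := by linarith
  have hzx : (1 - x) / 2 ≤ ‖z - x‖ := by
    have := norm_sub_norm_le z x
    rw [hz, norm_real, Real.norm_of_nonneg hx] at this
    linarith
  have hnum : r ^ 2 - x ^ 2 ≤ 2 * (r - x) := by nlinarith
  rcases le_total ‖1 - z‖ (1 / (2 * n)) with h | h
  · have hD : 1 / 2 ≤ ‖∑ j ∈ Finset.range n, z ^ j‖ := by
      have hterm (j : ℕ) (hj : j ∈ Finset.range n) : ‖1 - z ^ j‖ ≤ 1 / 2 := by
        rw [Finset.mem_range] at hj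
        have hj' : (j : ℝ) ≤ n := by exact_mod_cast hj.le
        rw [← mul_neg_geom_sum, norm_mul]
        have : ‖∑ i ∈ Finset.range j, z ^ i‖ ≤ j := by
          refine (norm_sum_le _ _).trans ?_
          calc _ ≤ ∑ i ∈ Finset.range j, (1 : ℝ) := by
                gcongr with i
                rw [norm_pow, hz]
                exact pow_le_one₀ (by linarith) hr.le
            _ = j := by simp
        calc _ ≤ 1 / (2 * n) * (n : ℝ) := by gcongr; exact this.trans hj'
          _ = 1 / 2 := by field_simp
      have hsum : ‖∑ j ∈ Finset.range n, (1 - z ^ j)‖ ≤ n * (1 / 2) := by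
        refine (norm_sum_le_of_le _ hterm).trans ?_
        simp
      rw [Finset.sum_sub_distrib] at hsum
      have := norm_sub_norm_le (∑ j ∈ Finset.range n, (1 : ℂ)) (∑ j ∈ Finset.range n, z ^ j)
      simp only [Finset.sum_const, Finset.card_range, nsmul_eq_mul, mul_one, norm_natCast]
        at this hsum
      linarith
    have hD2 : 1 / 4 ≤ ‖∑ j ∈ Finset.range n, z ^ j‖ ^ 2 := by nlinarith
    calc _ ≤ 4 / (1 - x) := by
          have hpos : 0 < ‖z - x‖ := by linarith
          rw [div_le_div_iff₀ (by positivity) hx1]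
          have h3 := norm_sub_norm_le z x
          rw [hz, norm_real, Real.norm_of_nonneg hx] at h3
          have h4 : (r - x) * ((1 - x) / 2) ≤ ‖z - x‖ ^ 2 := by
            rw [sq]
            gcongr
          nlinarith
      _ = 16 / (1 - x) * (1 / 4) := by ring
      _ ≤ 16 / (1 - x) * ‖∑ j ∈ Finset.range n, z ^ j‖ ^ 2 := by gcongr
      _ ≤ _ := le_add_of_nonneg_left (by positivity)
  · have h4 : 1 / (4 * n) ≤ ‖z - x‖ := by
      have h5 : ‖1 - z‖ ≤ ‖z - x‖ + (1 - x) := by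
        have h6 : 1 - z = ((1 - x : ℝ) : ℂ) - (z - x) := by push_cast; ring
        rw [h6]
        refine (norm_sub_le _ _).trans ?_
        rw [norm_real, Real.norm_of_nonneg hx1.le, add_comm]
      have : (1 : ℝ) / (2 * n) = 2 * (1 / (4 * n)) := by field_simp; norm_num
      linarith
    calc _ ≤ 1 / (1 / (4 * (n : ℝ))) ^ 2 := by
          gcongr
          nlinarith
      _ = 16 * n ^ 2 := by field_simp; norm_num
      _ ≤ _ := le_add_of_nonneg_right (by positivity)

/-- A Harnack-type inequality at real points near the boundary, for functions of nonnegative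
real part on the unit disc. -/
lemma re_le_of_re_nonneg {G : ℂ → ℂ} (hG : DifferentiableOn ℂ G (Metric.ball 0 1))
    (hre : ∀ z ∈ Metric.ball (0 : ℂ) 1, 0 ≤ (G z).re) (n : ℕ) {x : ℝ} (hx : 0 ≤ x) (hx1 : x < 1)
    (hxn : 1 - x ≤ 1 / (4 * (n + 1 : ℕ))) :
    (G x).re ≤ 16 * (n + 1 : ℕ) ^ 2 * (G 0).re +
      16 / (1 - x) * (iteratedDeriv n (fun z ↦ G z / (1 - z) ^ 2) 0 / (n ! : ℂ)).re := by
  set D : ℂ → ℂ := fun z ↦ ∑ j ∈ Finset.range (n + 1), z ^ j with hD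
  have hDd : Differentiable ℂ D := by fun_prop
  have hH : DifferentiableOn ℂ (fun z ↦ D z * G z) (Metric.ball 0 1) :=
    hDd.differentiableOn.mul hG
  set c : ℕ → ℂ := fun k ↦ iteratedDeriv k (fun z ↦ D z * G z) 0 / k ! with hc
  set K : ℝ := 16 / (1 - x) with hK
  have hbound (r : ℝ) (hxr : (1 + x) / 2 ≤ r) (hr : r < 1) :
      (G x).re ≤ 16 * (n + 1 : ℕ) ^ 2 * (G 0).re +
        K * (∑ k ∈ Finset.range (n + 1), ((r ^ 2 : ℝ) : ℂ) ^ k * c k).re := by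
    have hr0 : 0 < r := by linarith
    have habs : |r| = r := abs_of_pos hr0
    have hsub : Metric.closedBall (0 : ℂ) |r| ⊆ Metric.ball 0 1 := by
      rw [habs]
      exact Metric.closedBall_subset_ball hr
    have hsph := Metric.sphere_subset_closedBall.trans hsub
    have hz0 (z : ℂ) (hz : z ∈ Metric.sphere (0 : ℂ) |r|) : z ≠ 0 := by
      rintro rfl
      exact (abs_pos.mpr hr0.ne').ne (by simpa using hz)
    have hGr : DiffContOnCl ℂ G (Metric.ball 0 |r|) :=
      (hG.mono (Metric.closure_ball_subset_closedBall.trans hsub)).diffContOnCl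
    have hGi : CircleIntegrable G 0 r := (hG.continuousOn.mono hsph).circleIntegrable'
    have hHi (k : ℕ) : CircleIntegrable (fun z ↦ (z ^ k)⁻¹ * (D z * G z)) 0 r :=
      (ContinuousOn.mul (ContinuousOn.inv₀ (by fun_prop) fun z hz ↦ pow_ne_zero k (hz0 z hz))
        (hH.continuousOn.mono hsph)).circleIntegrable'
    set U : ℂ → ℂ := fun z ↦
      (((r ^ 2 - x ^ 2) / ‖z - x‖ ^ 2 : ℝ) : ℂ) * G z with hU
    set V : ℂ → ℂ := fun z ↦ ((16 * (n + 1 : ℕ) ^ 2 : ℝ) : ℂ) • G z +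
      (K : ℂ) • ∑ k ∈ Finset.range (n + 1),
        ((r ^ 2 : ℝ) : ℂ) ^ k • ((z ^ k)⁻¹ * (D z * G z)) with hV
    have hUi : CircleIntegrable U 0 r := by
      refine (ContinuousOn.mul ?_ (hG.continuousOn.mono hsph)).circleIntegrable'
      refine continuous_ofReal.comp_continuousOn (ContinuousOn.div (by fun_prop) (by fun_prop)
        fun z hz ↦ ?_)
      rw [mem_sphere_zero_iff_norm, habs] at hz
      have := norm_sub_norm_le z x
      rw [hz, norm_real, Real.norm_of_nonneg hx] at this
      have : 0 < ‖z - x‖ := by linarith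
      positivity
    have hsumi : CircleIntegrable (fun z ↦ ∑ k ∈ Finset.range (n + 1),
        ((r ^ 2 : ℝ) : ℂ) ^ k • ((z ^ k)⁻¹ * (D z * G z))) 0 r :=
      CircleIntegrable.fun_sum _ fun k _ ↦ (hHi k).const_fun_smul
    have hVi : CircleIntegrable V 0 r := hGi.const_fun_smul.add hsumi.const_fun_smul
    have hUavg : Real.circleAverage U 0 r = G x := by
      have hxm : (x : ℂ) ∈ Metric.ball (0 : ℂ) r := by
        rw [mem_ball_zero_iff, norm_real, Real.norm_of_nonneg hx]
        linarith
      rw [habs] at hGr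
      rw [← hGr.circleAverage_poissonKernel_smul' hxm]
      refine Real.circleAverage_congr_sphere fun z hz ↦ ?_
      rw [mem_sphere_zero_iff_norm, habs] at hz
      simp only [hU, sub_zero, hz, norm_real, Real.norm_of_nonneg hx, real_smul]
    have hVavg : Real.circleAverage V 0 r = ((16 * (n + 1 : ℕ) ^ 2 : ℝ) : ℂ) * G 0 +
        K * ∑ k ∈ Finset.range (n + 1), ((r ^ 2 : ℝ) : ℂ) ^ k * c k := by
      rw [hV, Real.circleAverage_fun_add hGi.const_fun_smul hsumi.const_fun_smul,
        Real.circleAverage_fun_smul, Real.circleAverage_fun_smul, hGr.circleAverage,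
        Real.circleAverage_fun_sum fun k _ ↦ (hHi k).const_fun_smul]
      simp_rw [Real.circleAverage_fun_smul, circleAverage_inv_pow_mul hH hr0 hr, smul_eq_mul, hc]
    have hre1 := reCLM.circleAverage_comp_comm hUi
    have hre2 := reCLM.circleAverage_comp_comm hVi
    rw [hUavg, reCLM_apply] at hre1
    rw [hVavg, reCLM_apply, add_re, re_ofReal_mul, re_ofReal_mul] at hre2
    rw [← hre1, ← hre2]
    have hcomp {f : ℂ → ℂ} (hf : CircleIntegrable f 0 r) : CircleIntegrable (reCLM ∘ f) 0 r := by
      simp only [CircleIntegrable, intervalIntegrable_iff] at hf ⊢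
      exact reCLM.integrable_comp hf
    refine Real.circleAverage_mono (hcomp hUi) (hcomp hVi) fun z hz ↦ ?_
    have hzG := hre z (hsph hz)
    have hz0 := hz0 z hz
    rw [mem_sphere_zero_iff_norm, habs] at hz
    have hVz : V z = ((16 * (n + 1 : ℕ) ^ 2 + K * ‖D z‖ ^ 2 : ℝ) : ℂ) * G z := by
      have hconj : ∑ k ∈ Finset.range (n + 1), ((r ^ 2 : ℝ) : ℂ) ^ k * (z ^ k)⁻¹ =
          starRingEnd ℂ (D z) := by
        rw [hD, map_sum]
        refine Finset.sum_congr rfl fun k _ ↦ ?_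
        rw [map_pow, ← inv_pow, ← mul_pow, ← hz, ofReal_pow, ← mul_conj']
        field_simp
      simp only [hV, smul_eq_mul, ← mul_assoc]
      rw [← Finset.sum_mul, ← Finset.sum_mul, hconj]
      push_cast
      rw [← conj_mul']
      ring
    have hle := mul_le_mul_of_nonneg_right
      (poissonKernel_le_geom_sum (Nat.succ_le_succ n.zero_le) hx hxn hxr hr hz) hzG
    simp only [Function.comp_apply, reCLM_apply, hVz, hU]
    rw [re_ofReal_mul, re_ofReal_mul]
    exact hle
  rw [← sum_iteratedDeriv_geom_mul hG n]
  have hcont : Continuous fun r : ℝ ↦ 16 * ((n + 1 : ℕ) : ℝ) ^ 2 * (G 0).re +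
      K * (∑ k ∈ Finset.range (n + 1), ((r ^ 2 : ℝ) : ℂ) ^ k * c k).re := by fun_prop
  have hlim := (hcont.tendsto 1).mono_left (nhdsWithin_le_nhds (s := Iio 1))
  simp only [one_pow, ofReal_one, one_mul] at hlim
  refine ge_of_tendsto hlim ?_
  filter_upwards [Ico_mem_nhdsLT (show (1 + x) / 2 < 1 by linarith)] with r hr
  exact hbound r hr.1 hr.2

lemma one_sub_ne_zero_of_norm_lt_one {z : ℂ} (hz : ‖z‖ < 1) : 1 - z ≠ 0 := by
  refine sub_ne_zero.mpr fun h ↦ ?_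
  simp [← h] at hz

/-- The Möbius transformation `z ↦ 1 / (1 - z)` maps the unit disc to the right of the critical
line. -/
lemma one_half_lt_re_one_div_one_sub {z : ℂ} (hz : ‖z‖ < 1) : 1 / 2 < (1 / (1 - z)).re := by
  have hpos : 0 < normSq (1 - z) := normSq_pos.mpr (one_sub_ne_zero_of_norm_lt_one hz)
  have hz2 : normSq z < 1 := by
    rw [normSq_eq_norm_sq]
    nlinarith [norm_nonneg z]
  rw [one_div (1 - z), inv_re, lt_div_iff₀ hpos]
  rw [normSq_apply] at hz2 ⊢
  simp only [sub_re, sub_im, one_re, one_im]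
  nlinarith

lemma hasDerivAt_one_div_one_sub {z : ℂ} (hz : ‖z‖ < 1) :
    HasDerivAt (fun z : ℂ ↦ 1 / (1 - z)) (1 / (1 - z) ^ 2) z := by
  have h := ((hasDerivAt_id z).const_sub 1).fun_inv (one_sub_ne_zero_of_norm_lt_one hz)
  simpa using h

/-- On discs where `2ξ(1 / (1 - z))` has no zeros, it has a logarithm with the same Taylor
coefficients as `PhiKL`. -/
lemma exists_log_entireXi_one_div_one_sub {r : ℝ} (hr : 0 < r) (hr1 : r ≤ 1)
    (hne : ∀ z ∈ Metric.ball (0 : ℂ) r, entireXi (1 / (1 - z)) ≠ 0) :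
    ∃ L : ℂ → ℂ, L 0 = 0 ∧ PhiKL =ᶠ[𝓝 0] L ∧ ∀ z ∈ Metric.ball (0 : ℂ) r,
      exp (L z) = entireXi (1 / (1 - z)) ∧
      HasDerivAt L (logDeriv entireXi (1 / (1 - z)) / (1 - z) ^ 2) z := by
  have hball {z : ℂ} (hz : z ∈ Metric.ball (0 : ℂ) r) : ‖z‖ < 1 :=
    (mem_ball_zero_iff.mp hz).trans_le hr1
  have hd (z : ℂ) (hz : z ∈ Metric.ball (0 : ℂ) r) :=
    hasDerivAt_one_div_one_sub (hball hz)
  obtain ⟨L, hL0, hL⟩ := exists_differentiableOn_log_ball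
    (f := fun z ↦ entireXi (1 / (1 - z))) (fun z hz ↦ (differentiable_entireXi _).comp z
      (hd z hz).differentiableAt |>.differentiableWithinAt) hne hr
  have hL0' : L 0 = 0 := by rw [hL0]; simp [entireXi_one]
  refine ⟨L, hL0', ?_, fun z hz ↦ ⟨(hL z hz).1, ?_⟩⟩
  · have hcont := (hL 0 (Metric.mem_ball_self hr)).2.continuousAt
    have him : ∀ᶠ z in 𝓝 0, (L z).im ∈ Ioo (-Real.pi) Real.pi := by
      refine (continuous_im.continuousAt.comp hcont).eventually_mem (Ioo_mem_nhds ?_ ?_) <;>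
        simp [hL0', Real.pi_pos]
    filter_upwards [him, Metric.ball_mem_nhds 0 hr] with z hz hzr
    rw [PhiKL, xi2_eq_entireXi (by linarith [one_half_lt_re_one_div_one_sub (hball hzr)]),
      ← (hL z hzr).1, log_exp hz.1 hz.2.le]
  · refine (hL z hz).2.congr_deriv ?_
    have h := logDeriv_comp (f := entireXi) (g := fun z ↦ 1 / (1 - z)) (x := z)
      (differentiable_entireXi _) (hd z hz).differentiableAt
    rw [(hd z hz).deriv] at h
    rw [div_eq_mul_one_div, ← h]
    rfl

lemma lambdaL_succ (n : ℕ) : lambdaL (n + 1) = (iteratedDeriv (n + 1) PhiKL 0 / (n ! : ℂ)).re := by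
  rw [lambdaL, lambdaK, ← re_ofReal_mul]
  congr 1
  rw [Nat.factorial_succ]
  have : (n ! : ℂ) ≠ 0 := Nat.cast_ne_zero.mpr n.factorial_ne_zero
  have : (n : ℂ) + 1 ≠ 0 := Nat.cast_add_one_ne_zero n
  push_cast
  field_simp

/-- Li's criterion: Li's constants are positive if the Riemann hypothesis holds. -/
lemma lambdaL_succ_pos (hX : ∀ s : ℂ, 1 / 2 < s.re → entireXi s ≠ 0) (n : ℕ) :
    0 < lambdaL (n + 1) := by
  set G : ℂ → ℂ := fun z ↦ logDeriv entireXi (1 / (1 - z)) with hG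
  have hhalf {z : ℂ} (hz : z ∈ Metric.ball (0 : ℂ) 1) : 1 / 2 < (1 / (1 - z)).re :=
    one_half_lt_re_one_div_one_sub (mem_ball_zero_iff.mp hz)
  obtain ⟨L, -, hPhi, hL⟩ := exists_log_entireXi_one_div_one_sub one_pos le_rfl
    fun z hz ↦ hX _ (hhalf hz)
  have hGd : DifferentiableOn ℂ G (Metric.ball 0 1) := fun z hz ↦ by
    have h1 : DifferentiableAt ℂ (logDeriv entireXi) (1 / (1 - z)) :=
      (differentiable_entireXi.differentiableOn.deriv isOpen_univ |>.differentiableAt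
        univ_mem).div (differentiable_entireXi _) (hX _ (hhalf hz))
    exact (h1.comp z (hasDerivAt_one_div_one_sub
      (mem_ball_zero_iff.mp hz)).differentiableAt).differentiableWithinAt
  have hcoeff : lambdaL (n + 1) = (iteratedDeriv n (fun z ↦ G z / (1 - z) ^ 2) 0 / (n ! : ℂ)).re := by
    have hderiv : deriv L =ᶠ[𝓝 0] fun z ↦ G z / (1 - z) ^ 2 := by
      filter_upwards [Metric.ball_mem_nhds 0 one_pos] with z hz using (hL z hz).2.deriv
    rw [lambdaL_succ, hPhi.iteratedDeriv_eq, iteratedDeriv_succ', hderiv.iteratedDeriv_eq]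
  by_contra! hle
  set N : ℝ := ((n + 1 : ℕ) : ℝ) with hN
  have hN1 : 1 ≤ N := by simp [hN]
  obtain ⟨y, hy, hK⟩ := exists_lt_re_logDeriv_entireXi (16 * N ^ 2 * (G 0).re) (4 * N)
  have hy0 : 0 < y := by linarith
  have hsub : 1 - (1 - 1 / y) = 1 / y := by ring
  have hy1 : 1 / y ≤ 1 := by rw [div_le_one hy0]; linarith
  have hH := re_le_of_re_nonneg hGd (fun z hz ↦ re_logDeriv_entireXi_nonneg hX (hhalf hz)) n
    (x := 1 - 1 / y) (by linarith) (by linarith [one_div_pos.mpr hy0])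
    (by rw [hsub]; gcongr)
  have hGy : G ((1 - 1 / y : ℝ) : ℂ) = logDeriv entireXi y := by
    simp only [hG]
    push_cast
    simp
  rw [hGy, ← hcoeff, hsub] at hH
  have : 16 / (1 / y) * lambdaL (n + 1) ≤ 0 :=
    mul_nonpos_of_nonneg_of_nonpos (by positivity) hle
  linarith

/-- Positivity of the Taylor coefficients forces the modulus to be smallest on the real axis. -/
lemma one_le_norm_entireXi_mul (hpos : ∀ n, 0 < lambdaL (n + 1)) {r : ℝ} (hr1 : r ≤ 1)
    (hne : ∀ z ∈ Metric.ball (0 : ℂ) r, entireXi (1 / (1 - z)) ≠ 0) {z : ℂ} (hz : ‖z‖ < r) :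
    1 ≤ ‖entireXi (1 / (1 - z))‖ * ‖entireXi (1 / (1 - (‖z‖ : ℂ)))‖ := by
  obtain ⟨L, hL0, hPhi, hL⟩ := exists_log_entireXi_one_div_one_sub ((norm_nonneg z).trans_lt hz)
    hr1 hne
  have hLd : DifferentiableOn ℂ L (Metric.ball 0 r) :=
    fun w hw ↦ (hL w hw).2.differentiableAt.differentiableWithinAt
  have hz1 : z ∈ Metric.ball (0 : ℂ) r := mem_ball_zero_iff.mpr hz
  have hz2 : starRingEnd ℂ z ∈ Metric.ball (0 : ℂ) r := by simpa using hz
  have hz3 : (‖z‖ : ℂ) ∈ Metric.ball (0 : ℂ) r := by simpa using hz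
  have hconj : ‖entireXi (1 / (1 - starRingEnd ℂ z))‖ = ‖entireXi (1 / (1 - z))‖ := by
    rw [← norm_conj (entireXi (1 / (1 - z))), ← entireXi_conj]
    simp
  have hnorm (w : ℂ) (hw : w ∈ Metric.ball (0 : ℂ) r) :
      ‖entireXi (1 / (1 - w))‖ = Real.exp (L w).re := by
    rw [← (hL w hw).1, norm_exp]
  have hre : (L (starRingEnd ℂ z)).re = (L z).re := by
    rwa [hnorm z hz1, hnorm _ hz2, Real.exp_eq_exp] at hconj
  have h1 := hasSum_taylorSeries_on_ball hLd hz1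
  have h2 := hasSum_taylorSeries_on_ball hLd hz2
  have h3 := hasSum_taylorSeries_on_ball hLd hz3
  have hsum := hasSum_re ((h1.add h2).add (h3.mul_left 2))
  rw [hnorm z hz1, hnorm _ hz3, ← Real.exp_add, Real.one_le_exp_iff]
  have hnonneg := hsum.nonneg fun n ↦ ?_
  · simp only [add_re, mul_re, re_ofNat, im_ofNat, hre] at hnonneg
    linarith
  · cases n with
    | zero => simp [hL0]
    | succ n =>
      have hc := hpos n
      rw [lambdaL_succ, hPhi.iteratedDeriv_eq] at hc
      have key : ((n + 1)! : ℂ)⁻¹ • (z - 0) ^ (n + 1) • iteratedDeriv (n + 1) L 0 +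
          ((n + 1)! : ℂ)⁻¹ • (starRingEnd ℂ z - 0) ^ (n + 1) • iteratedDeriv (n + 1) L 0 +
          2 * (((n + 1)! : ℂ)⁻¹ • ((‖z‖ : ℂ) - 0) ^ (n + 1) • iteratedDeriv (n + 1) L 0) =
          ((n ! / (n + 1)! * (2 * ((z ^ (n + 1)).re + ‖z‖ ^ (n + 1))) : ℝ) : ℂ) *
            (iteratedDeriv (n + 1) L 0 / n !) := by
        have hadd := add_conj (z ^ (n + 1))
        rw [map_pow] at hadd
        have : (n ! : ℂ) ≠ 0 := Nat.cast_ne_zero.mpr n.factorial_ne_zero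
        simp only [smul_eq_mul, sub_zero]
        push_cast at hadd ⊢
        field_simp
        linear_combination iteratedDeriv (n + 1) L 0 * ((n + 1)! : ℂ)⁻¹ * hadd
      rw [key, re_ofReal_mul]
      have := neg_le_of_abs_le (abs_re_le_norm (z ^ (n + 1)))
      rw [norm_pow] at this
      have h4 : 0 ≤ (z ^ (n + 1)).re + ‖z‖ ^ (n + 1) := by linarith
      positivity

lemma entireXi_one_div_one_sub_ne_zero (hpos : ∀ n, 0 < lambdaL (n + 1)) {z : ℂ} (hz : ‖z‖ < 1) :
    entireXi (1 / (1 - z)) ≠ 0 := by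
  intro h0
  have hcont : ContinuousOn (fun w ↦ entireXi (1 / (1 - w))) (Metric.ball 0 1) := fun w hw ↦
    (differentiable_entireXi.continuous.continuousAt.comp (hasDerivAt_one_div_one_sub
      (mem_ball_zero_iff.mp hw)).continuousAt).continuousWithinAt
  have hsub : Metric.closedBall (0 : ℂ) ‖z‖ ⊆ Metric.ball 0 1 := Metric.closedBall_subset_ball hz
  have hclosed : IsCompact (Metric.closedBall (0 : ℂ) ‖z‖ ∩
      (fun w ↦ entireXi (1 / (1 - w))) ⁻¹' {0}) :=
    (isCompact_closedBall _ _).of_isClosed_subset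
      ((hcont.mono hsub).preimage_isClosed_of_isClosed Metric.isClosed_closedBall
        isClosed_singleton) inter_subset_left
  obtain ⟨w, ⟨hwz, hw0⟩, hmin⟩ := hclosed.exists_isMinOn ⟨z, by simp, h0⟩
    continuous_norm.continuousOn
  have hwz' : ‖w‖ ≤ ‖z‖ := mem_closedBall_zero_iff.mp hwz
  have hne (v : ℂ) (hv : v ∈ Metric.ball (0 : ℂ) ‖w‖) : entireXi (1 / (1 - v)) ≠ 0 := by
    rw [mem_ball_zero_iff] at hv
    intro hv0
    have : ‖w‖ ≤ ‖v‖ := hmin ⟨mem_closedBall_zero_iff.mpr (hv.le.trans hwz'), hv0⟩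
    linarith
  have hw : 0 < ‖w‖ := by
    rw [norm_pos_iff]
    rintro rfl
    simp [entireXi_one] at hw0
  set F : ℝ → ℝ := fun t ↦ ‖entireXi (1 / (1 - t * w))‖ * ‖entireXi (1 / (1 - (‖t * w‖ : ℂ)))‖
  have hF : ContinuousAt F 1 := by
    have hAt (v : ℂ) (hv : ‖v‖ < 1) : ContinuousAt (fun w ↦ entireXi (1 / (1 - w))) v :=
      hcont.continuousAt (Metric.isOpen_ball.mem_nhds (mem_ball_zero_iff.mpr hv))
    have h1 : ContinuousAt (fun t : ℝ ↦ (t : ℂ) * w) 1 := by fun_prop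
    have h2 : ContinuousAt (fun t : ℝ ↦ (‖t * w‖ : ℂ)) 1 := by fun_prop
    refine ((hAt _ ?_).comp h1).norm.mul ((hAt _ ?_).comp h2).norm <;>
    · simpa using hwz'.trans_lt hz
  have hF1 : F 1 = 0 := by
    have : entireXi (1 / (1 - w)) = 0 := hw0
    simp [F, one_div] at this ⊢
    exact Or.inl this
  have hlim : 1 ≤ F 1 := by
    refine ge_of_tendsto (hF.tendsto.mono_left (nhdsWithin_le_nhds (s := Iio 1))) ?_
    filter_upwards [Ioo_mem_nhdsLT (zero_lt_one' ℝ)] with t ht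
    refine one_le_norm_entireXi_mul hpos (hwz'.trans hz.le) hne ?_
    rw [norm_mul, norm_real, Real.norm_of_nonneg ht.1.le]
    exact mul_lt_of_lt_one_left hw ht.2
  linarith

/-- Li's criterion: the Riemann hypothesis holds if Li's constants are positive. -/
lemma entireXi_ne_zero_of_lambdaL_pos (hpos : ∀ n, 0 < lambdaL (n + 1)) {s : ℂ}
    (hs : 1 / 2 < s.re) : entireXi s ≠ 0 := by
  have hs0 : s ≠ 0 := by
    rintro rfl
    norm_num at hs
  have hnorm : ‖1 - 1 / s‖ < 1 := by
    rw [one_sub_div hs0, norm_div, div_lt_one (norm_pos_iff.mpr hs0),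
      ← sq_lt_sq₀ (norm_nonneg _) (norm_nonneg _), ← normSq_eq_norm_sq, ← normSq_eq_norm_sq,
      normSq_apply, normSq_apply]
    simp only [sub_re, sub_im, one_re, one_im]
    nlinarith
  simpa using entireXi_one_div_one_sub_ne_zero hpos hnorm

/-- **Li's criterion**: RH holds iff `λ_n^L > 0` for every `n ≥ 1`. -/
theorem li_criterion : RiemannHypothesis ↔ ∀ n : ℕ, 1 ≤ n → 0 < lambdaL n := by
  rw [riemannHypothesis_iff_entireXi_ne_zero]
  refine ⟨fun hX n hn ↦ ?_, fun hpos s hs ↦ ?_⟩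
  · obtain ⟨m, rfl⟩ := Nat.exists_eq_add_of_le' hn
    exact lambdaL_succ_pos hX m
  · exact entireXi_ne_zero_of_lambdaL_pos (fun n ↦ hpos (n + 1) (Nat.le_add_left 1 n)) hs
end
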